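/- Fix integers N ≥ 2 and d ≥ 2 with N > 2^d·(d−1), and let F ∈ ℤ[x₀,…,x_N] be homogeneous of degree d defining a smooth hypersurface, i.e. for every nonzero z ∈ ℂ^{N+1} with F(z) = 0 the gradient (∂F/∂x₀(z),…,∂F/∂x_N(z)) is nonzero. Let g ∈ ℚ[x₀,…,x_N] be a homogeneous polynomial for which there exists a nonzero z ∈ ℂ^{N+1} with F(z) = 0 and g(z) ≠ 0. Then there exist δ > 0, γ ∈ [0,1) and C > 0 such that for all B ≥ 2, the number of primitive vectors x ∈ ℤ^{N+1} satisfying F(x) = 0, g(x) = 0 and ‖x‖∞^{N+1−d} ≤ B is at most C·B^{1−δ}·(log B)^γ. -/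

import Mathlib

noncomputable section
open MvPolynomial

/-- A vector of integers is primitive if the gcd of its coordinates is `1`. -/
def IsPrimitiveVec {k : ℕ} (x : Fin k → ℤ) : Prop := Finset.gcd Finset.univ x = 1

/-- The sup-norm `max_i |x_i|` of an integer vector. -/
def supNorm {k : ℕ} (x : Fin k → ℤ) : ℕ := Finset.univ.sup fun i => (x i).natAbs

namespace BirchThin

def Dlt {n : ℕ} {A : Type*} [AddCommGroup A] (h : Fin n → ℤ) (f : (Fin n → ℤ) → A) :
    (Fin n → ℤ) → A := fun x => f (x + h) - f x

def FD {n : ℕ} {A : Type*} [AddCommGroup A] : ℕ → ((Fin n → ℤ) → A) → Prop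
  | 0, f => ∀ x y, f x = f y
  | (k+1), f => ∀ h, FD k (Dlt h f)

def iterD {n : ℕ} {A : Type*} [AddCommGroup A] :
    (k : ℕ) → (Fin k → (Fin n → ℤ)) → ((Fin n → ℤ) → A) → (Fin n → ℤ) → A
  | 0, _, f => f
  | (k+1), v, f => iterD k (fun i => v i.succ) (Dlt (v 0) f)

section
variable {n : ℕ} {A : Type*} [AddCommGroup A]

lemma FD_mono_succ : ∀ (k : ℕ) (f : (Fin n → ℤ) → A), FD k f → FD (k+1) f
  | 0, f, hf => fun h x y => by simp [Dlt, hf (x+h) x, hf (y+h) y]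
  | (k+1), f, hf => fun h => FD_mono_succ k _ (hf h)

lemma FD_mono {k l : ℕ} (hkl : k ≤ l) {f : (Fin n → ℤ) → A} (hf : FD k f) : FD l f := by
  induction hkl with
  | refl => exact hf
  | step _ ih => exact FD_mono_succ _ _ ih

lemma Dlt_add (h : Fin n → ℤ) (f g : (Fin n → ℤ) → A) : Dlt h (f + g) = Dlt h f + Dlt h g := by
  ext x; simp [Dlt]; abel

lemma FD_add : ∀ (k : ℕ) (f g : (Fin n → ℤ) → A), FD k f → FD k g → FD k (f + g)
  | 0, f, g, hf, hg => fun x y => by simp [hf x y, hg x y]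
  | (k+1), f, g, hf, hg => fun h => by rw [Dlt_add]; exact FD_add k _ _ (hf h) (hg h)

lemma FD_const (k : ℕ) (c : A) : FD k (fun _ : Fin n → ℤ => c) :=
  FD_mono (Nat.zero_le k) (fun _ _ => rfl)

lemma FD_coord (i : Fin n) : FD 1 (fun x : Fin n → ℤ => x i) := by
  intro h x y; simp [Dlt]

lemma FD_shift : ∀ (k : ℕ) (f : (Fin n → ℤ) → A) (a : Fin n → ℤ), FD k f → FD k (fun x => f (x + a))
  | 0, f, a, hf => fun x y => hf _ _
  | (k+1), f, a, hf => fun h => by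
      have := FD_shift k (Dlt h f) a (hf h)
      convert this using 1
      ext x; simp [Dlt, add_right_comm]

lemma FD_mul_aux : ∀ (m k l : ℕ) (f g : (Fin n → ℤ) → ℤ), k + l = m → FD k f → FD l g → FD (k + l) (f * g) := by
  intro m
  induction m with
  | zero =>
    intro k l f g hm hf hg
    obtain ⟨rfl, rfl⟩ : k = 0 ∧ l = 0 := by omega
    intro x y; simp [hf x y, hg x y]
  | succ m ih =>
    intro k l f g hm hf hg
    rw [hm]
    intro h
    have e : Dlt h (f * g) = Dlt h f * (fun x => g (x + h)) + f * Dlt h g := by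
      ext x; simp [Dlt]; ring
    rw [e]
    apply FD_add
    · cases k with
      | zero =>
        have : Dlt h f = 0 := by ext x; simp [Dlt, hf (x+h) x]
        rw [this, zero_mul]; exact FD_const _ _
      | succ k =>
        have := ih k l (Dlt h f) (fun x => g (x + h)) (by omega) (hf h) (FD_shift _ _ _ hg)
        rwa [show k + l = m by omega] at this
    · cases l with
      | zero =>
        have : Dlt h g = 0 := by ext x; simp [Dlt, hg (x+h) x]
        rw [this, mul_zero]; exact FD_const _ _
      | succ l =>
        have := ih k l f (Dlt h g) (by omega) hf (hg h)
        rwa [show k + l = m by omega] at this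

lemma FD_mul {k l : ℕ} {f g : (Fin n → ℤ) → ℤ} (hf : FD k f) (hg : FD l g) : FD (k + l) (f * g) :=
  FD_mul_aux _ k l f g rfl hf hg

/-- A closure principle for polynomial functions. -/
lemma poly_closure (Q : ℕ → ((Fin n → ℤ) → ℤ) → Prop)
    (hmono : ∀ k l f, k ≤ l → Q k f → Q l f)
    (hconst : ∀ c : ℤ, Q 0 (fun _ => c)) (hcoord : ∀ i, Q 1 (fun x => x i))
    (hadd : ∀ k f g, Q k f → Q k g → Q k (f + g))
    (hmul : ∀ k l f g, Q k f → Q l g → Q (k + l) (f * g))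
    (F : MvPolynomial (Fin n) ℤ) (d : ℕ) (hF : F.totalDegree ≤ d) :
    Q d (fun x => eval x F) := by
  have hmon : ∀ (s : Fin n →₀ ℕ) (c : ℤ), Q (s.sum fun _ e => e) (fun x => eval x (monomial s c)) := by
    intro s c
    have e : (fun x : Fin n → ℤ => eval x (monomial s c)) =
        (fun _ => c) * ∏ i ∈ s.support, (fun x : Fin n → ℤ => x i ^ s i) := by
      ext x; simp [eval_monomial, Finsupp.prod]
    rw [e, ← zero_add (s.sum _)]
    apply hmul _ _ _ _ (hconst c)
    have hp : ∀ i m, Q m (fun x : Fin n → ℤ => x i ^ m) := by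
      intro i m
      induction m with
      | zero => simpa using hconst 1
      | succ m ih =>
        have := hmul _ _ _ _ ih (hcoord i)
        convert this using 1
        ext x; simp [pow_succ]
    have : ∀ t : Finset (Fin n), Q (∑ i ∈ t, s i) (∏ i ∈ t, (fun x : Fin n → ℤ => x i ^ s i)) := by
      intro t
      induction t using Finset.induction_on with
      | empty => rw [Finset.sum_empty, Finset.prod_empty]; exact hconst 1
      | insert a t ha ih =>
        rw [Finset.sum_insert ha, Finset.prod_insert ha]
        exact hmul _ _ _ _ (hp _ _) ih
    exact this _
  have hsum : ∀ t : Finset (Fin n →₀ ℕ), (∀ s ∈ t, s ∈ F.support) →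
      Q d (fun x => ∑ s ∈ t, eval x (monomial s (coeff s F))) := by
    intro t
    induction t using Finset.induction_on with
    | empty => intro _; simpa using hmono 0 d _ (Nat.zero_le _) (hconst 0)
    | insert a t ha ih =>
      intro h
      simp only [Finset.sum_insert ha]
      refine hadd _ _ _ (hmono _ _ _ ?_ (hmon a _)) (ih fun s hs => h s (Finset.mem_insert_of_mem hs))
      exact (le_totalDegree (h a (Finset.mem_insert_self _ _))).trans hF
  have := hsum F.support (fun s hs => hs)
  convert this using 2 with x
  rw [← map_sum, ← F.as_sum]

lemma FD_poly (F : MvPolynomial (Fin n) ℤ) (d : ℕ) (hF : F.totalDegree ≤ d) :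
    FD d (fun x => eval x F) :=
  poly_closure (fun k f => FD k f) (fun _ _ _ h => FD_mono h) (fun c => FD_const 0 c) FD_coord
    FD_add (fun _ _ _ _ => FD_mul) F d hF

/-! ### iterated differences via the group ring -/

abbrev GR (n : ℕ) := AddMonoidAlgebra ℤ (Fin n → ℤ)

def dl (h : Fin n → ℤ) : GR n := AddMonoidAlgebra.single h 1 - 1

def Lf (f : (Fin n → ℤ) → ℤ) : GR n →+ ℤ :=
  AddMonoidAlgebra.liftNC (AddMonoidHom.id ℤ) (fun m => f m.toAdd)

lemma Lf_single (f : (Fin n → ℤ) → ℤ) (a : Fin n → ℤ) (r : ℤ) :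
    Lf f (AddMonoidAlgebra.single a r) = r * f a := by
  simp [Lf]

lemma Lf_dl_mul (f : (Fin n → ℤ) → ℤ) (h : Fin n → ℤ) (r : GR n) :
    Lf f (dl h * r) = Lf (Dlt h f) r := by
  induction r using AddMonoidAlgebra.induction_linear with
  | zero => simp
  | add a b ha hb => rw [mul_add, map_add, map_add, ha, hb]
  | single m r =>
    rw [dl, sub_mul, one_mul, AddMonoidAlgebra.single_mul_single, map_sub, Lf_single, Lf_single, Lf_single,
      Dlt, add_comm h m]; ring

lemma iterD_eq : ∀ (k : ℕ) (v : Fin k → (Fin n → ℤ)) (f : (Fin n → ℤ) → ℤ) (x : Fin n → ℤ),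
    iterD k v f x = Lf f ((∏ i, dl (v i)) * AddMonoidAlgebra.single x 1)
  | 0, v, f, x => by simp [iterD, Lf_single]
  | (k+1), v, f, x => by
    rw [iterD, iterD_eq k, Fin.prod_univ_succ, mul_assoc, Lf_dl_mul]

lemma Lf_FD_zero : ∀ (k : ℕ) (f : (Fin n → ℤ) → ℤ) (_ : FD k f) (v : Fin (k+1) → (Fin n → ℤ)) (r : GR n),
    Lf f ((∏ i, dl (v i)) * r) = 0
  | 0, f, hf, v, r => by
    rw [Fin.prod_univ_one, Lf_dl_mul]
    have : Dlt (v 0) f = 0 := by ext x; simp [Dlt, hf (x + v 0) x]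
    rw [this]
    induction r using AddMonoidAlgebra.induction_linear with
    | zero => simp
    | add a b ha hb => rw [map_add, ha, hb, add_zero]
    | single m r => simp [Lf_single]
  | (k+1), f, hf, v, r => by
    rw [Fin.prod_univ_succ, mul_assoc, Lf_dl_mul]
    exact Lf_FD_zero k _ (hf _) _ r

/-- The polarization. -/
def Tf (f : (Fin n → ℤ) → ℤ) (d : ℕ) (v : Fin d → (Fin n → ℤ)) : ℤ := Lf f (∏ i, dl (v i))

lemma Tf_perm (f : (Fin n → ℤ) → ℤ) (d : ℕ) (v : Fin d → (Fin n → ℤ)) (σ : Equiv.Perm (Fin d)) :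
    Tf f d (v ∘ σ) = Tf f d v := by
  unfold Tf
  congr 1
  exact Equiv.prod_comp σ (fun i => dl (v i))

lemma dl_add (a b : Fin n → ℤ) : dl (a + b) = dl a + dl b + dl a * dl b := by
  have : (AddMonoidAlgebra.single (a + b) 1 : GR n) =
      AddMonoidAlgebra.single a 1 * AddMonoidAlgebra.single b 1 := by
    rw [AddMonoidAlgebra.single_mul_single]; simp
  unfold dl; rw [this]; ring

lemma Tf_update_add (f : (Fin n → ℤ) → ℤ) (d : ℕ) (hf : FD d f) (v : Fin d → (Fin n → ℤ))
    (i : Fin d) (a b : Fin n → ℤ) :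
    Tf f d (Function.update v i (a + b)) = Tf f d (Function.update v i a) + Tf f d (Function.update v i b) := by
  have key : ∀ c, (∏ j, dl (Function.update v i c j)) = dl c * ∏ j ∈ Finset.univ.erase i, dl (v j) := by
    intro c
    rw [← Finset.mul_prod_erase _ _ (Finset.mem_univ i)]
    congr 1
    · simp
    · apply Finset.prod_congr rfl
      intro j hj
      rw [Function.update_of_ne (Finset.ne_of_mem_erase hj)]
  have h0 : Lf f (dl a * dl b * ∏ j ∈ Finset.univ.erase i, dl (v j)) = 0 := by
    have := Lf_FD_zero d f hf (Fin.cons a (Function.update v i b)) 1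
    rw [Fin.prod_univ_succ] at this
    simp only [Fin.cons_zero, Fin.cons_succ, mul_one] at this
    rw [key b, ← mul_assoc] at this
    exact this
  unfold Tf
  rw [key, key, key, dl_add, add_mul, add_mul, map_add, map_add, h0, add_zero]

def Tm (f : (Fin n → ℤ) → ℤ) (d : ℕ) (hf : FD d f) :
    MultilinearMap ℤ (fun _ : Fin d => (Fin n → ℤ)) ℤ :=
  MultilinearMap.mk' (Tf f d) (Tf_update_add f d hf) (by
    intro v i c x
    let φ : (Fin n → ℤ) →+ ℤ := AddMonoidHom.mk' (fun x => Tf f d (Function.update v i x))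
      (fun a b => Tf_update_add f d hf v i a b)
    exact map_zsmul φ c x)

lemma Tm_apply (f : (Fin n → ℤ) → ℤ) (d : ℕ) (hf : FD d f) (v) : Tm f d hf v = Tf f d v := rfl

lemma iterD_Tm (f : (Fin n → ℤ) → ℤ) (k : ℕ) (hf : FD (k+1) f) (v : Fin k → (Fin n → ℤ)) (x : Fin n → ℤ) :
    iterD k v f x = iterD k v f 0 + Tm f (k+1) hf (Fin.snoc v x) := by
  rw [iterD_eq, iterD_eq, Tm_apply, Tf, Fin.prod_univ_castSucc]
  simp only [Fin.snoc_castSucc, Fin.snoc_last]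
  rw [← map_add, ← mul_add]
  congr 2
  rw [dl]
  have : (AddMonoidAlgebra.single (0 : Fin n → ℤ) 1 : GR n) = 1 := rfl
  rw [this]; ring

/-- diagonal values -/
lemma Tf_diag (F : MvPolynomial (Fin n) ℤ) (d : ℕ) (hF : F.IsHomogeneous d) (x : Fin n → ℤ) :
    Tf (fun x => eval x F) d (fun _ => x) = (d.factorial : ℤ) * eval x F := by
  have hom : ∀ c : ℤ, eval (c • x) F = c ^ d * eval x F := by
    intro c
    rw [eval_eq', eval_eq', Finset.mul_sum]
    apply Finset.sum_congr rfl
    intro s hs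
    have hs' : ∑ i, s i = d := by
      have := hF (mem_support_iff.mp hs)
      rw [← this, Finsupp.weight_apply, Finsupp.sum_fintype] <;> simp
    simp only [Pi.smul_apply, smul_eq_mul, mul_pow, Finset.prod_mul_distrib]
    rw [Finset.prod_pow_eq_pow_sum, hs']; ring
  have h1 : ∀ k (f : (Fin n → ℤ) → ℤ) (y : Fin n → ℤ), iterD k (fun _ => x) f y =
      ((fwdDiff (1 : ℤ))^[k] (fun c : ℤ => f (y + c • x))) 0 := by
    intro k
    induction k with
    | zero => intro f y; simp [iterD]
    | succ k ih =>
      intro f y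
      rw [iterD, ih, Function.iterate_succ_apply]
      have : (fun c : ℤ => Dlt x f (y + c • x)) = fwdDiff (1 : ℤ) (fun c : ℤ => f (y + c • x)) := by
        ext c
        simp [Dlt, fwdDiff, add_smul, add_assoc]
      rw [this]
  have h2 := iterD_eq d (fun _ => x) (fun x => eval x F) 0
  have h3 : (AddMonoidAlgebra.single (0 : Fin n → ℤ) 1 : GR n) = 1 := rfl
  rw [h3, mul_one] at h2
  unfold Tf
  rw [← h2, h1]
  simp only [zero_add, hom]
  have h4 : (fun c : ℤ => c ^ d * eval x F) = (eval x F) • (fun c : ℤ => c ^ d) := by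
    ext c; simp [mul_comm]
  rw [h4, fwdDiff_iter_const_smul, fwdDiff_iter_eq_factorial]
  simp [mul_comm]
end
end BirchThin

namespace BirchThin
section
variable {n : ℕ}

abbrev eb (j : Fin n) : Fin n → ℤ := Pi.single j 1

def Er (j : Fin n) (p : MvPolynomial (Fin n) ℤ) : (Fin n → ℤ) → ℤ :=
  fun x => eval (x + eb j) p - eval x p - eval x (pderiv j p)

lemma Er_add (j : Fin n) (p q : MvPolynomial (Fin n) ℤ) : Er j (p + q) = Er j p + Er j q := by
  ext x; simp [Er]; ring

lemma Er_mul_X (j i : Fin n) (p : MvPolynomial (Fin n) ℤ) : Er j (p * X i) =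
    Er j p * (fun x => x i) + Dlt (eb j) (fun x => eval x p) * (fun _ => (eb j : Fin n → ℤ) i) := by
  ext x
  simp only [Er, map_mul, eval_X, Derivation.leibniz, pderiv_X, Pi.add_apply, Pi.mul_apply, Dlt, smul_eq_mul, map_add]
  by_cases h : i = j
  · subst h; simp; ring
  · have h' : j ≠ i := fun e => h e.symm
    simp [Pi.single_eq_of_ne h]; ring

lemma Er_monomial (j : Fin n) : ∀ (m : ℕ) (s : Fin n →₀ ℕ) (c : ℤ), (s.sum fun _ e => e) = m →
    (m ≤ 1 → Er j (monomial s c) = 0) ∧ (∀ l, m = l + 2 → FD l (Er j (monomial s c))) := by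
  intro m
  induction m with
  | zero =>
    intro s c hs
    have : s = 0 := by
      ext i
      have := (Finsupp.sum_fintype s (fun _ e => e) (by simp)).symm.trans hs
      simpa using (Finset.sum_eq_zero_iff.mp this) i (Finset.mem_univ i)
    subst this
    refine ⟨fun _ => ?_, fun l hl => by omega⟩
    ext x
    have h0 : monomial (0 : Fin n →₀ ℕ) c = C c := rfl
    rw [h0]
    simp [Er]
  | succ m ih =>
    intro s c hs
    obtain ⟨i, hi⟩ : ∃ i, s i ≠ 0 := by
      by_contra h
      push Not at h
      have : s = 0 := by ext i; simp [h i]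
      subst this; simp at hs
    set s' := s - Finsupp.single i 1 with hs'
    have hss : s = s' + Finsupp.single i 1 := by
      rw [hs', tsub_add_cancel_of_le]
      rw [Finsupp.single_le_iff]; omega
    have hs'm : (s'.sum fun _ e => e) = m := by
      rw [hss, Finsupp.sum_add_index' (by simp) (by simp), Finsupp.sum_single_index rfl] at hs
      omega
    have hmon : monomial s c = monomial s' c * X i := by
      rw [hss, monomial_add_single, pow_one]
    have hfd : FD m (fun x => eval x (monomial s' c)) := by
      apply FD_poly
      have := totalDegree_monomial_le (R := ℤ) s' c
      rw [← hs'm]; exact this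
    obtain ⟨ih1, ih2⟩ := ih s' c hs'm
    rw [hmon, Er_mul_X]
    constructor
    · intro hm
      have hm0 : m = 0 := by omega
      subst hm0
      rw [ih1 (by omega)]
      have : Dlt (eb j) (fun x => eval x (monomial s' c)) = 0 := by
        ext x; exact sub_eq_zero.mpr (hfd (x + eb j) x)
      rw [this]; simp
    · intro l hl
      obtain rfl : m = l + 1 := by omega
      apply FD_add
      · cases l with
        | zero => rw [ih1 (by omega)]; rw [zero_mul]; exact FD_const _ _
        | succ l => exact FD_mul (ih2 l rfl) (FD_coord i)
      · have := FD_mul (hfd (eb j)) (FD_const 0 ((eb j : Fin n → ℤ) i))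
        exact this

lemma Er_FD (j : Fin n) (F : MvPolynomial (Fin n) ℤ) (l : ℕ) (hF : F.totalDegree ≤ l + 2) :
    FD l (Er j F) := by
  have hsum : ∀ t : Finset (Fin n →₀ ℕ), (∀ s ∈ t, s ∈ F.support) →
      FD l (Er j (∑ s ∈ t, (monomial s (coeff s F)))) := by
    intro t
    induction t using Finset.induction_on with
    | empty =>
      intro _
      have : Er j (∑ s ∈ (∅ : Finset (Fin n →₀ ℕ)), (monomial s (coeff s F))) = 0 := by
        ext x; simp [Er]
      rw [this]; exact FD_const _ _
    | insert a t ha ih =>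
      intro h
      rw [Finset.sum_insert ha, Er_add]
      refine FD_add _ _ _ ?_ (ih fun s hs => h s (Finset.mem_insert_of_mem hs))
      have hdeg := (le_totalDegree (h a (Finset.mem_insert_self _ _))).trans hF
      obtain ⟨h1, h2⟩ := Er_monomial j _ a (coeff a F) rfl
      by_cases hle : (a.sum fun _ e => e) ≤ 1
      · rw [h1 hle]; exact FD_const _ _
      · obtain ⟨l', hl'⟩ := Nat.exists_eq_add_of_le (show 2 ≤ (a.sum fun _ e => e) by omega)
        exact FD_mono (by omega) (h2 l' (by omega))
  have := hsum F.support (fun s hs => hs)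
  rwa [← F.as_sum] at this

lemma Lf_add_fun (f g : (Fin n → ℤ) → ℤ) (r : GR n) : Lf (f + g) r = Lf f r + Lf g r := by
  induction r using AddMonoidAlgebra.induction_linear with
  | zero => simp
  | add a b ha hb => rw [map_add, map_add, map_add, ha, hb]; ring
  | single m r => simp [Lf_single, mul_add]

/-- the polarization on the diagonal is the gradient -/
lemma Tf_grad (F : MvPolynomial (Fin n) ℤ) (l : ℕ) (hF : F.IsHomogeneous (l + 2)) (x : Fin n → ℤ) (j : Fin n) :
    Tf (fun x => eval x F) (l + 2) (Fin.snoc (fun _ : Fin (l+1) => x) (eb j)) =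
      ((l+1).factorial : ℤ) * eval x (pderiv j F) := by
  have h1 := Tf_diag (pderiv j F) (l+1) (by simpa using hF.pderiv (i := j)) x
  rw [← h1]
  unfold Tf
  rw [Fin.prod_univ_castSucc]
  simp only [Fin.snoc_castSucc, Fin.snoc_last]
  rw [mul_comm, Lf_dl_mul]
  have : Dlt (eb j) (fun x => eval x F) = (fun x => eval x (pderiv j F)) + Er j F := by
    ext x; simp [Dlt, Er]
  rw [this, Lf_add_fun]
  have h2 := Lf_FD_zero l (Er j F) (Er_FD j F l hF.totalDegree_le) (fun _ => x) 1
  rw [mul_one] at h2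
  rw [h2, add_zero]

end
end BirchThin

namespace BirchThin
section
variable {n : ℕ}

def Smooth (F : MvPolynomial (Fin n) ℤ) : Prop := ∀ z : Fin n → ℂ, z ≠ 0 →
      eval z (MvPolynomial.map (Int.castRingHom ℂ) F) = 0 →
      ∃ i, eval z (pderiv i (MvPolynomial.map (Int.castRingHom ℂ) F)) ≠ 0

abbrev mQ (F : MvPolynomial (Fin n) ℤ) : MvPolynomial (Fin n) ℚ := MvPolynomial.map (Int.castRingHom ℚ) F

lemma mQ_inj : Function.Injective (mQ (n := n)) :=
  MvPolynomial.map_injective _ Int.cast_injective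

lemma clear_denom (p : MvPolynomial (Fin n) ℚ) : ∃ (c : ℤ) (P : MvPolynomial (Fin n) ℤ), c ≠ 0 ∧ mQ P = C (c : ℚ) * p := by
  induction p using MvPolynomial.induction_on with
  | C a =>
    refine ⟨a.den, C a.num, by simp, ?_⟩
    simp only [mQ, map_C, ← C_mul]
    congr 1
    simp [Rat.den_mul_eq_num]
  | add p q hp hq =>
    obtain ⟨c, P, hc, h1⟩ := hp
    obtain ⟨c', P', hc', h2⟩ := hq
    refine ⟨c * c', C c' * P + C c * P', mul_ne_zero hc hc', ?_⟩
    simp only [mQ] at *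
    simp only [map_add, map_mul, h1, h2, map_C]
    simp; ring
  | mul_X p i hp =>
    obtain ⟨c, P, hc, h1⟩ := hp
    refine ⟨c, P * X i, hc, ?_⟩
    simp only [mQ] at *
    simp only [map_mul, h1, map_X]; ring

lemma clear_denom_fin {ι : Type*} [Fintype ι] (p : ι → MvPolynomial (Fin n) ℚ) :
    ∃ (c : ℤ) (P : ι → MvPolynomial (Fin n) ℤ), c ≠ 0 ∧ ∀ i, mQ (P i) = C (c : ℚ) * p i := by
  classical
  choose c P hc hP using fun i => clear_denom (p i)
  refine ⟨∏ i, c i, fun i => C (∏ j ∈ Finset.univ.erase i, c j) * P i, Finset.prod_ne_zero_iff.mpr fun i _ => hc i, ?_⟩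
  intro i
  have hP' := hP i
  rw [mQ] at hP'
  rw [mQ, map_mul, hP', map_C, ← mul_assoc, ← C_mul, ← Finset.mul_prod_erase _ _ (Finset.mem_univ i)]
  simp [mul_comm]

lemma hc_mul (p f : MvPolynomial (Fin n) ℚ) (m r : ℕ) (hf : f.IsHomogeneous r) :
    homogeneousComponent (m + r) (p * f) = homogeneousComponent m p * f := by
  have hp := sum_homogeneousComponent p
  have hpm : ∀ i, homogeneousComponent (m + r) (homogeneousComponent i p * f) = if m = i then homogeneousComponent i p * f else 0 := by
    intro i
    rw [homogeneousComponent_of_mem (n := i + r) ((homogeneousComponent_isHomogeneous i p).mul hf)]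
    simp
  have h1 : homogeneousComponent (m + r) (p * f) = ∑ i ∈ Finset.range (p.totalDegree + 1), if m = i then homogeneousComponent i p * f else 0 := by
    conv_lhs => rw [← hp, Finset.sum_mul, map_sum]
    exact Finset.sum_congr rfl fun i _ => hpm i
  rw [h1, Finset.sum_ite_eq]
  split_ifs with h
  · rfl
  · rw [homogeneousComponent_eq_zero, zero_mul]
    simp at h; omega

lemma smooth_null (F : MvPolynomial (Fin n) ℤ) (l : ℕ) (hF : F.IsHomogeneous (l+2)) (hs : Smooth F) :
    ∃ (c : ℤ) (m : ℕ) (h : Fin n → Fin n → MvPolynomial (Fin n) ℤ), c ≠ 0 ∧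
      (∀ i j, (h i j).IsHomogeneous m) ∧
      ∀ i, C c * X i ^ (m + (l+1)) = ∑ j, h i j * pderiv j F := by
  set I : Ideal (MvPolynomial (Fin n) ℚ) := Ideal.span (Set.range fun j => pderiv j (mQ F)) with hI
  have hh : ∀ j, (pderiv j (mQ F)).IsHomogeneous (l+1) := fun j => (hF.map _).pderiv
  have hmap : MvPolynomial.map (algebraMap ℚ ℂ) (mQ F) = MvPolynomial.map (Int.castRingHom ℂ) F := by
    rw [mQ, MvPolynomial.map_map]; congr 1
  have hae : ∀ (z : Fin n → ℂ) (j), aeval z (pderiv j (mQ F)) = eval z (pderiv j (MvPolynomial.map (Int.castRingHom ℂ) F)) := by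
    intro z j
    rw [← hmap, pderiv_map (φ := algebraMap ℚ ℂ), eval_map, aeval_def]
  have hzero : ∀ z ∈ zeroLocus ℂ I, z = 0 := by
    intro z hz
    by_contra hne
    rw [mem_zeroLocus_iff] at hz
    have hg : ∀ j, eval z (pderiv j (MvPolynomial.map (Int.castRingHom ℂ) F)) = 0 := by
      intro j
      rw [← hae]
      exact hz _ (Ideal.subset_span ⟨j, rfl⟩)
    have he := (hF.map (Int.castRingHom ℂ)).sum_X_mul_pderiv
    have he' := congrArg (eval z) he
    simp only [map_sum, map_mul, hg, mul_zero, Finset.sum_const_zero, map_nsmul] at he'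
    have h0 : eval z (MvPolynomial.map (Int.castRingHom ℂ) F) = 0 := by
      have := he'.symm
      rw [nsmul_eq_mul] at this
      rcases mul_eq_zero.mp this with h | h
      · exfalso; norm_cast at h
      · exact h
    obtain ⟨i, hi⟩ := hs z hne h0
    exact hi (hg i)
  have hrad : ∀ i, ∃ k, (X i : MvPolynomial (Fin n) ℚ) ^ k ∈ I := by
    intro i
    have : (X i : MvPolynomial (Fin n) ℚ) ∈ vanishingIdeal ℚ (zeroLocus ℂ I) := by
      rw [mem_vanishingIdeal_iff]
      intro z hz
      rw [hzero z hz]; simp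
    rw [vanishingIdeal_zeroLocus_eq_radical] at this
    exact this
  choose k hk using hrad
  set m := ∑ i, k i
  have hmem : ∀ i, (X i : MvPolynomial (Fin n) ℚ) ^ (m + (l+1)) ∈ I := by
    intro i
    have : k i ≤ m + (l+1) := (Finset.single_le_sum (f := k) (fun _ _ => Nat.zero_le _) (Finset.mem_univ i)).trans (by omega)
    rw [← Nat.add_sub_cancel' this, pow_add]
    exact Ideal.mul_mem_right _ _ (hk i)
  have hex : ∀ i, ∃ q : Fin n → MvPolynomial (Fin n) ℚ, ∑ j, q j * pderiv j (mQ F) = X i ^ (m + (l+1)) :=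
    fun i => Ideal.mem_span_range_iff_exists_fun.mp (hmem i)
  choose q hq using hex
  have hq' : ∀ i, ∑ j, homogeneousComponent m (q i j) * pderiv j (mQ F) = X i ^ (m + (l+1)) := by
    intro i
    have := congrArg (homogeneousComponent (m + (l+1))) (hq i)
    rw [map_sum] at this
    simp only [hc_mul _ _ _ _ (hh _)] at this
    rw [this]
    have hX : (X i ^ (m + (l+1)) : MvPolynomial (Fin n) ℚ) ∈ homogeneousSubmodule (Fin n) ℚ (m + (l+1)) := isHomogeneous_X_pow i _
    rw [homogeneousComponent_of_mem hX, if_pos rfl]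
  obtain ⟨c, P, hc, hP⟩ := clear_denom_fin (fun ij : Fin n × Fin n => homogeneousComponent m (q ij.1 ij.2))
  refine ⟨c, m, fun i j => P (i, j), hc, ?_, ?_⟩
  · intro i j
    apply IsHomogeneous.of_map (f := Int.castRingHom ℚ) Int.cast_injective
    have := hP (i, j)
    rw [mQ] at this
    rw [this]
    have h2 := (isHomogeneous_C (Fin n) (c : ℚ)).mul (homogeneousComponent_isHomogeneous m (q i j))
    rwa [zero_add] at h2
  · intro i
    apply mQ_inj
    have := hq' i
    simp only [mQ, map_sum, map_mul, map_C, map_pow, map_X, ← pderiv_map]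
    simp only [mQ] at hP this
    simp only [hP, mul_assoc, ← Finset.mul_sum, this]
    simp

end
end BirchThin

namespace BirchThin
section
variable {n : ℕ}

abbrev mP (p : ℕ) (F : MvPolynomial (Fin n) ℤ) : MvPolynomial (Fin n) (ZMod p) := MvPolynomial.map (Int.castRingHom (ZMod p)) F

lemma totalDegree_mP (p : ℕ) (F : MvPolynomial (Fin n) ℤ) : (mP p F).totalDegree ≤ F.totalDegree :=
  Finset.sup_mono (support_map_subset _ _)

lemma smooth_modp (F : MvPolynomial (Fin n) ℤ) (l : ℕ) (hF : F.IsHomogeneous (l+2)) (hs : Smooth F) :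
    ∃ c : ℤ, c ≠ 0 ∧ ∀ p : ℕ, p.Prime → ¬ (p : ℤ) ∣ c → ∀ x : Fin n → ZMod p,
      (∀ j, eval x (pderiv j (mP p F)) = 0) → x = 0 := by
  obtain ⟨c, m, h, hc, _, hh⟩ := smooth_null F l hF hs
  refine ⟨c, hc, fun p hp hpc x hx => ?_⟩
  have := Fact.mk hp
  ext i
  have := congrArg (fun P => eval x (mP p P)) (hh i)
  simp only [mP] at this hx
  simp only [map_mul, map_C, map_pow, map_X, map_sum, eval_C, eval_X, ← pderiv_map, hx, mul_zero, Finset.sum_const_zero] at this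
  rcases mul_eq_zero.mp this with h1 | h1
  · exact absurd ((ZMod.intCast_zmod_eq_zero_iff_dvd c p).mp (by simpa using h1)) hpc
  · exact pow_eq_zero_iff (by omega) |>.mp h1

lemma exists_prime_not_dvd (c : ℤ) (hc : c ≠ 0) (p : ℕ) (h : c.natAbs < p) : ¬ (p : ℤ) ∣ c := by
  intro hd
  have := Int.natAbs_dvd_natAbs.mpr hd
  have := Nat.le_of_dvd (Int.natAbs_pos.mpr hc) this
  simp at this; omega

lemma top_mul (A B : MvPolynomial (Fin n) ℚ) : homogeneousComponent (A.totalDegree + B.totalDegree) (A * B) =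
    homogeneousComponent A.totalDegree A * homogeneousComponent B.totalDegree B := by
  conv_lhs => rw [← sum_homogeneousComponent B, Finset.mul_sum, map_sum]
  rw [Finset.sum_range_succ, Finset.sum_eq_zero, zero_add, sum_homogeneousComponent, hc_mul]
  · exact homogeneousComponent_isHomogeneous _ _
  · intro j hj
    have hj' := Finset.mem_range.mp hj
    rw [sum_homogeneousComponent]
    have : A.totalDegree + B.totalDegree = (A.totalDegree + (B.totalDegree - j)) + j := by omega
    rw [this, hc_mul _ _ _ _ (homogeneousComponent_isHomogeneous j B), homogeneousComponent_eq_zero _ _ (by omega), zero_mul]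

lemma F_ne_zero (hn : 0 < n) (F : MvPolynomial (Fin n) ℤ) (l : ℕ) (hF : F.IsHomogeneous (l+2)) (hs : Smooth F) : F ≠ 0 := by
  rintro rfl
  obtain ⟨c, m, h, hc, _, hh⟩ := smooth_null (0 : MvPolynomial (Fin n) ℤ) l hF hs
  have := hh ⟨0, hn⟩
  simp only [map_zero, mul_zero, Finset.sum_const_zero] at this
  have h2 : (C c : MvPolynomial (Fin n) ℤ) * X ⟨0, hn⟩ ^ (m + (l+1)) ≠ 0 :=
    mul_ne_zero (by simpa using hc) (pow_ne_zero _ (X_ne_zero _))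
  exact h2 this

lemma eval_zero_hom {R : Type*} [CommRing R] {P : MvPolynomial (Fin n) R} {a : ℕ} (hP : P.IsHomogeneous a) (ha : 0 < a) :
    eval (0 : Fin n → R) P = 0 := by
  have := hP.coeff_eq_zero (d := 0) (by simp; omega)
  simpa [← constantCoeff_eq, constantCoeff_eq] using this

lemma smooth_prime (F : MvPolynomial (Fin n) ℤ) (l : ℕ) (hF : F.IsHomogeneous (l+2)) (hs : Smooth F)
    (hn : l + 2 < n) : Prime (mQ F) := by
  classical
  apply Irreducible.prime
  have hF0 : mQ F ≠ 0 := fun h => F_ne_zero (by omega) F l hF hs (mQ_inj (by simpa [mQ] using h))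
  have hFdeg : (mQ F).totalDegree = l + 2 := (hF.map _).totalDegree hF0
  have unit_of : ∀ A : MvPolynomial (Fin n) ℚ, A ≠ 0 → A.totalDegree = 0 → IsUnit A := by
    intro A hA h
    rw [totalDegree_eq_zero_iff_eq_C] at h
    rw [h] at hA ⊢
    exact (IsUnit.mk0 _ (fun h0 => hA (by rw [h0]; simp))).map C
  refine ⟨fun hu => ?_, fun A B hAB => ?_⟩
  · obtain ⟨r, hr, hr'⟩ := isUnit_iff_eq_C_of_isReduced.mp hu
    rw [hr', totalDegree_C] at hFdeg; omega
  · by_contra hcon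
    push Not at hcon
    have hA0 : A ≠ 0 := by rintro rfl; simp at hAB; exact hF0 hAB
    have hB0 : B ≠ 0 := by rintro rfl; simp at hAB; exact hF0 hAB
    have ha : 0 < A.totalDegree := Nat.pos_of_ne_zero fun h => hcon.1 (unit_of A hA0 h)
    have hb : 0 < B.totalDegree := Nat.pos_of_ne_zero fun h => hcon.2 (unit_of B hB0 h)
    have hab : A.totalDegree + B.totalDegree = l + 2 := by
      rw [← totalDegree_mul_of_isDomain hA0 hB0, ← hAB, hFdeg]
    have htop := top_mul A B
    rw [← hAB, hab, homogeneousComponent_of_mem (n := l+2) (hF.map _), if_pos rfl] at htop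
    obtain ⟨cA, P, hcA, hP⟩ := clear_denom (homogeneousComponent A.totalDegree A)
    obtain ⟨cB, Q, hcB, hQ⟩ := clear_denom (homogeneousComponent B.totalDegree B)
    have hom : ∀ (c : ℤ) (R : MvPolynomial (Fin n) ℤ) (S : MvPolynomial (Fin n) ℚ) (a : ℕ),
        mQ R = C (c : ℚ) * homogeneousComponent a S → R.IsHomogeneous a := by
      intro c R S a h
      apply IsHomogeneous.of_map (f := Int.castRingHom ℚ) Int.cast_injective
      rw [mQ] at h
      rw [h]
      have h2 := (isHomogeneous_C (Fin n) (c : ℚ)).mul (homogeneousComponent_isHomogeneous a S)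
      rwa [zero_add] at h2
    have hPh := hom _ _ _ _ hP
    have hQh := hom _ _ _ _ hQ
    have hPQ : C (cA * cB) * F = P * Q := by
      apply mQ_inj
      simp only [mQ] at hP hQ htop ⊢
      simp only [map_mul, hP, hQ, htop, map_C]
      simp; ring
    obtain ⟨c, hc, hmod⟩ := smooth_modp F l hF hs
    obtain ⟨p, hpl, hp⟩ := Nat.exists_infinite_primes ((c * (cA * cB)).natAbs + 1)
    have := Fact.mk hp
    have hnd := exists_prime_not_dvd _ (mul_ne_zero hc (mul_ne_zero hcA hcB)) p hpl
    have hnd1 : ¬ (p : ℤ) ∣ c := fun h => hnd (h.mul_right _)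
    have hnd2 : ¬ (p : ℤ) ∣ cA * cB := fun h => hnd (h.mul_left _)
    have hcw := char_dvd_card_solutions_of_add_lt p (f₁ := mP p P) (f₂ := mP p Q) (by
      have h1 := (totalDegree_mP p P).trans hPh.totalDegree_le
      have h2 := (totalDegree_mP p Q).trans hQh.totalDegree_le
      simp; omega)
    obtain ⟨⟨x, hx1, hx2⟩, hx0⟩ : ∃ x : {x : Fin n → ZMod p // eval x (mP p P) = 0 ∧ eval x (mP p Q) = 0}, x.1 ≠ 0 := by
      by_contra hall
      push Not at hall
      have : Fintype.card {x : Fin n → ZMod p // eval x (mP p P) = 0 ∧ eval x (mP p Q) = 0} = 1 := by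
        rw [Fintype.card_eq_one_iff]
        refine ⟨⟨0, eval_zero_hom (hPh.map _) ha, eval_zero_hom (hQh.map _) hb⟩, fun y => Subtype.ext (hall y)⟩
      rw [this] at hcw
      exact hp.one_lt.ne' (Nat.dvd_one.mp hcw)
    apply hx0
    apply hmod p hp hnd1 x
    intro j
    have h3 := congrArg (fun R => eval x (pderiv j (mP p R))) hPQ
    simp only [mP] at h3 hx1 hx2
    simp only [map_mul, Derivation.leibniz, map_C, pderiv_C, map_zero, mul_zero, add_zero, smul_eq_mul, map_add, hx1, hx2, zero_mul, eval_C] at h3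
    rcases mul_eq_zero.mp h3 with h | h
    · exfalso; apply hnd2
      rw [← ZMod.intCast_zmod_eq_zero_iff_dvd]
      simpa using h
    · exact h

end
end BirchThin

namespace BirchThin
section
variable {k : ℕ}

abbrev fse (R : Type*) [CommRing R] (k : ℕ) := MvPolynomial.finSuccEquiv R k

lemma lead_coeff {R : Type*} [CommRing R] (F : MvPolynomial (Fin (k+1)) R) (d : ℕ) (hF : F.IsHomogeneous d) :
    (fse R k F).coeff d = C (eval (Fin.cons 1 0) F) ∧ (fse R k F).natDegree ≤ d := by
  have hdeg : (fse R k F).natDegree ≤ d := by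
    rw [fse, natDegree_finSuccEquiv]; exact (degreeOf_le_totalDegree F 0).trans hF.totalDegree_le
  refine ⟨?_, hdeg⟩
  have h0 := hF.finSuccEquiv_coeff_isHomogeneous d 0 (by omega)
  rw [← totalDegree_zero_iff_isHomogeneous, totalDegree_eq_zero_iff_eq_C] at h0
  rw [eval_eq_eval_mv_eval', Polynomial.eval_eq_sum_range' (n := d + 1) (lt_of_le_of_lt Polynomial.natDegree_map_le (by simpa using Nat.lt_succ_of_le hdeg))]
  rw [Finset.sum_range_succ, Finset.sum_eq_zero]
  · rw [fse]
    simp only [Polynomial.coeff_map, one_pow, mul_one, zero_add]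
    conv_rhs => rw [h0]
    rw [eval_C]; exact h0
  · intro i hi
    have hi' := Finset.mem_range.mp hi
    have := hF.finSuccEquiv_coeff_isHomogeneous i (d - i) (by omega)
    simp only [Polynomial.coeff_map, one_pow, mul_one]
    exact eval_zero_hom this (by omega)

lemma fse_rename (R : Type*) [CommRing R] (r : MvPolynomial (Fin k) R) : fse R k (rename Fin.succ r) = Polynomial.C r := by
  induction r using MvPolynomial.induction_on with
  | C a => simp [fse, finSuccEquiv_apply]
  | add p q hp hq => simp [hp, hq]
  | mul_X p i hp => simp [hp, fse, finSuccEquiv_X_succ]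

lemma elim (F g : MvPolynomial (Fin (k+1)) ℤ) (d : ℕ) (hF : F.IsHomogeneous d)
    (h1 : eval (Fin.cons 1 0) F ≠ 0) (hp : Prime (mQ F)) (hng : ¬ mQ F ∣ mQ g) :
    ∃ (r : MvPolynomial (Fin k) ℤ) (a b : MvPolynomial (Fin (k+1)) ℤ), r ≠ 0 ∧ rename Fin.succ r = a * F + b * g := by
  set f := fse ℚ k (mQ F) with hf
  set G := fse ℚ k (mQ g) with hG
  have hfp : Prime f := (MulEquiv.prime_iff (fse ℚ k)).mpr hp
  have hfG : ¬ f ∣ G := fun h => hng ((map_dvd_iff (fse ℚ k)).mp h)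
  obtain ⟨hl, hdeg⟩ := lead_coeff (mQ F) d (hF.map _)
  set u : ℚ := eval (Fin.cons 1 0) (mQ F) with hu
  have hu0 : u ≠ 0 := by
    have : u = ((eval (Fin.cons 1 0) F : ℤ) : ℚ) := by
      rw [hu, mQ, eval_map]
      have h2 := eval₂_comp_left (Int.castRingHom ℚ) (RingHom.id ℤ) (Fin.cons 1 0 : Fin (k+1) → ℤ) F
      have h3 : (Int.castRingHom ℚ) ∘ (Fin.cons 1 0 : Fin (k+1) → ℤ) = (Fin.cons 1 0 : Fin (k+1) → ℚ) := by
        ext i; refine Fin.cases ?_ (fun j => ?_) i <;> simp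
      rw [RingHom.comp_id, h3] at h2
      rw [← h2]; rfl
    rw [this]; exact_mod_cast h1
  let I := Ideal.span {f}
  have hI : I.IsPrime := (Ideal.span_singleton_prime hfp.ne_zero).mpr hfp
  let S := Polynomial (MvPolynomial (Fin k) ℚ) ⧸ I
  have hdom : IsDomain S := Ideal.Quotient.isDomain I
  let m : Polynomial (MvPolynomial (Fin k) ℚ) := Polynomial.C (C u⁻¹) * f
  have hm : m.Monic := by
    apply Polynomial.monic_of_natDegree_le_of_coeff_eq_one d
    · exact (Polynomial.natDegree_C_mul_le _ _).trans hdeg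
    · rw [Polynomial.coeff_C_mul, hl, ← C_mul, inv_mul_cancel₀ hu0, C_1]
  have hmI : m ∈ I := Ideal.mul_mem_left _ _ (Ideal.mem_span_singleton_self f)
  have hmint := hm.quotient_isIntegral hmI
  have hx : (Ideal.Quotient.mk I G : S) ≠ 0 := by
    intro h
    rw [Ideal.Quotient.eq_zero_iff_mem, Ideal.mem_span_singleton] at h
    exact hfG h
  have key := Ideal.comap_ne_bot_of_integral_mem (R := MvPolynomial (Fin k) ℚ) (S := S)
    (I := Ideal.span {(Ideal.Quotient.mk I G : S)}) hx (Ideal.mem_span_singleton_self _) (hmint _)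
  obtain ⟨r, hr, hr0⟩ := Submodule.exists_mem_ne_zero_of_ne_bot key
  rw [Ideal.mem_comap, Ideal.mem_span_singleton'] at hr
  obtain ⟨b, hb⟩ := hr
  obtain ⟨b, rfl⟩ := Ideal.Quotient.mk_surjective b
  have hb' : Polynomial.C r - b * G ∈ I := by
    rw [← Ideal.Quotient.eq_zero_iff_mem, map_sub, map_mul, hb, sub_eq_zero]; rfl
  obtain ⟨a, ha⟩ := Ideal.mem_span_singleton'.mp hb'
  have hQ : rename Fin.succ r = (fse ℚ k).symm a * mQ F + (fse ℚ k).symm b * mQ g := by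
    apply (fse ℚ k).injective
    rw [fse_rename]; simp only [map_add, map_mul, AlgEquiv.apply_symm_apply]
    rw [ha, hG]; ring
  obtain ⟨c1, R, hc1, hR⟩ := clear_denom r
  obtain ⟨c2, P, hc2, hP⟩ := clear_denom_fin (fun i : Fin 2 => if i = 0 then (fse ℚ k).symm a else (fse ℚ k).symm b)
  refine ⟨C c2 * R, C c1 * P 0, C c1 * P 1, ?_, ?_⟩
  · apply mul_ne_zero (by simpa using hc2)
    rintro rfl
    have : C (c1 : ℚ) * r ≠ 0 := mul_ne_zero (by simpa using hc1) hr0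
    exact this (by rw [← hR]; simp [mQ])
  · apply mQ_inj
    have e0 := hP 0
    have e1 := hP 1
    simp only [mQ] at *
    rw [map_rename]
    simp only [map_mul, map_add, map_C, hR, e0, e1]
    simp only [rename_C, hQ]
    simp; ring

lemma mP_ne_zero {n : ℕ} (r : MvPolynomial (Fin n) ℤ) (hr : r ≠ 0) : ∃ p0 : ℕ, ∀ p : ℕ, p0 ≤ p → mP p r ≠ 0 := by
  obtain ⟨s, hs⟩ := MvPolynomial.ne_zero_iff.mp hr
  refine ⟨(coeff s r).natAbs + 1, fun p hp h => ?_⟩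
  have := congrArg (coeff s) h
  rw [mP, coeff_map, coeff_zero] at this
  exact exists_prime_not_dvd _ hs p hp ((ZMod.intCast_zmod_eq_zero_iff_dvd _ p).mp (by simpa using this))

lemma eval_mP {n : ℕ} (p : ℕ) (x : Fin n → ℤ) (F : MvPolynomial (Fin n) ℤ) :
    eval (fun i => (x i : ZMod p)) (mP p F) = ((eval x F : ℤ) : ZMod p) := by
  rw [mP, eval_map]
  have h2 := eval₂_comp_left (Int.castRingHom (ZMod p)) (RingHom.id ℤ) x F
  rw [RingHom.comp_id] at h2
  exact h2.symm

open Classical in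
lemma count_cons (F g : MvPolynomial (Fin (k+1)) ℤ) (d : ℕ) (hF : F.IsHomogeneous d) (hk : 0 < k)
    (h1 : eval (Fin.cons 1 0) F ≠ 0) (hp : Prime (mQ F)) (hng : ¬ mQ F ∣ mQ g) :
    ∃ K p0 : ℕ, ∀ p : ℕ, [Fact p.Prime] → p0 ≤ p →
      (Finset.univ.filter fun x : Fin (k+1) → ZMod p => eval x (mP p F) = 0 ∧ eval x (mP p g) = 0).card ≤ K * p ^ (k-1) := by
  obtain ⟨r, a, b, hr, hab⟩ := elim F g d hF h1 hp hng
  obtain ⟨p0, hp0⟩ := mP_ne_zero r hr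
  refine ⟨d * r.totalDegree, p0 + (eval (Fin.cons 1 0) F).natAbs + 1, fun p hpp hpl => ?_⟩
  have hrp := hp0 p (by omega)
  have hpF := exists_prime_not_dvd _ h1 p (by omega)
  have hT := Finset.card_le_mul_card_image_of_maps_to
    (s := Finset.univ.filter fun x : Fin (k+1) → ZMod p => eval x (mP p F) = 0 ∧ eval x (mP p g) = 0)
    (t := (Fintype.piFinset fun _ => (Finset.univ : Finset (ZMod p))).filter fun y : Fin k → ZMod p => eval y (mP p r) = 0)
    (f := Fin.tail) (by
      intro x hx
      simp only [Finset.mem_filter, Finset.mem_univ, true_and, Fintype.mem_piFinset, implies_true] at hx ⊢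
      have := congrArg (fun P => eval x (mP p P)) hab
      simp only [mP] at this hx
      simp only [map_rename, eval_rename, map_add, map_mul, hx.1, hx.2, mul_zero, add_zero] at this
      exact this) d (by
      intro y _
      obtain ⟨hl, hd⟩ := lead_coeff (mP p F) d (hF.map _)
      set Q := Polynomial.map (eval y) (fse (ZMod p) k (mP p F)) with hQ
      have hQd : Q.natDegree ≤ d := Polynomial.natDegree_map_le.trans hd
      have hQ0 : Q ≠ 0 := by
        intro h
        have : Q.coeff d = 0 := by rw [h]; simp
        rw [hQ, Polynomial.coeff_map, hl, eval_C] at this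
        apply hpF
        rw [← ZMod.intCast_zmod_eq_zero_iff_dvd, ← eval_mP, ← this]
        congr 2
        ext i; refine Fin.cases ?_ (fun j => ?_) i <;> simp
      calc _ ≤ Q.roots.toFinset.card := by
            apply Finset.card_le_card_of_injOn (fun x => x 0)
            · intro x hx
              simp only [Finset.coe_filter, Finset.mem_filter, Finset.mem_univ, true_and, Set.mem_ofPred_eq] at hx
              have h2 := hx.1.1
              rw [← Fin.cons_self_tail x, hx.2, eval_eq_eval_mv_eval'] at h2
              simp only [Finset.mem_coe, Multiset.mem_toFinset]
              rw [Polynomial.mem_roots hQ0]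
              exact h2
            · intro x hx x' hx' h
              simp only [Finset.coe_filter, Set.mem_ofPred_eq] at hx hx'
              rw [← Fin.cons_self_tail x, ← Fin.cons_self_tail x', hx.2, hx'.2]
              simp only at h
              rw [h]
        _ ≤ Q.natDegree := (Multiset.toFinset_card_le _).trans (Polynomial.card_roots' Q)
        _ ≤ d := hQd)
  refine hT.trans ?_
  rw [mul_assoc]
  refine Nat.mul_le_mul_left _ ?_
  have hsz := schwartz_zippel_totalDegree hrp (Finset.univ : Finset (ZMod p))
  have hppos : (0 : NNRat) < p := by exact_mod_cast hpp.out.pos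
  rw [Finset.card_univ, ZMod.card, div_le_div_iff₀ (by positivity) hppos] at hsz
  have hsz' := hsz.trans (mul_le_mul_of_nonneg_right (Nat.cast_le.mpr (totalDegree_mP p r)) (by positivity))
  norm_cast at hsz'
  have e : p ^ k = p ^ (k-1) * p := by rw [← pow_succ, Nat.sub_add_cancel hk]
  rw [e, ← mul_assoc] at hsz'
  exact Nat.le_of_mul_le_mul_right hsz' hpp.out.pos

def shf {R : Type*} [CommRing R] (a : R) (v : Fin k → R) : Fin (k+1) → MvPolynomial (Fin (k+1)) R :=
  Fin.cons (C a * X 0) (fun j => X j.succ + C (v j) * X 0)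

def shx {R : Type*} [CommRing R] (a : R) (v : Fin k → R) (x : Fin (k+1) → R) : Fin (k+1) → R :=
  Fin.cons (a * x 0) (fun j => x j.succ + v j * x 0)

lemma eval_sh {R : Type*} [CommRing R] (a : R) (v : Fin k → R) (x : Fin (k+1) → R) (P : MvPolynomial (Fin (k+1)) R) :
    eval x (aeval (shf a v) P) = eval (shx a v x) P := by
  induction P using MvPolynomial.induction_on with
  | C c => simp [algebraMap_eq]
  | add p q hp hq => simp only [map_add, hp, hq]
  | mul_X p i hp =>
    simp only [map_mul, hp, aeval_X, eval_X]
    congr 1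
    refine Fin.cases ?_ (fun j => ?_) i <;> simp [shf, shx]

lemma map_sh {R S : Type*} [CommRing R] [CommRing S] (φ : R →+* S) (a : R) (v : Fin k → R) (P : MvPolynomial (Fin (k+1)) R) :
    MvPolynomial.map φ (aeval (shf a v) P) = aeval (shf (φ a) (fun j => φ (v j))) (MvPolynomial.map φ P) := by
  induction P using MvPolynomial.induction_on with
  | C c => simp [algebraMap_eq]
  | add p q hp hq => simp only [map_add, hp, hq]
  | mul_X p i hp =>
    simp only [map_mul, hp, aeval_X, map_X]
    congr 1
    refine Fin.cases ?_ (fun j => ?_) i <;> simp [shf]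

def shE {R : Type*} [Field R] (a : R) (ha : a ≠ 0) (v : Fin k → R) : MvPolynomial (Fin (k+1)) R ≃ₐ[R] MvPolynomial (Fin (k+1)) R :=
  AlgEquiv.ofAlgHom (aeval (shf a v)) (aeval (shf a⁻¹ (fun j => - v j * a⁻¹)))
    (by
      apply MvPolynomial.algHom_ext
      intro i
      refine Fin.cases ?_ (fun j => ?_) i
      · simp only [AlgHom.comp_apply, aeval_X, shf, Fin.cons_zero, map_mul, algHom_C, algebraMap_eq, AlgHom.id_apply]
        rw [← mul_assoc, ← C_mul, inv_mul_cancel₀ ha, C_1, one_mul]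
      · simp only [AlgHom.comp_apply, aeval_X, shf, Fin.cons_zero, Fin.cons_succ, map_mul, map_add, algHom_C, algebraMap_eq, AlgHom.id_apply]
        have : (C a⁻¹ : MvPolynomial (Fin (k+1)) R) * C a = 1 := by rw [← C_mul, inv_mul_cancel₀ ha, C_1]
        simp only [C_neg]
        linear_combination (- C (v j) * X 0) * this)
    (by
      apply MvPolynomial.algHom_ext
      intro i
      refine Fin.cases ?_ (fun j => ?_) i
      · simp only [AlgHom.comp_apply, aeval_X, shf, Fin.cons_zero, map_mul, algHom_C, algebraMap_eq, AlgHom.id_apply]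
        rw [← mul_assoc, ← C_mul, mul_inv_cancel₀ ha, C_1, one_mul]
      · simp only [AlgHom.comp_apply, aeval_X, shf, Fin.cons_zero, Fin.cons_succ, map_mul, map_add, algHom_C, algebraMap_eq, AlgHom.id_apply]
        simp only [C_neg]
        ring)

open Classical in
lemma Z_count (F : MvPolynomial (Fin (k+1)) ℤ) (l : ℕ) (hF : F.IsHomogeneous (l+2)) (hs : Smooth F)
    (hn : l + 2 < k + 1) (g : MvPolynomial (Fin (k+1)) ℤ) (hng : ¬ mQ F ∣ mQ g) :
    ∃ K p0 : ℕ, ∀ p : ℕ, [Fact p.Prime] → p0 ≤ p →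
      (Finset.univ.filter fun x : Fin (k+1) → ZMod p => eval x (mP p F) = 0 ∧ eval x (mP p g) = 0).card ≤ K * p ^ (k-1) := by
  have hF0 := F_ne_zero (by omega) F l hF hs
  obtain ⟨w, hw⟩ : ∃ w : Fin (k+1) → ℤ, eval w (X 0 * F) ≠ 0 := by
    by_contra h
    push Not at h
    exact mul_ne_zero (X_ne_zero 0) hF0 (MvPolynomial.funext (fun x => by rw [h x, map_zero]))
  rw [map_mul, eval_X] at hw
  set a := w 0
  set v : Fin k → ℤ := fun j => w j.succ
  have ha : a ≠ 0 := left_ne_zero_of_mul hw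
  have haQ : (Int.castRingHom ℚ a) ≠ 0 := by simpa using ha
  set F1 := aeval (shf a v) F
  set g1 := aeval (shf a v) g
  have hF1 : F1.IsHomogeneous (l+2) := by
    have := hF.aeval (shf a v) (n := 1) (by
      intro i
      refine Fin.cases ?_ (fun j => ?_) i
      · simpa [shf] using (isHomogeneous_C (Fin (k+1)) a).mul (isHomogeneous_X ℤ (0 : Fin (k+1)))
      · simpa [shf] using (isHomogeneous_X ℤ j.succ).add (by simpa using (isHomogeneous_C (Fin (k+1)) (v j)).mul (isHomogeneous_X ℤ (0 : Fin (k+1)))))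
    rwa [one_mul] at this
  have h1 : eval (Fin.cons 1 0) F1 ≠ 0 := by
    rw [eval_sh]
    have : shx a v (Fin.cons 1 0) = w := by
      ext i; refine Fin.cases ?_ (fun j => ?_) i <;> simp [shx, a, v]
    rw [this]; exact right_ne_zero_of_mul hw
  have hF1Q : mQ F1 = shE _ haQ (fun j => Int.castRingHom ℚ (v j)) (mQ F) := map_sh _ _ _ _
  have hg1Q : mQ g1 = shE _ haQ (fun j => Int.castRingHom ℚ (v j)) (mQ g) := map_sh _ _ _ _
  obtain ⟨K, p0, hK⟩ := count_cons F1 g1 (l+2) hF1 (by omega) h1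
    (by rw [hF1Q]; exact (MulEquiv.prime_iff _).mpr (smooth_prime F l hF hs hn))
    (by rw [hF1Q, hg1Q]; exact fun h => hng ((map_dvd_iff _).mp h))
  refine ⟨K, p0 + a.natAbs + 1, fun p hp hpl => le_trans ?_ (hK p (by omega))⟩
  have hap : (a : ZMod p) ≠ 0 := by
    rw [Ne, ZMod.intCast_zmod_eq_zero_iff_dvd]; exact exists_prime_not_dvd a ha p (by omega)
  set ι : (Fin (k+1) → ZMod p) → (Fin (k+1) → ZMod p) := fun x =>
    Fin.cons (x 0 * (a : ZMod p)⁻¹) (fun j => x j.succ - v j * (x 0 * (a : ZMod p)⁻¹))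
  have hι : ∀ x, shx (a : ZMod p) (fun j => (v j : ZMod p)) (ι x) = x := by
    intro x
    ext i; refine Fin.cases ?_ (fun j => ?_) i
    · simp [shx, ι]; field_simp
    · simp [shx, ι]
  apply Finset.card_le_card_of_injOn ι
  · intro x hx
    simp only [Finset.coe_filter, Finset.mem_univ, true_and, Set.mem_ofPred_eq] at hx ⊢
    have e1 : mP p F1 = _ := map_sh (Int.castRingHom (ZMod p)) a v F
    have e2 : mP p g1 = _ := map_sh (Int.castRingHom (ZMod p)) a v g
    rw [e1, e2, eval_sh, eval_sh]
    simp only [eq_intCast, hι]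
    exact hx
  · intro x _ y _ h
    rw [← hι x, ← hι y, h]

end
end BirchThin

namespace BirchThin
section
variable {n : ℕ}

def box (n H : ℕ) : Finset (Fin n → ℤ) := Fintype.piFinset fun _ => Finset.Icc (-(H:ℤ)) H

lemma mem_box {H : ℕ} {x : Fin n → ℤ} : x ∈ box n H ↔ ∀ i, |x i| ≤ H := by
  simp [box, Fintype.mem_piFinset, abs_le]

lemma card_box (n H : ℕ) : (box n H).card = (2 * H + 1) ^ n := by
  rw [box, Fintype.card_piFinset_const, Int.card_Icc]
  congr 1; omega

def evS (S : Finset (Fin n → ℤ)) (p : MvPolynomial (Fin n) ℤ) : S → ℚ := fun x => ((eval x.1 p : ℤ) : ℚ)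

lemma evS_add (S : Finset (Fin n → ℤ)) (p q : MvPolynomial (Fin n) ℤ) : evS S (p + q) = evS S p + evS S q := by
  ext x; simp [evS]

lemma evS_C_mul (S : Finset (Fin n → ℤ)) (c : ℤ) (q : MvPolynomial (Fin n) ℤ) : evS S (C c * q) = (c : ℚ) • evS S q := by
  ext x; simp [evS]

lemma evS_sum (S : Finset (Fin n → ℤ)) {ι : Type*} (t : Finset ι) (q : ι → MvPolynomial (Fin n) ℤ) :
    evS S (∑ i ∈ t, q i) = ∑ i ∈ t, evS S (q i) := by
  ext x; simp [evS]

lemma evS_span (hn : 0 < n) (S : Finset (Fin n → ℤ)) (W : Submodule ℚ (S → ℚ)) (h : ∀ p, evS S p ∈ W) : W = ⊤ := by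
  classical
  rw [eq_top_iff]
  intro f _
  have hsingle : ∀ x0 : S, ∃ p : MvPolynomial (Fin n) ℤ, evS S p x0 ≠ 0 ∧ ∀ x : S, x ≠ x0 → evS S p x = 0 := by
    intro x0
    have hsep : ∀ x : S, ∃ i, x ≠ x0 → x.1 i ≠ x0.1 i := by
      intro x
      by_cases hx : x = x0
      · exact ⟨⟨0, hn⟩, fun h => absurd hx h⟩
      · by_contra hcon
        push Not at hcon
        exact hx (Subtype.ext (funext fun i => (hcon i).2))
    choose i hi using hsep
    refine ⟨∏ x ∈ Finset.univ.erase x0, (X (i x) - C (x.1 (i x))), ?_, ?_⟩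
    · simp only [evS, map_prod, map_sub, eval_X, eval_C, ne_eq, Int.cast_eq_zero]
      rw [Finset.prod_eq_zero_iff]
      rintro ⟨x, hx, hx'⟩
      exact hi x (Finset.ne_of_mem_erase hx) (sub_eq_zero.mp hx').symm
    · intro x hx
      simp only [evS, map_prod, map_sub, eval_X, eval_C, Int.cast_eq_zero]
      exact Finset.prod_eq_zero (Finset.mem_erase.mpr ⟨hx, Finset.mem_univ x⟩) (by simp)
  choose p hp hp' using hsingle
  have : f = ∑ x0, (f x0 / evS S (p x0) x0) • evS S (p x0) := by
    ext x
    rw [Finset.sum_apply, Finset.sum_eq_single x]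
    · simp [hp x]
    · intro b _ hb
      simp [hp' b x hb.symm]
    · simp
  rw [this]
  exact W.sum_mem fun x _ => W.smul_mem _ (h _)

lemma fibre_bound (hn : 0 < n) (l m : ℕ) (c : ℤ) (hc : c ≠ 0)
    (h : Fin n → Fin n → MvPolynomial (Fin n) ℤ) (ψ G : Fin n → MvPolynomial (Fin n) ℤ)
    (hh : ∀ i j, (h i j).totalDegree ≤ m) (hid : ∀ i, C c * X i ^ (m + (l+1)) = ∑ j, h i j * ψ j)
    (hG : ∀ j, (ψ j - G j).totalDegree ≤ l) (S : Finset (Fin n → ℤ)) (hS : ∀ x ∈ S, ∀ j, eval x (G j) = 0) :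
    S.card ≤ (m + (l+1)) ^ n := by
  classical
  set k := m + (l+1) with hk
  let gen : (Fin n → Fin k) → (S → ℚ) := fun e => evS S (monomial (Finsupp.equivFunOnFinite.symm fun i => (e i : ℕ)) 1)
  let W := Submodule.span ℚ (Set.range gen)
  have key : ∀ N : ℕ, ∀ p : MvPolynomial (Fin n) ℤ, p.totalDegree ≤ N → evS S p ∈ W := by
    intro N
    induction N using Nat.strong_induction_on with
    | _ N ih =>
    intro p hp
    rw [p.as_sum, evS_sum]
    refine W.sum_mem fun s hs => ?_
    have hsN := (le_totalDegree hs).trans hp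
    have : monomial s (coeff s p) = C (coeff s p) * monomial s 1 := by rw [C_mul_monomial, mul_one]
    rw [this, evS_C_mul]
    apply W.smul_mem
    by_cases hsk : ∀ i, s i < k
    · apply Submodule.subset_span
      refine ⟨fun i => ⟨s i, hsk i⟩, ?_⟩
      simp only [gen]; congr 2; congr 1
      ext i; simp
    · push Not at hsk
      obtain ⟨i, hi⟩ := hsk
      set s' := s - Finsupp.single i k with hs'
      have hss : s = s' + Finsupp.single i k := by
        rw [hs', tsub_add_cancel_of_le]
        rw [Finsupp.single_le_iff]; exact hi
      have hdeg : (s.sum fun _ e => e) = (s'.sum fun _ e => e) + k := by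
        conv_lhs => rw [hss, Finsupp.sum_add_index' (by simp) (by simp), Finsupp.sum_single_index rfl]
      have hmem : evS S (monomial s' 1 * ∑ j, h i j * (ψ j - G j)) ∈ W := by
        refine ih ((s'.sum fun _ e => e) + (m + l)) (by omega) _ ?_
        refine (totalDegree_mul _ _).trans (add_le_add (totalDegree_monomial_le _ _) ?_)
        refine totalDegree_finsetSum_le fun j _ => ?_
        exact (totalDegree_mul _ _).trans (add_le_add (hh i j) (hG j))
      have heq : evS S (monomial s' 1 * ∑ j, h i j * (ψ j - G j)) = (c : ℚ) • evS S (monomial s 1) := by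
        rw [← evS_C_mul]
        have e1 : C c * monomial s 1 = monomial s' 1 * ∑ j, h i j * ψ j := by
          rw [← hid, hss, monomial_add_single]; ring
        rw [e1]
        ext x
        simp only [evS, map_mul, map_sum, map_sub, hS x.1 x.2, sub_zero]
      rw [heq] at hmem
      exact (W.smul_mem_iff (by exact_mod_cast hc)).mp hmem
  have htop : W = ⊤ := evS_span hn S W fun p => key _ p le_rfl
  have h1 : Module.finrank ℚ W = S.card := by
    rw [htop, finrank_top, Module.finrank_fintype_fun_eq_card, Fintype.card_coe]
  rw [← h1]
  refine (finrank_range_le_card gen).trans ?_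
  simp

lemma prod_shift_deg {ι : Type*} (s : Finset ι) (f : ι → Fin n) (c : ι → ℤ) :
    (∏ i ∈ s, (X (f i) + C (c i)) - ∏ i ∈ s, X (f i) : MvPolynomial (Fin n) ℤ).totalDegree ≤ s.card - 1 := by
  classical
  induction s using Finset.induction_on with
  | empty => simp
  | insert a s ha ih =>
    rw [Finset.prod_insert ha, Finset.prod_insert ha, Finset.card_insert_of_notMem ha]
    have e : ((X (f a) + C (c a)) * ∏ i ∈ s, (X (f i) + C (c i)) - X (f a) * ∏ i ∈ s, X (f i) : MvPolynomial (Fin n) ℤ) =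
      X (f a) * (∏ i ∈ s, (X (f i) + C (c i)) - ∏ i ∈ s, X (f i)) + C (c a) * ∏ i ∈ s, (X (f i) + C (c i)) := by ring
    rw [e]
    have hP : (∏ i ∈ s, (X (f i) + C (c i)) : MvPolynomial (Fin n) ℤ).totalDegree ≤ s.card := by
      refine (totalDegree_finsetProd _ _).trans ?_
      refine (Finset.sum_le_card_nsmul _ _ 1 fun i _ => ?_).trans (by simp)
      exact (totalDegree_add _ _).trans (by rw [totalDegree_X, totalDegree_C]; simp)
    refine (totalDegree_add _ _).trans (max_le ?_ ?_)
    · rcases Finset.eq_empty_or_nonempty s with rfl | hs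
      · simp
      · refine (totalDegree_mul _ _).trans ?_
        have := Finset.card_pos.mpr hs
        rw [totalDegree_X]; omega
    · refine (totalDegree_mul _ _).trans ?_
      rw [totalDegree_C]; omega


/-- `Ψ_j` as a multilinear form -/
def Psi (F : MvPolynomial (Fin n) ℤ) (l : ℕ) (hf : FD (l+2) (fun x => eval x F)) (j : Fin n) :
    MultilinearMap ℤ (fun _ : Fin (l+1) => (Fin n → ℤ)) ℤ :=
  (LinearMap.applyₗ (eb j)).compMultilinearMap (Tm (fun x => eval x F) (l+2) hf).curryRight

lemma Psi_apply (F : MvPolynomial (Fin n) ℤ) (l : ℕ) (hf) (j : Fin n) (v) :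
    Psi F l hf j v = Tf (fun x => eval x F) (l+2) (Fin.snoc v (eb j)) := rfl

lemma vec_eq_sum (x : Fin n → ℤ) : x = ∑ a, x a • (eb a : Fin n → ℤ) := by
  ext i; simp [Finset.sum_apply, Pi.single_apply]

def PG (F : MvPolynomial (Fin n) ℤ) (l : ℕ) (hf : FD (l+2) (fun x => eval x F)) (c : Fin (l+1) → Fin n → ℤ) (j : Fin n) : MvPolynomial (Fin n) ℤ :=
  ∑ f : Fin (l+1) → Fin n, C (Psi F l hf j (fun i => eb (f i))) * ∏ i, (X (f i) + C (c i (f i)))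

lemma eval_PG (F : MvPolynomial (Fin n) ℤ) (l : ℕ) (hf) (c : Fin (l+1) → Fin n → ℤ) (j : Fin n) (x : Fin n → ℤ) :
    eval x (PG F l hf c j) = Psi F l hf j (fun i => x + c i) := by
  have : (fun i => x + c i) = fun i : Fin (l+1) => ∑ a, (x a + c i a) • (eb a : Fin n → ℤ) := by
    ext1 i; exact vec_eq_sum (x + c i)
  rw [this, MultilinearMap.map_sum]
  simp only [PG, map_sum, map_mul, eval_C, map_prod, map_add, eval_X]
  refine Finset.sum_congr rfl fun f _ => ?_
  rw [MultilinearMap.map_smul_univ (Psi F l hf j) (fun i => x (f i) + c i (f i)) (fun i => eb (f i))]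
  rw [smul_eq_mul, mul_comm]

lemma PG_zero (F : MvPolynomial (Fin n) ℤ) (l : ℕ) (hF : F.IsHomogeneous (l+2)) (hf) (j : Fin n) :
    PG F l hf 0 j = C ((l+1).factorial : ℤ) * pderiv j F := by
  apply MvPolynomial.funext
  intro x
  rw [eval_PG, Psi_apply]
  simp only [Pi.zero_apply, add_zero, map_mul, eval_C]
  exact Tf_grad F l hF x j

lemma PG_deg (F : MvPolynomial (Fin n) ℤ) (l : ℕ) (hf) (c : Fin (l+1) → Fin n → ℤ) (j : Fin n) :
    (PG F l hf 0 j - PG F l hf c j).totalDegree ≤ l := by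
  rw [PG, PG, ← Finset.sum_sub_distrib]
  refine totalDegree_finsetSum_le fun f _ => ?_
  rw [← mul_sub]
  refine (totalDegree_mul _ _).trans ?_
  rw [totalDegree_C, zero_add, ← neg_sub, totalDegree_neg]
  have := prod_shift_deg (n := n) (Finset.univ : Finset (Fin (l+1))) f (fun i => c i (f i))
  simpa using this

lemma claimD (hn : 0 < n) (F : MvPolynomial (Fin n) ℤ) (l : ℕ) (hF : F.IsHomogeneous (l+2)) (hs : Smooth F) (hf) :
    ∃ K : ℕ, ∀ H : ℕ, ((Fintype.piFinset fun _ : Fin (l+1) => box n H).filter fun v => ∀ j, Psi F l hf j v = 0).card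
      ≤ K * (4 * H + 1) ^ (n * l) := by
  classical
  obtain ⟨c, m, h, hc, hh, hid⟩ := smooth_null F l hF hs
  refine ⟨(m + (l+1)) ^ n, fun H => ?_⟩
  have hT := Finset.card_le_mul_card_image_of_maps_to
    (s := (Fintype.piFinset fun _ : Fin (l+1) => box n H).filter fun v => ∀ j, Psi F l hf j v = 0)
    (t := Fintype.piFinset fun _ : Fin l => box n (2*H)) (f := fun v i => v i.succ - v 0) (by
      intro v hv
      simp only [Finset.mem_filter, Fintype.mem_piFinset, mem_box] at hv ⊢
      intro i a
      have h1 := hv.1 i.succ a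
      have h2 := hv.1 0 a
      rw [abs_le] at *
      simp only [Pi.sub_apply]; push_cast
      constructor <;> linarith [h1.1, h1.2, h2.1, h2.2]) ((m + (l+1)) ^ n) (by
      intro w _
      set cc : Fin (l+1) → Fin n → ℤ := Fin.cons 0 w with hcc
      set A := ((Fintype.piFinset fun _ : Fin (l+1) => box n H).filter fun v => ∀ j, Psi F l hf j v = 0).filter
        (fun v => (fun i : Fin l => v i.succ - v 0) = w) with hA
      have hv : ∀ v ∈ A, v = fun i => v 0 + cc i := by
        intro v hv
        have := (Finset.mem_filter.mp hv).2
        ext1 i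
        refine Fin.cases (by simp [hcc]) (fun i => ?_) i
        rw [hcc, Fin.cons_succ, ← this]; simp
      have hinj : Set.InjOn (fun v : Fin (l+1) → Fin n → ℤ => v 0) A := by
        intro v hv1 v' hv2 e
        rw [hv v hv1, hv v' hv2]; simp only at e; rw [e]
      rw [← Finset.card_image_of_injOn hinj]
      refine fibre_bound hn l m (c * (l+1).factorial) (mul_ne_zero hc (by exact_mod_cast (Nat.factorial_ne_zero _))) h
        (PG F l hf 0) (PG F l hf cc) (fun i j => (hh i j).totalDegree_le) ?_ (PG_deg F l hf cc) _ ?_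
      · intro i
        simp only [PG_zero F l hF]
        rw [C_mul, mul_comm (C c), mul_assoc, hid, Finset.mul_sum]
        exact Finset.sum_congr rfl fun j _ => by ring
      · intro x hx j
        obtain ⟨v, hv1, rfl⟩ := Finset.mem_image.mp hx
        rw [eval_PG, ← hv v hv1]
        exact (Finset.mem_filter.mp (Finset.mem_filter.mp hv1).1).2 j)
  refine hT.trans (Nat.mul_le_mul_left _ ?_)
  rw [Fintype.card_piFinset_const, card_box, ← pow_mul]
  apply le_of_eq; congr 1; ring

end
end BirchThin

namespace BirchThin
section
variable {n : ℕ}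

def Bl (L : (Fin n → ℤ) →+ (Fin n → ℝ)) (U δ : ℝ) : Set ((Fin n → ℤ) × (Fin n → ℤ)) :=
  {g | (∀ i, |(g.1 i : ℝ)| ≤ U) ∧ ∀ i, |L g.1 i - g.2 i| ≤ δ}

lemma mem_Bl {L : (Fin n → ℤ) →+ (Fin n → ℝ)} {U δ : ℝ} {g} :
    g ∈ Bl L U δ ↔ (∀ i, |(g.1 i : ℝ)| ≤ U) ∧ ∀ i, |L g.1 i - g.2 i| ≤ δ := Iff.rfl

lemma Bl_finite (L : (Fin n → ℤ) →+ (Fin n → ℝ)) (U δ : ℝ) : (Bl L U δ).Finite := by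
  have h1 : {u : Fin n → ℤ | ∀ i, |(u i : ℝ)| ≤ U}.Finite := by
    apply (box n ⌊U⌋₊).finite_toSet.subset
    intro u hu
    rw [Finset.mem_coe, mem_box]
    intro i
    have h := hu i
    have h0 : 0 ≤ U := (abs_nonneg _).trans h
    have h2 : ((|u i|).toNat : ℝ) ≤ U := by
      have : ((|u i|).toNat : ℤ) = |u i| := Int.toNat_of_nonneg (abs_nonneg _)
      have h3 : (((|u i|).toNat : ℤ) : ℝ) = |(u i : ℝ)| := by rw [this]; push_cast; rfl
      have h4 : ((|u i|).toNat : ℝ) = |(u i : ℝ)| := by exact_mod_cast h3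
      rw [h4]; exact h
    have := Nat.le_floor h2
    omega
  have h2 : ∀ u : Fin n → ℤ, {v : Fin n → ℤ | ∀ i, |L u i - v i| ≤ δ}.Finite := by
    intro u
    have : {v : Fin n → ℤ | ∀ i, |L u i - v i| ≤ δ} ⊆ {v | ∀ i, v i ∈ Set.Icc ⌊L u i - δ⌋ ⌈L u i + δ⌉} := by
      intro v hv i
      have := abs_le.mp (hv i)
      constructor
      · exact Int.cast_le (R := ℝ).mp ((Int.floor_le _).trans (by linarith))
      · exact Int.cast_le (R := ℝ).mp (le_trans (by linarith) (Int.le_ceil _))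
    exact (Set.Finite.pi' fun i => Set.finite_Icc _ _).subset this
  apply (h1.biUnion fun u _ => (Set.finite_singleton u).prod (h2 u)).subset
  intro g hg
  simp only [Set.mem_iUnion]
  exact ⟨g.1, hg.1, rfl, hg.2⟩

def NN (L : (Fin n → ℤ) →+ (Fin n → ℝ)) (U δ : ℝ) : ℕ := (Bl_finite L U δ).toFinset.card

lemma mem_BlF {L : (Fin n → ℤ) →+ (Fin n → ℝ)} {U δ : ℝ} {g} :
    g ∈ (Bl_finite L U δ).toFinset ↔ (∀ i, |(g.1 i : ℝ)| ≤ U) ∧ ∀ i, |L g.1 i - g.2 i| ≤ δ := by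
  rw [Set.Finite.mem_toFinset, mem_Bl]

lemma NN_mono (L : (Fin n → ℤ) →+ (Fin n → ℝ)) {U δ U' δ' : ℝ} (hU : U ≤ U') (hδ : δ ≤ δ') : NN L U δ ≤ NN L U' δ' := by
  apply Finset.card_le_card
  intro g hg
  rw [mem_BlF] at *
  exact ⟨fun i => (hg.1 i).trans hU, fun i => (hg.2 i).trans hδ⟩

lemma NN_pos (L : (Fin n → ℤ) →+ (Fin n → ℝ)) {U δ : ℝ} (hU : 0 ≤ U) (hδ : 0 ≤ δ) : 0 < NN L U δ := by
  apply Finset.card_pos.mpr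
  refine ⟨0, ?_⟩
  rw [mem_BlF]; simp [hU, hδ]

lemma floor_mem_Icc {t U : ℝ} (hU : 0 < U) (c : ℕ) (h : |t| ≤ c * U) : ⌊t / U⌋ ∈ Finset.Icc (-(c:ℤ)) c := by
  have := abs_le.mp h
  rw [Finset.mem_Icc]
  constructor
  · rw [Int.le_floor, le_div_iff₀ hU]; push_cast; linarith
  · have : t / U ≤ c := by rw [div_le_iff₀ hU]; linarith
    have h2 : (⌊t / U⌋ : ℝ) ≤ c := (Int.floor_le _).trans this
    exact_mod_cast h2

lemma floor_eq_close {s t U : ℝ} (hU : 0 < U) (h : ⌊s / U⌋ = ⌊t / U⌋) : |s - t| ≤ U := by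
  have := Int.abs_sub_lt_one_of_floor_eq_floor h
  rw [← sub_div, abs_div, abs_of_pos hU, div_lt_one hU] at this
  exact this.le

lemma NN_dbl (L : (Fin n → ℤ) →+ (Fin n → ℝ)) {U δ : ℝ} (hU : 0 < U) (hδ : 0 < δ) (c : ℕ) :
    NN L (c * U) (c * δ) ≤ (2 * c + 1) ^ (2 * n) * NN L U δ := by
  classical
  have hT := Finset.card_le_mul_card_image_of_maps_to (s := (Bl_finite L (c*U) (c*δ)).toFinset)
    (t := (Fintype.piFinset fun _ : Fin n => Finset.Icc (-(c:ℤ)) c) ×ˢ (Fintype.piFinset fun _ : Fin n => Finset.Icc (-(c:ℤ)) c))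
    (f := fun g => (fun i => ⌊(g.1 i : ℝ) / U⌋, fun i => ⌊(L g.1 i - g.2 i) / δ⌋)) (by
      intro g hg
      rw [mem_BlF] at hg
      rw [Finset.mem_product, Fintype.mem_piFinset, Fintype.mem_piFinset]
      exact ⟨fun i => floor_mem_Icc hU c (hg.1 i), fun i => floor_mem_Icc hδ c (hg.2 i)⟩) (NN L U δ) (by
      intro b _
      set A := Finset.filter (fun g => (fun i => ⌊(g.1 i : ℝ) / U⌋, fun i => ⌊(L g.1 i - g.2 i) / δ⌋) = b) (Bl_finite L (c*U) (c*δ)).toFinset with hA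
      rcases A.eq_empty_or_nonempty with h | ⟨g0, hg0⟩
      · rw [h]; simp
      apply Finset.card_le_card_of_injOn (fun g => g - g0)
      · intro g hg
        have e1 := (Finset.mem_filter.mp hg).2
        have e2 := (Finset.mem_filter.mp hg0).2
        rw [← e2, Prod.mk.injEq] at e1
        rw [Finset.mem_coe, mem_BlF]
        constructor
        · intro i
          have := floor_eq_close hU (congrFun e1.1 i)
          simpa using this
        · intro i
          have := floor_eq_close hδ (congrFun e1.2 i)
          simp only [Prod.fst_sub, Prod.snd_sub, map_sub, Pi.sub_apply, Int.cast_sub]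
          convert this using 2; ring
      · intro g _ g' _ h
        simpa using h)
  refine hT.trans (le_of_eq ?_)
  rw [Finset.card_product, Fintype.card_piFinset_const, Int.card_Icc, mul_comm]
  congr 1
  rw [← pow_add, ← two_mul]; congr 1; omega

lemma NN_sq (L : (Fin n → ℤ) →+ (Fin n → ℝ)) (U δ : ℝ) (c : ℕ) (hc : 0 < c) :
    NN L U δ * NN L U δ ≤ NN L (2 * U / c) (2 * δ / c) * NN L ((c + 1) * U) ((c + 1) * δ) := by
  classical
  have hcR : (0:ℝ) < c := by exact_mod_cast hc
  have hT := Finset.card_le_mul_card_image_of_maps_to (s := (Bl_finite L U δ).toFinset ×ˢ (Bl_finite L U δ).toFinset)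
    (t := (Bl_finite L ((c+1)*U) ((c+1)*δ)).toFinset)
    (f := fun g => c • g.1 + g.2) (by
      intro g hg
      rw [Finset.mem_product, mem_BlF, mem_BlF] at hg
      obtain ⟨⟨a1, a2⟩, b1, b2⟩ := hg
      rw [mem_BlF]
      constructor
      · intro i
        simp only [Prod.fst_add, Prod.snd_add, Prod.smul_fst, Prod.smul_snd, Prod.fst_sub, Prod.snd_sub, map_add, map_sub, map_nsmul, Pi.add_apply, Pi.sub_apply, Pi.smul_apply]
        simp only [nsmul_eq_mul, Int.cast_add, Int.cast_mul, Int.cast_sub, Int.cast_natCast]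
        calc _ ≤ |(c:ℝ) * (g.1.1 i)| + |(g.2.1 i : ℝ)| := abs_add_le _ _
          _ ≤ c * U + U := by
            rw [abs_mul, abs_of_pos hcR]
            exact add_le_add (mul_le_mul_of_nonneg_left (a1 i) hcR.le) (b1 i)
          _ = (c + 1) * U := by ring
      · intro i
        simp only [Prod.fst_add, Prod.snd_add, Prod.smul_fst, Prod.smul_snd, Prod.fst_sub, Prod.snd_sub, map_add, map_sub, map_nsmul, Pi.add_apply, Pi.sub_apply, Pi.smul_apply]
        simp only [nsmul_eq_mul, Int.cast_add, Int.cast_mul, Int.cast_sub, Int.cast_natCast]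
        calc _ = |(c:ℝ) * (L g.1.1 i - g.1.2 i) + (L g.2.1 i - g.2.2 i)| := by ring_nf
          _ ≤ |(c:ℝ) * (L g.1.1 i - g.1.2 i)| + |(L g.2.1 i - g.2.2 i)| := abs_add_le _ _
          _ ≤ c * δ + δ := by
            rw [abs_mul, abs_of_pos hcR]
            exact add_le_add (mul_le_mul_of_nonneg_left (a2 i) hcR.le) (b2 i)
          _ = (c + 1) * δ := by ring) (NN L (2*U/c) (2*δ/c)) (by
      intro b _
      set A := Finset.filter (fun g => c • g.1 + g.2 = b) ((Bl_finite L U δ).toFinset ×ˢ (Bl_finite L U δ).toFinset) with hA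
      rcases A.eq_empty_or_nonempty with h | ⟨g0, hg0⟩
      · rw [h]; simp
      obtain ⟨m0, e0⟩ := Finset.mem_filter.mp hg0
      apply Finset.card_le_card_of_injOn (fun g => g.1 - g0.1)
      · intro g hg
        obtain ⟨m1, e1⟩ := Finset.mem_filter.mp hg
        rw [Finset.mem_product, mem_BlF, mem_BlF] at m0 m1
        have key : c • (g.1 - g0.1) = g0.2 - g.2 := by
          rw [smul_sub, sub_eq_sub_iff_add_eq_add, e1, ← e0, add_comm]
        rw [Finset.mem_coe, mem_BlF]
        constructor
        · intro i
          have hk := congrArg (fun z : (Fin n → ℤ) × (Fin n → ℤ) => ((z.1 i : ℤ) : ℝ)) key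
          simp only [Prod.fst_add, Prod.snd_add, Prod.smul_fst, Prod.smul_snd, Prod.fst_sub, Prod.snd_sub, map_add, map_sub, map_nsmul, Pi.add_apply, Pi.sub_apply, Pi.smul_apply] at hk ⊢
          simp only [nsmul_eq_mul, Int.cast_add, Int.cast_mul, Int.cast_sub, Int.cast_natCast] at hk ⊢
          rw [le_div_iff₀ hcR]
          calc _ = |(c:ℝ) * ((g.1.1 i : ℝ) - g0.1.1 i)| := by rw [abs_mul, abs_of_pos hcR]; ring
            _ = |(g0.2.1 i : ℝ) - g.2.1 i| := by rw [hk]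
            _ ≤ |(g0.2.1 i : ℝ)| + |(g.2.1 i : ℝ)| := abs_sub _ _
            _ ≤ 2 * U := by linarith [m0.2.1 i, m1.2.1 i]
        · intro i
          have hk := congrArg (fun z : (Fin n → ℤ) × (Fin n → ℤ) => L z.1 i - ((z.2 i : ℤ) : ℝ)) key
          simp only [Prod.fst_add, Prod.snd_add, Prod.smul_fst, Prod.smul_snd, Prod.fst_sub, Prod.snd_sub, map_add, map_sub, map_nsmul, Pi.add_apply, Pi.sub_apply, Pi.smul_apply] at hk ⊢
          simp only [nsmul_eq_mul, Int.cast_add, Int.cast_mul, Int.cast_sub, Int.cast_natCast] at hk ⊢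
          rw [le_div_iff₀ hcR]
          calc _ = |(c:ℝ) * (L g.1.1 i - L g0.1.1 i) - c * ((g.1.2 i : ℝ) - g0.1.2 i)| := by
                rw [← mul_sub, abs_mul, abs_of_pos hcR]; ring
            _ = |(L g0.2.1 i - g0.2.2 i) - (L g.2.1 i - g.2.2 i)| := by rw [hk]; congr 1; ring
            _ ≤ |(L g0.2.1 i - g0.2.2 i)| + |(L g.2.1 i - g.2.2 i)| := abs_sub _ _
            _ ≤ 2 * δ := by linarith [m0.2.2 i, m1.2.2 i]
      · intro g hg g' hg' h
        have e1 := (Finset.mem_filter.mp hg).2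
        have e2 := (Finset.mem_filter.mp hg').2
        have h1 : g.1 = g'.1 := by simpa using h
        have h2 : g.2 = g'.2 := by
          rw [h1, ← e2] at e1; exact add_left_cancel e1
        exact Prod.ext h1 h2)
  rwa [Finset.card_product] at hT

end
end BirchThin

namespace BirchThin
section
variable {n : ℕ}

def ee (t : ℝ) : ℂ := Complex.exp (Complex.I * ((2 * Real.pi * t : ℝ) : ℂ))

lemma ee_add (s t : ℝ) : ee (s + t) = ee s * ee t := by
  unfold ee; rw [← Complex.exp_add]; congr 1; push_cast; ring

lemma ee_zero : ee 0 = 1 := by simp [ee]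

lemma ee_int (m : ℤ) : ee m = 1 := by
  unfold ee; rw [Complex.exp_eq_one_iff]; exact ⟨m, by push_cast; ring⟩

lemma ee_add_int (t : ℝ) (m : ℤ) : ee (t + m) = ee t := by rw [ee_add, ee_int, mul_one]

lemma ee_sub_int (t : ℝ) (m : ℤ) : ee (t - m) = ee t := by
  rw [← ee_add_int _ m]; congr 1; ring

lemma norm_ee (t : ℝ) : ‖ee t‖ = 1 := by
  unfold ee; rw [Complex.norm_exp_I_mul_ofReal]

lemma ee_conj (t : ℝ) : (starRingEnd ℂ) (ee t) = ee (-t) := by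
  unfold ee; rw [← Complex.exp_conj, map_mul, Complex.conj_I, Complex.conj_ofReal]; congr 1; push_cast; ring

lemma ee_ne (t : ℝ) : ee t ≠ 0 := Complex.exp_ne_zero _

lemma ee_sum {ι : Type*} (s : Finset ι) (f : ι → ℝ) : ee (∑ i ∈ s, f i) = ∏ i ∈ s, ee (f i) := by
  classical
  induction s using Finset.induction_on with
  | empty => simp [ee_zero]
  | insert a s ha ih => rw [Finset.sum_insert ha, Finset.prod_insert ha, ee_add, ih]

lemma ee_nmul (k : ℕ) (t : ℝ) : ee (k * t) = ee t ^ k := by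
  induction k with
  | zero => simp [ee_zero]
  | succ k ih => rw [pow_succ, ← ih, ← ee_add]; congr 1; push_cast; ring

lemma ee_sub_one_ge (t : ℝ) (ht : |t| ≤ 1/2) : 4 * |t| ≤ ‖ee t - 1‖ := by
  unfold ee
  rw [Complex.norm_exp_I_mul_ofReal_sub_one, Real.norm_eq_abs, abs_mul, abs_of_pos (by norm_num : (0:ℝ) < 2)]
  have h : 2 * |t| ≤ |Real.sin (Real.pi * t)| := by
    have hp := Real.pi_pos
    have h1 := Real.mul_le_sin (x := Real.pi * |t|) (by positivity) (by nlinarith)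
    have h2 : 2 / Real.pi * (Real.pi * |t|) = 2 * |t| := by field_simp
    rw [h2] at h1
    rcases abs_cases t with ⟨h, _⟩ | ⟨h, _⟩
    · rw [h] at h1 ⊢; exact h1.trans (le_abs_self _)
    · rw [h] at h1 ⊢
      rw [mul_neg Real.pi, Real.sin_neg] at h1; exact h1.trans (neg_le_abs _)
  have : 2 * Real.pi * t / 2 = Real.pi * t := by ring
  rw [this]; linarith

lemma ee_sub_one_le (t : ℝ) : ‖ee t - 1‖ ≤ 2 * Real.pi * |t| := by
  unfold ee
  rw [Complex.norm_exp_I_mul_ofReal_sub_one, Real.norm_eq_abs, abs_mul, abs_of_pos (by norm_num : (0:ℝ) < 2)]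
  have h := Real.abs_sin_le_abs (x := 2 * Real.pi * t / 2)
  have : |2 * Real.pi * t / 2| = Real.pi * |t| := by
    rw [show 2 * Real.pi * t / 2 = Real.pi * t by ring, abs_mul, abs_of_pos Real.pi_pos]
  linarith

def sf (t : ℝ) : ℝ := t - round t
lemma abs_sf (t : ℝ) : |sf t| ≤ 1/2 := abs_sub_round t
lemma ee_sf (t : ℝ) : ee (sf t) = ee t := ee_sub_int _ _

def key (A : ℕ) (t : ℝ) : ℤ := ⌊(A:ℝ) * sf t⌋
def wj (A : ℕ) (j : ℤ) : ℝ := 3 * A / (1 + |(j:ℝ)|)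
lemma wj_nonneg (A : ℕ) (j : ℤ) : 0 ≤ wj A j := by unfold wj; positivity

lemma key_mem (A : ℕ) (t : ℝ) : key A t ∈ Finset.Icc (-(A:ℤ)) A := by
  have h := floor_mem_Icc (t := A * sf t) (U := 1) one_pos A (by
    rw [abs_mul, abs_of_nonneg (by positivity : (0:ℝ) ≤ A)]
    have := abs_sf t
    nlinarith [(by positivity : (0:ℝ) ≤ A)])
  rw [div_one] at h; exact h

lemma le_wj (A : ℕ) (t S : ℝ) (h0 : 0 ≤ S) (h1 : S ≤ A) (h2 : 4 * (S * |sf t|) ≤ 2) : S ≤ wj A (key A t) := by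
  unfold wj
  rw [le_div_iff₀ (by positivity)]
  have hk : |(key A t : ℝ)| ≤ A * |sf t| + 1 := by
    have e1 := Int.floor_le ((A:ℝ) * sf t)
    have e2 := Int.lt_floor_add_one ((A:ℝ) * sf t)
    change |((⌊(A:ℝ) * sf t⌋ : ℤ) : ℝ)| ≤ _
    have e3 : |(A:ℝ) * sf t| = A * |sf t| := by rw [abs_mul, abs_of_nonneg (by positivity : (0:ℝ) ≤ A)]
    rw [← e3]
    have := neg_abs_le ((A:ℝ) * sf t)
    have := le_abs_self ((A:ℝ) * sf t)
    rw [abs_le]; constructor <;> linarith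
  have hA : (0:ℝ) ≤ A := by positivity
  nlinarith [mul_le_mul_of_nonneg_left hk h0, mul_le_mul_of_nonneg_left h2 hA]

lemma geom_range (k : ℕ) (t : ℝ) : 4 * (‖∑ x ∈ Finset.range k, ee (x * t)‖ * |sf t|) ≤ 2 := by
  have h1 : (∑ x ∈ Finset.range k, ee (x * t)) * (ee t - 1) = ee t ^ k - 1 := by
    simp_rw [ee_nmul]; exact geom_sum_mul _ _
  have h2 := congrArg norm h1
  rw [norm_mul] at h2
  have h3 : ‖ee t ^ k - 1‖ ≤ 2 := by
    refine (norm_sub_le _ _).trans ?_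
    rw [norm_pow, norm_ee]; norm_num
  have h4 := ee_sub_one_ge (sf t) (abs_sf t)
  rw [ee_sf] at h4
  have := mul_le_mul_of_nonneg_left h4 (norm_nonneg (∑ x ∈ Finset.range k, ee (x * t)))
  linarith

lemma sum_Ico_norm (a b : ℤ) (t : ℝ) : ‖∑ x ∈ Finset.Ico a b, ee (x * t)‖ = ‖∑ x ∈ Finset.range (b - a).toNat, ee (x * t)‖ := by
  have : ∑ x ∈ Finset.Ico a b, ee (x * t) = ee (a * t) * ∑ x ∈ Finset.range (b - a).toNat, ee (x * t) := by
    rw [Finset.mul_sum]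
    symm
    apply Finset.sum_bij (fun (x:ℕ) _ => a + (x:ℤ))
    · intro x hx; rw [Finset.mem_range] at hx; rw [Finset.mem_Ico]; omega
    · intro x _ y _ h; omega
    · intro x hx; rw [Finset.mem_Ico] at hx
      exact ⟨(x - a).toNat, by rw [Finset.mem_range]; omega, by omega⟩
    · intro x _; rw [← ee_add]; congr 1; push_cast; ring
  rw [this, norm_mul, norm_ee, one_mul]

lemma geom_Ico (A : ℕ) (a b : ℤ) (h : b - a ≤ A) (t : ℝ) : ‖∑ x ∈ Finset.Ico a b, ee (x * t)‖ ≤ wj A (key A t) := by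
  rw [sum_Ico_norm]
  apply le_wj _ _ _ (norm_nonneg _) _ (geom_range _ _)
  refine (norm_sum_le _ _).trans ?_
  simp_rw [norm_ee]
  simp only [Finset.sum_const, Finset.card_range, nsmul_eq_mul, mul_one]
  exact_mod_cast (by omega : (b - a).toNat ≤ A)

def dt (x : Fin n → ℤ) (t : Fin n → ℝ) : ℝ := ∑ i, (x i : ℝ) * t i

lemma dt_sub_left (x y : Fin n → ℤ) (t : Fin n → ℝ) : dt (x - y) t = dt x t - dt y t := by
  unfold dt; rw [← Finset.sum_sub_distrib]; apply Finset.sum_congr rfl; intro i _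
  simp only [Pi.sub_apply]; push_cast; ring

def ibox (a b : Fin n → ℤ) : Finset (Fin n → ℤ) := Fintype.piFinset fun i => Finset.Ico (a i) (b i)

lemma mem_ibox {a b x : Fin n → ℤ} : x ∈ ibox a b ↔ ∀ i, a i ≤ x i ∧ x i < b i := by
  simp [ibox, Fintype.mem_piFinset]

lemma sum_ibox_ee (a b : Fin n → ℤ) (t : Fin n → ℝ) :
    ∑ x ∈ ibox a b, ee (dt x t) = ∏ i, ∑ x ∈ Finset.Ico (a i) (b i), ee (x * t i) := by
  rw [Finset.prod_univ_sum]
  apply Finset.sum_congr rfl; intro x _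
  unfold dt; rw [ee_sum]

lemma geom_ibox (A : ℕ) (a b : Fin n → ℤ) (h : ∀ i, b i - a i ≤ A) (t : Fin n → ℝ) :
    ‖∑ x ∈ ibox a b, ee (dt x t)‖ ≤ ∏ i, wj A (key A (t i)) := by
  rw [sum_ibox_ee, norm_prod]
  exact Finset.prod_le_prod (fun i _ => norm_nonneg _) fun i _ => geom_Ico A _ _ (h i) _

lemma cell (L : (Fin n → ℤ) →+ (Fin n → ℝ)) (A B : ℕ) (hA : 0 < A) (g : ℤ → ℝ) (hg : ∀ j, 0 ≤ g j) :
    ∑ z ∈ box n B, ∏ i, g (key A (L z i)) ≤ NN L (2 * B) (1 / A) * (∑ j ∈ Finset.Icc (-(A:ℤ)) A, g j) ^ n := by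
  classical
  have hAR : (0:ℝ) < A := by exact_mod_cast hA
  rw [← Finset.sum_fiberwise_of_maps_to (s := box n B) (t := Fintype.piFinset fun _ : Fin n => Finset.Icc (-(A:ℤ)) A)
    (g := fun z i => key A (L z i)) (fun z _ => by rw [Fintype.mem_piFinset]; exact fun i => key_mem _ _)]
  have hR : (∑ j ∈ Finset.Icc (-(A:ℤ)) A, g j) ^ n = ∑ k ∈ Fintype.piFinset fun _ : Fin n => Finset.Icc (-(A:ℤ)) A, ∏ i, g (k i) := by
    rw [← Finset.prod_univ_sum]; simp
  rw [hR, Finset.mul_sum]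
  apply Finset.sum_le_sum
  intro k _
  rw [Finset.sum_congr rfl (g := fun _ => ∏ i, g (k i)) (by
    intro z hz; rw [← (Finset.mem_filter.mp hz).2])]
  rw [Finset.sum_const, nsmul_eq_mul]
  apply mul_le_mul_of_nonneg_right _ (Finset.prod_nonneg fun i _ => hg _)
  norm_cast
  set S := Finset.filter (fun z => (fun i => key A (L z i)) = k) (box n B) with hS
  rcases S.eq_empty_or_nonempty with h | ⟨z0, hz0⟩
  · rw [h]; simp
  obtain ⟨m0, e0⟩ := Finset.mem_filter.mp hz0
  rw [mem_box] at m0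
  apply Finset.card_le_card_of_injOn (fun z => (z - z0, fun i => round (L z i) - round (L z0 i)))
  · intro z hz
    obtain ⟨m1, e1⟩ := Finset.mem_filter.mp hz
    rw [mem_box] at m1
    rw [Finset.mem_coe, mem_BlF]
    constructor
    · intro i
      have a1 := m1 i
      have a0 := m0 i
      have : |z i - z0 i| ≤ 2 * B := by rw [abs_le] at *; constructor <;> omega
      simp only [Pi.sub_apply]
      exact_mod_cast this
    · intro i
      have h := congrFun (e1.trans e0.symm) i
      have h2 := Int.abs_sub_lt_one_of_floor_eq_floor h
      rw [← mul_sub, abs_mul, abs_of_pos hAR] at h2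
      simp only [map_sub, Pi.sub_apply, Int.cast_sub]
      push_cast
      rw [le_div_iff₀ hAR]
      have : L z i - L z0 i - (round (L z i) - round (L z0 i) : ℝ) = sf (L z i) - sf (L z0 i) := by unfold sf; ring
      rw [this]; linarith
  · intro z _ z' _ h
    simpa using (Prod.mk.inj h).1

lemma sum_sym (A : ℕ) (f : ℕ → ℝ) (hf : ∀ j, 0 ≤ f j) :
    ∑ j ∈ Finset.Icc (-(A:ℤ)) A, f j.natAbs ≤ 2 * ∑ j ∈ Finset.range (A + 1), f j := by
  classical
  rw [← Finset.sum_fiberwise_of_maps_to (s := Finset.Icc (-(A:ℤ)) A) (t := Finset.range (A+1)) (g := Int.natAbs)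
    (fun z hz => by rw [Finset.mem_Icc] at hz; rw [Finset.mem_range]; omega), Finset.mul_sum]
  apply Finset.sum_le_sum
  intro k _
  rw [Finset.sum_congr rfl (g := fun _ => f k) (by
    intro z hz; rw [← (Finset.mem_filter.mp hz).2]), Finset.sum_const, nsmul_eq_mul]
  apply mul_le_mul_of_nonneg_right _ (hf k)
  have : (Finset.filter (fun z => z.natAbs = k) (Finset.Icc (-(A:ℤ)) A)) ⊆ {(k:ℤ), -(k:ℤ)} := by
    intro z hz
    have := (Finset.mem_filter.mp hz).2
    simp only [Finset.mem_insert, Finset.mem_singleton]; omega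
  exact_mod_cast (Finset.card_le_card this).trans Finset.card_le_two

lemma wj_sum (A : ℕ) : ∑ j ∈ Finset.Icc (-(A:ℤ)) A, wj A j ≤ 6 * A * (1 + Real.log (A + 1)) := by
  have h := sum_sym A (fun k => 3 * A / (1 + (k:ℝ))) (fun j => by positivity)
  have e : ∑ j ∈ Finset.Icc (-(A:ℤ)) A, wj A j = ∑ j ∈ Finset.Icc (-(A:ℤ)) A, 3 * A / (1 + ((j.natAbs : ℕ):ℝ)) := by
    apply Finset.sum_congr rfl; intro j _
    unfold wj; rw [Nat.cast_natAbs]; push_cast; rfl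
  rw [e]
  refine h.trans ?_
  have h2 := harmonic_le_one_add_log (A + 1)
  have h3 : ((harmonic (A+1) : ℚ) : ℝ) = ∑ j ∈ Finset.range (A+1), 1 / (1 + (j:ℝ)) := by
    unfold harmonic; push_cast
    apply Finset.sum_congr rfl; intro j _; rw [one_div, add_comm]
  rw [h3] at h2
  have h4 : ∑ j ∈ Finset.range (A+1), 3 * A / (1 + (j:ℝ)) = 3 * A * ∑ j ∈ Finset.range (A+1), 1 / (1 + (j:ℝ)) := by
    rw [Finset.mul_sum]; apply Finset.sum_congr rfl; intro j _; ring
  rw [h4]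
  push_cast at h2
  have := mul_le_mul_of_nonneg_left h2 (by positivity : (0:ℝ) ≤ 6 * A)
  linarith

lemma wj_sq_sum (A : ℕ) : ∑ j ∈ Finset.Icc (-(A:ℤ)) A, wj A j ^ 2 ≤ 36 * A ^ 2 := by
  have h := sum_sym A (fun k => 9 * A ^ 2 / (1 + (k:ℝ)) ^ 2) (fun j => by positivity)
  have e : ∑ j ∈ Finset.Icc (-(A:ℤ)) A, wj A j ^ 2 = ∑ j ∈ Finset.Icc (-(A:ℤ)) A, 9 * A ^ 2 / (1 + ((j.natAbs : ℕ):ℝ)) ^ 2 := by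
    apply Finset.sum_congr rfl; intro j _
    unfold wj; rw [Nat.cast_natAbs, div_pow]; push_cast; ring
  rw [e]
  refine h.trans ?_
  have h2 : ∀ m : ℕ, ∑ j ∈ Finset.range (m+1), 1 / (1 + (j:ℝ)) ^ 2 ≤ (2 - 1 / (m + 1) : ℝ) := by
    intro m
    induction m with
    | zero => norm_num [Finset.sum_range_one]
    | succ m ih =>
      rw [Finset.sum_range_succ]
      have : 1 / (1 + ((m+1 : ℕ):ℝ)) ^ 2 ≤ 1 / (m + 1) - 1 / ((m + 1 : ℕ) + 1) := by
        push_cast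
        rw [div_sub_div _ _ (by positivity) (by positivity), div_le_div_iff₀ (by positivity) (by positivity)]
        have : (0:ℝ) ≤ m := by positivity
        nlinarith [mul_nonneg this this]
      linarith
  have h4 : ∑ j ∈ Finset.range (A+1), 9 * (A:ℝ) ^ 2 / (1 + (j:ℝ)) ^ 2 = 9 * (A:ℝ) ^ 2 * ∑ j ∈ Finset.range (A+1), 1 / (1 + (j:ℝ)) ^ 2 := by
    rw [Finset.mul_sum]; apply Finset.sum_congr rfl; intro j _; ring
  have h5 : ∑ j ∈ Finset.range (A+1), 1 / (1 + (j:ℝ)) ^ 2 ≤ 2 :=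
    (h2 A).trans (by have : (0:ℝ) ≤ 1 / (A + 1) := by positivity
                     linarith)
  rw [h4]
  nlinarith [mul_le_mul_of_nonneg_left h5 (by positivity : (0:ℝ) ≤ 9 * A ^ 2)]

end
end BirchThin

namespace BirchThin
section
variable {n : ℕ}

lemma normsq_sum {ι : Type*} (X : Finset ι) (f : ι → ℝ) :
    ((‖∑ x ∈ X, ee (f x)‖ ^ 2 : ℝ) : ℂ) = ∑ x ∈ X, ∑ x' ∈ X, ee (f x - f x') := by
  push_cast
  rw [← Complex.mul_conj', map_sum, Finset.sum_mul_sum]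
  apply Finset.sum_congr rfl; intro x _
  apply Finset.sum_congr rfl; intro y _
  rw [ee_conj, ← ee_add]; rfl

lemma dual_eq (L : (Fin n → ℤ) →+ (Fin n → ℝ)) (hs : ∀ w z, dt w (L z) = dt z (L w)) (X Y : Finset (Fin n → ℤ)) :
    ∑ y ∈ Y, ∑ y' ∈ Y, ‖∑ x ∈ X, ee (dt x (L (y - y')))‖ ^ 2 =
    ∑ x ∈ X, ∑ x' ∈ X, ‖∑ y ∈ Y, ee (dt y (L (x - x')))‖ ^ 2 := by
  apply Complex.ofReal_injective
  rw [Complex.ofReal_sum, Complex.ofReal_sum]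
  simp_rw [Complex.ofReal_sum, normsq_sum, ← dt_sub_left]
  simp_rw [← Finset.sum_product' Y Y (fun y y' => ∑ x ∈ X, ∑ x' ∈ X, ee (dt (x - x') (L (y - y')))),
    ← Finset.sum_product' X X (fun x x' => ee (dt (x - x') (L (_ - _)))),
    ← Finset.sum_product' X X (fun x x' => ∑ y ∈ Y, ∑ y' ∈ Y, ee (dt (y - y') (L (x - x')))),
    ← Finset.sum_product' Y Y (fun y y' => ee (dt (y - y') (L (_ - _))))]
  rw [Finset.sum_comm]
  apply Finset.sum_congr rfl; intro x _
  apply Finset.sum_congr rfl; intro y _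
  rw [hs]

lemma ee_re_ge (s : ℝ) (h : |s| ≤ 1/6) : 1/2 ≤ (ee s).re := by
  have : (ee s).re = Real.cos (2 * Real.pi * s) := by
    unfold ee; rw [mul_comm, Complex.exp_ofReal_mul_I_re]
  rw [this, ← Real.cos_abs, ← Real.cos_pi_div_three]
  have hp := Real.pi_pos
  have e : |2 * Real.pi * s| = 2 * Real.pi * |s| := by rw [abs_mul, abs_of_pos (by positivity)]
  apply Real.cos_le_cos_of_nonneg_of_le_pi (abs_nonneg _)
  · linarith
  · rw [e]; nlinarith

lemma term_lower (B : ℕ) (hB : 0 < B) (t : Fin n → ℝ) (v : Fin n → ℤ) (h : ∀ i, |t i - v i| ≤ 1 / (6 * B)) :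
    ((B:ℝ) / 2) ^ n ≤ ‖∑ y ∈ ibox (fun _ => 0) (fun _ : Fin n => (B:ℤ)), ee (dt y t)‖ := by
  have hBR : (0:ℝ) < B := by exact_mod_cast hB
  rw [sum_ibox_ee, norm_prod]
  calc ((B:ℝ)/2)^n = ∏ _i : Fin n, ((B:ℝ)/2) := by rw [Finset.prod_const]; simp
    _ ≤ _ := Finset.prod_le_prod (fun _ _ => by positivity) ?_
  intro i _
  refine le_trans ?_ (Complex.re_le_norm _)
  rw [Complex.re_sum]
  calc (B:ℝ)/2 = ∑ x ∈ Finset.Ico (0:ℤ) B, (1/2:ℝ) := by simp; ring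
    _ ≤ _ := Finset.sum_le_sum ?_
  intro x hx
  rw [Finset.mem_Ico] at hx
  have e : ee (x * t i) = ee (x * (t i - v i)) := by
    rw [← ee_sub_int _ (x * v i)]; congr 1; push_cast; ring
  rw [e]
  apply ee_re_ge
  have h0 : (0:ℝ) ≤ x := by exact_mod_cast hx.1
  have h1 : (x:ℝ) ≤ B := by exact_mod_cast hx.2.le
  rw [abs_mul, abs_of_nonneg h0]
  calc (x:ℝ) * |t i - v i| ≤ B * (1 / (6 * B)) := mul_le_mul h1 (h i) (abs_nonneg _) hBR.le
    _ = 1/6 := by field_simp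

lemma card_ibox (B : ℕ) : (ibox (fun _ => 0) (fun _ : Fin n => (B:ℤ))).card = B ^ n := by
  unfold ibox; rw [Fintype.card_piFinset_const]; simp

lemma dual (L : (Fin n → ℤ) →+ (Fin n → ℝ)) (hs : ∀ w z, dt w (L z) = dt z (L w)) (a B : ℕ) (ha : 0 < a) (hB : 0 < B) :
    (NN L a (1 / (6 * B)) : ℝ) * B ^ n ≤ NN L (2 * B) (1 / (2 * a)) * (576 * a) ^ n := by
  classical
  have hBR : (0:ℝ) < B := by exact_mod_cast hB
  have haR : (0:ℝ) < a := by exact_mod_cast ha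
  set X := ibox (fun _ => 0) (fun _ : Fin n => ((2 * a : ℕ):ℤ)) with hX
  set Y := ibox (fun _ => 0) (fun _ : Fin n => (B:ℤ)) with hY
  have E := dual_eq L hs X Y
  have up : ∑ y ∈ Y, ∑ y' ∈ Y, ‖∑ x ∈ X, ee (dt x (L (y - y')))‖ ^ 2 ≤ B ^ n * (NN L (2 * B) (1 / (2 * a)) * (36 * (2 * a) ^ 2) ^ n) := by
    rw [Finset.sum_comm]
    calc _ ≤ ∑ y' ∈ Y, (NN L (2 * B) (1 / (2 * a)) * (36 * (2 * a) ^ 2) ^ n : ℝ) := Finset.sum_le_sum ?_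
      _ = _ := by rw [Finset.sum_const, card_ibox, nsmul_eq_mul]; push_cast; ring
    intro y' hy'
    have h1 : ∀ y ∈ Y, ‖∑ x ∈ X, ee (dt x (L (y - y')))‖ ^ 2 ≤ ∏ i, wj (2 * a) (key (2 * a) (L (y - y') i)) ^ 2 := by
      intro y _
      rw [Finset.prod_pow]
      exact pow_le_pow_left₀ (norm_nonneg _) (geom_ibox _ _ _ (by simp) _) 2
    refine (Finset.sum_le_sum h1).trans ?_
    have hc := cell L (2 * a) B (by omega) (fun j => wj (2 * a) j ^ 2) (fun j => sq_nonneg _)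
    have hc2 := pow_le_pow_left₀ (Finset.sum_nonneg fun j _ => sq_nonneg _) (wj_sq_sum (2 * a)) n
    have hc3 := hc.trans (mul_le_mul_of_nonneg_left hc2 (by positivity))
    push_cast at hc3
    refine le_trans ?_ hc3
    rw [← Finset.sum_image (s := Y) (g := fun y => y - y') (f := fun z => ∏ i, wj (2 * a) (key (2 * a) (L z i)) ^ 2)
      (fun y _ z _ h => by simpa using h)]
    apply Finset.sum_le_sum_of_subset_of_nonneg
    · intro z hz
      obtain ⟨y, hy, rfl⟩ := Finset.mem_image.mp hz
      rw [mem_ibox] at hy hy'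
      rw [mem_box]; intro i
      have := hy i; have := hy' i
      simp only [Pi.sub_apply]; rw [abs_le]; constructor <;> omega
    · intro z _ _; exact Finset.prod_nonneg fun i _ => sq_nonneg _
  have low : (NN L a (1 / (6 * B)) : ℝ) * a ^ n * (((B:ℝ) / 2) ^ n) ^ 2 ≤ ∑ x ∈ X, ∑ x' ∈ X, ‖∑ y ∈ Y, ee (dt y (L (x - x')))‖ ^ 2 := by
    rw [← Finset.sum_product' X X (fun x x' => ‖∑ y ∈ Y, ee (dt y (L (x - x')))‖ ^ 2)]
    set S := (Bl_finite L a (1 / (6 * B))).toFinset ×ˢ ibox (fun _ => 0) (fun _ : Fin n => (a:ℤ)) with hS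
    set f : ((Fin n → ℤ) × (Fin n → ℤ)) × (Fin n → ℤ) → (Fin n → ℤ) × (Fin n → ℤ) :=
      fun g => (fun i => g.2 i + max (g.1.1 i) 0, fun i => g.2 i + max (- g.1.1 i) 0) with hf
    have fd : ∀ g, (f g).1 - (f g).2 = g.1.1 := by
      intro g; ext i; simp only [hf, Pi.sub_apply]; omega
    have inj : Set.InjOn f S := by
      intro g hg g' hg' h
      rw [Finset.mem_coe, hS, Finset.mem_product, mem_BlF] at hg hg'
      have e1 : g.1.1 = g'.1.1 := by rw [← fd g, ← fd g', h]
      have e2 : g.2 = g'.2 := by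
        ext i
        have := congrFun (congrArg Prod.fst h) i
        simp only [hf, e1] at this; omega
      have e3 : g.1.2 = g'.1.2 := by
        ext i
        have h1 := hg.1.2 i
        have h2 := hg'.1.2 i
        rw [← e1] at h2
        have h6 : (1:ℝ) / (6 * B) ≤ 1/6 := by
          apply one_div_le_one_div_of_le (by norm_num)
          have : (1:ℝ) ≤ B := by exact_mod_cast hB
          linarith
        have h3 : |(g.1.2 i : ℝ) - g'.1.2 i| < 1 := by
          rw [abs_le] at h1 h2; rw [abs_lt]; constructor <;> linarith
        have h4 : |g.1.2 i - g'.1.2 i| < 1 := by exact_mod_cast h3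
        rw [abs_lt] at h4; omega
      exact Prod.ext (Prod.ext e1 e3) e2
    calc _ = ∑ g ∈ S, (((B:ℝ) / 2) ^ n) ^ 2 := by
          rw [Finset.sum_const, hS, Finset.card_product, card_ibox, nsmul_eq_mul]; push_cast; rfl
      _ ≤ ∑ g ∈ S, ‖∑ y ∈ Y, ee (dt y (L ((f g).1 - (f g).2)))‖ ^ 2 := by
          apply Finset.sum_le_sum; intro g hg
          rw [hS, Finset.mem_product, mem_BlF] at hg
          rw [fd]
          exact pow_le_pow_left₀ (by positivity) (term_lower B hB _ g.1.2 hg.1.2) 2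
      _ = ∑ p ∈ S.image f, ‖∑ y ∈ Y, ee (dt y (L (p.1 - p.2)))‖ ^ 2 := by
          rw [Finset.sum_image inj]
      _ ≤ _ := by
          apply Finset.sum_le_sum_of_subset_of_nonneg
          · intro p hp
            obtain ⟨g, hg, rfl⟩ := Finset.mem_image.mp hp
            rw [hS, Finset.mem_product, mem_BlF, mem_ibox] at hg
            rw [Finset.mem_product, hX, mem_ibox, mem_ibox]
            have hb : ∀ i, |g.1.1 i| ≤ a := fun i => by exact_mod_cast hg.1.1 i
            constructor
            · intro i
              have := hb i; have := hg.2 i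
              rw [abs_le] at *; simp only [hf]; push_cast; omega
            · intro i
              have := hb i; have := hg.2 i
              rw [abs_le] at *; simp only [hf]; push_cast; omega
          · intro p _ _; positivity
  have := low.trans (E ▸ up)
  have e1 : (NN L a (1 / (6 * B)) : ℝ) * a ^ n * (((B:ℝ) / 2) ^ n) ^ 2 = (NN L a (1 / (6 * B)) * B ^ n) * (a ^ n * B ^ n * (1/4)^n) := by
    have : (((B:ℝ) / 2) ^ n) ^ 2 = B ^ n * B ^ n * (1/4) ^ n := by
      rw [← pow_mul, mul_comm n 2, pow_mul, ← mul_pow, ← mul_pow]; congr 1; ring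
    rw [this]; ring
  have e2 : (B:ℝ) ^ n * (NN L (2 * B) (1 / (2 * a)) * (36 * (2 * a) ^ 2) ^ n) = (NN L (2 * B) (1 / (2 * a)) * (576 * a) ^ n) * (a ^ n * B ^ n * (1/4)^n) := by
    have : (36 * (2 * (a:ℝ)) ^ 2) ^ n = (576 * a) ^ n * a ^ n * (1/4)^n := by
      rw [← mul_pow, ← mul_pow]; congr 1; ring
    rw [this]; ring
  rw [e1, e2] at this
  exact le_of_mul_le_mul_right this (by positivity)

end
end BirchThin

namespace BirchThin
section
variable {n : ℕ}

lemma NN_monoR (L : (Fin n → ℤ) →+ (Fin n → ℝ)) {U δ U' δ' : ℝ} (hU : U ≤ U') (hδ : δ ≤ δ') : (NN L U δ : ℝ) ≤ NN L U' δ' :=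
  Nat.cast_le.mpr (NN_mono L hU hδ)

lemma shrink (n : ℕ) : ∃ C : ℝ, 1 ≤ C ∧ ∀ (L : (Fin n → ℤ) →+ (Fin n → ℝ)) (_ : ∀ w z, dt w (L z) = dt z (L w))
    (U l : ℕ) (δ : ℝ), 0 < U → 0 < l → 0 < δ → (l * U) * (l * δ) ≤ 1 →
    (NN L (l * U) (l * δ) : ℝ) ≤ C * l ^ n * NN L U δ := by
  set D : ℝ := 5 ^ (2 * n) with hD
  set C1 : ℝ := D * D with hC1
  set C2 : ℝ := 13 ^ (2 * n) * D * 576 ^ n with hC2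
  have hD1 : 1 ≤ D := one_le_pow₀ (by norm_num)
  have hC11 : 1 ≤ C1 := by nlinarith
  have hC21 : 1 ≤ C2 := by
    have a1 : (1:ℝ) ≤ 13 ^ (2 * n) := one_le_pow₀ (by norm_num)
    have a2 : (1:ℝ) ≤ 576 ^ n := one_le_pow₀ (by norm_num)
    have a3 := one_le_mul_of_one_le_of_one_le a1 hD1
    exact one_le_mul_of_one_le_of_one_le a3 a2
  refine ⟨D * (C1 * C2), one_le_mul_of_one_le_of_one_le hD1 (one_le_mul_of_one_le_of_one_le hC11 hC21), ?_⟩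
  intro L hs U l δ hU hl hδ hle
  have hUR : (1:ℝ) ≤ U := by exact_mod_cast hU
  have hlR : (1:ℝ) ≤ l := by exact_mod_cast hl
  have dbl : ∀ u d : ℝ, 0 < u → 0 < d → (NN L (2 * u) (2 * d) : ℝ) ≤ D * NN L u d := by
    intro u d hu hd
    have := NN_dbl L hu hd 2
    push_cast at this
    rw [hD]; exact_mod_cast this
  set x := U * δ with hx
  have hx0 : 0 < x := by positivity
  have hl2 : (l:ℝ) ^ 2 * x ≤ 1 := by rw [hx]; linarith
  have hx1 : x ≤ 1 := by nlinarith [one_le_pow₀ hlR (n := 2)]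
  obtain ⟨K, hK1, hK2⟩ := exists_nat_pow_near (x := 1 / x) (y := (2:ℝ)) (by rw [le_div_iff₀ hx0]; linarith) (by norm_num)
  rw [le_div_iff₀ hx0] at hK1
  rw [div_lt_iff₀ hx0] at hK2
  set Nf : ℕ → ℝ := fun k => NN L (2 ^ k * U) (2 ^ k * δ) with hNf
  set h : ℕ → ℝ := fun k => Nf k / (2 ^ k) ^ n with hh
  have hNh : ∀ k, Nf k = h k * (2 ^ k) ^ n := by intro k; simp only [hh]; field_simp
  have hNpos : ∀ k, 0 < Nf k := by
    intro k; simp only [hNf]; exact_mod_cast NN_pos L (by positivity) (by positivity)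
  have hpos : ∀ k, 0 < h k := fun k => div_pos (hNpos k) (by positivity)
  have sq : ∀ k, h k ^ 2 ≤ C1 * h 0 * h (2 * k) := by
    intro k
    have e := NN_sq L (2 ^ k * U) (2 ^ k * δ) (2 ^ k) (by positivity)
    have e' : Nf k * Nf k ≤ NN L (2 * U) (2 * δ) * NN L ((2 ^ k + 1) * (2 ^ k * U)) ((2 ^ k + 1) * (2 ^ k * δ)) := by
      have q1 : 2 * (2 ^ k * (U:ℝ)) / ((2 ^ k : ℕ):ℝ) = 2 * U := by push_cast; field_simp
      have q2 : 2 * (2 ^ k * δ) / ((2 ^ k : ℕ):ℝ) = 2 * δ := by push_cast; field_simp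
      rw [q1, q2] at e
      have e2 := Nat.cast_le (α := ℝ).mpr e
      push_cast at e2
      exact e2
    have f1 := dbl U δ (by linarith) hδ
    have h2k : (1:ℝ) ≤ 2 ^ k := one_le_pow₀ (by norm_num)
    have f2 : (NN L ((2 ^ k + 1) * (2 ^ k * U)) ((2 ^ k + 1) * (2 ^ k * δ)) : ℝ) ≤ D * Nf (2 * k) := by
      refine le_trans ?_ (dbl (2 ^ (2 * k) * U) (2 ^ (2 * k) * δ) (by positivity) (by positivity))
      have : (2 ^ k + 1 : ℝ) * 2 ^ k ≤ 2 * 2 ^ (2 * k) := by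
        rw [two_mul k, pow_add]; nlinarith
      exact NN_monoR L (by rw [← mul_assoc, ← mul_assoc]; exact mul_le_mul_of_nonneg_right this (by positivity))
        (by rw [← mul_assoc, ← mul_assoc]; exact mul_le_mul_of_nonneg_right this (by positivity))
    have f0 : (NN L U δ : ℝ) = Nf 0 := by simp [hNf]
    rw [f0] at f1
    have f3 : Nf k * Nf k ≤ (D * Nf 0) * (D * Nf (2 * k)) := e'.trans (mul_le_mul f1 f2 (by positivity) (mul_nonneg (by linarith) (hNpos 0).le))
    rw [hNh k, hNh 0, hNh (2 * k)] at f3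
    have g1 : h k * (2 ^ k) ^ n * (h k * (2 ^ k) ^ n) = h k ^ 2 * (2 ^ (2 * k)) ^ n := by
      have : ((2:ℝ) ^ (2 * k)) ^ n = (2 ^ k) ^ n * (2 ^ k) ^ n := by rw [← mul_pow, ← pow_add, two_mul]
      rw [this]; ring
    have g2 : D * (h 0 * (2 ^ 0) ^ n) * (D * (h (2 * k) * (2 ^ (2 * k)) ^ n)) = C1 * h 0 * h (2 * k) * (2 ^ (2 * k)) ^ n := by
      rw [hC1]; simp; ring
    rw [g1, g2] at f3
    exact le_of_mul_le_mul_right f3 (by positivity)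
  have du : ∀ k, k ≤ K → h k ≤ C2 * h (K - k) := by
    intro k hk
    obtain ⟨j, rfl⟩ := Nat.exists_eq_add_of_le hk
    have e := dual L hs (2 ^ k * U) (2 ^ j * U) (by positivity) (by positivity)
    push_cast at e
    set T := (NN L (2 ^ k * U) (1 / (6 * (2 ^ j * U))) : ℝ) with hT
    have f1 : Nf k ≤ 13 ^ (2 * n) * T := by
      have := NN_dbl L (U := 2 ^ k * U) (δ := 1 / (6 * (2 ^ j * U))) (by positivity) (by positivity) 6
      push_cast at this
      have t2 : (NN L (6 * (2 ^ k * U)) (6 * (1 / (6 * (2 ^ j * U)))) : ℝ) ≤ 13 ^ (2 * n) * T := by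
        rw [hT]; norm_num at this; norm_num; exact_mod_cast this
      refine le_trans ?_ t2
      have m1 : 2 ^ k * δ ≤ 6 * (1 / (6 * (2 ^ j * U))) := by
        have : 6 * (1 / (6 * (2 ^ j * (U:ℝ)))) = 1 / (2 ^ j * U) := by field_simp
        rw [this, le_div_iff₀ (by positivity)]
        rw [pow_add, hx] at hK1; linarith
      exact NN_monoR L (by nlinarith [(by positivity : (0:ℝ) ≤ 2 ^ k * U)]) m1
    have f2 : (NN L (2 * (2 ^ j * U)) (1 / (2 * (2 ^ k * U))) : ℝ) ≤ D * Nf j := by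
      refine le_trans ?_ (dbl (2 ^ j * U) (2 ^ j * δ) (by positivity) (by positivity))
      have m1 : 1 / (2 * (2 ^ k * U)) ≤ 2 * (2 ^ j * δ) := by
        rw [div_le_iff₀ (by positivity)]
        rw [pow_succ, pow_add, hx] at hK2
        nlinarith [(by positivity : (0:ℝ) ≤ 2 ^ j * δ * (2 ^ k * U))]
      exact NN_monoR L le_rfl m1
    rw [show k + j - k = j by omega]
    have f3 : Nf k * (2 ^ j * U) ^ n ≤ 13 ^ (2 * n) * (D * Nf j * (576 * (2 ^ k * U)) ^ n) := by
      calc Nf k * (2 ^ j * U) ^ n ≤ 13 ^ (2 * n) * T * (2 ^ j * U) ^ n := mul_le_mul_of_nonneg_right f1 (by positivity)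
        _ = 13 ^ (2 * n) * (T * (2 ^ j * U) ^ n) := by ring
        _ ≤ _ := mul_le_mul_of_nonneg_left (e.trans (mul_le_mul_of_nonneg_right f2 (by positivity))) (by positivity)
    rw [hNh k, hNh j] at f3
    have g1 : h k * (2 ^ k) ^ n * (2 ^ j * U) ^ n = h k * ((2 ^ k) ^ n * (2 ^ j) ^ n * (U:ℝ) ^ n) := by rw [mul_pow]; ring
    have g2 : 13 ^ (2 * n) * (D * (h j * (2 ^ j) ^ n) * (576 * (2 ^ k * (U:ℝ))) ^ n) = C2 * h j * ((2 ^ k) ^ n * (2 ^ j) ^ n * (U:ℝ) ^ n) := by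
      rw [mul_pow, mul_pow, hC2]; ring
    rw [g1, g2] at f3
    exact le_of_mul_le_mul_right f3 (by positivity)
  obtain ⟨m, hm, hmax⟩ := Finset.exists_max_image ((Finset.range (K+1)).filter fun k => 2 * k ≤ K) h ⟨0, by simp⟩
  simp only [Finset.mem_filter, Finset.mem_range] at hm hmax
  have hM : h m ≤ C1 * C2 * h 0 := by
    have h2m : h (2 * m) ≤ C2 * h m := by
      by_cases hc : 2 * (2 * m) ≤ K
      · have := hmax (2 * m) ⟨by omega, hc⟩
        nlinarith [hpos m]
      · have a1 := du (2 * m) hm.2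
        have a2 := hmax (K - 2 * m) ⟨by omega, by omega⟩
        exact a1.trans (mul_le_mul_of_nonneg_left a2 (by linarith))
    have s := (sq m).trans (mul_le_mul_of_nonneg_left h2m (mul_nonneg (by linarith) (hpos 0).le))
    have : h m * h m ≤ (C1 * C2 * h 0) * h m := by nlinarith
    exact le_of_mul_le_mul_right this (hpos m)
  obtain ⟨k, hk1, hk2⟩ := exists_nat_pow_near hlR (by norm_num : (1:ℝ) < 2)
  have hkK : 2 * k ≤ K := by
    have : (2:ℝ) ^ (2 * k) < 2 ^ (K + 1) := by
      have q : (2:ℝ) ^ (2 * k) ≤ (l:ℝ) ^ 2 := by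
        rw [mul_comm, pow_mul]; exact pow_le_pow_left₀ (by positivity) hk1 2
      have : (2:ℝ) ^ (2 * k) * x < 2 ^ (K+1) * x := by nlinarith
      exact lt_of_mul_lt_mul_right this hx0.le
    have := (pow_lt_pow_iff_right₀ (by norm_num : (1:ℝ) < 2)).mp this
    omega
  have hk := hmax k ⟨by omega, hkK⟩
  have f1 : (NN L (l * U) (l * δ) : ℝ) ≤ D * Nf k := by
    refine le_trans ?_ (dbl (2 ^ k * U) (2 ^ k * δ) (by positivity) (by positivity))
    rw [pow_succ] at hk2
    exact NN_monoR L (by rw [← mul_assoc]; exact mul_le_mul_of_nonneg_right (by linarith) (by positivity)) (by rw [← mul_assoc]; exact mul_le_mul_of_nonneg_right (by linarith) hδ.le)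
  have f0 : (NN L U δ : ℝ) = h 0 := by simp [hh, hNf]
  rw [f0]
  refine f1.trans ?_
  rw [hNh k]
  have p1 : ((2:ℝ) ^ k) ^ n ≤ (l:ℝ) ^ n := pow_le_pow_left₀ (by positivity) hk1 n
  calc D * (h k * (2 ^ k) ^ n) ≤ D * ((C1 * C2 * h 0) * l ^ n) := by
        apply mul_le_mul_of_nonneg_left _ (by linarith)
        exact mul_le_mul (hk.trans hM) p1 (by positivity) ((hpos k).le.trans (hk.trans hM))
    _ = _ := by ring

end
end BirchThin

namespace BirchThin
section
variable {n : ℕ}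

lemma diff_step (a b : Fin n → ℤ) (A : ℕ) (hab : ∀ i, b i - a i ≤ A) (φ : (Fin n → ℤ) → ℝ) :
    ‖∑ x ∈ ibox a b, ee (φ x)‖ ^ 2 ≤ ∑ h ∈ box n A, ‖∑ x ∈ ibox (fun i => max (a i) (a i - h i)) (fun i => min (b i) (b i - h i)), ee (Dlt h φ x)‖ := by
  classical
  have e : ((‖∑ x ∈ ibox a b, ee (φ x)‖ ^ 2 : ℝ) : ℂ) =
      ∑ h ∈ box n A, ∑ x ∈ ibox (fun i => max (a i) (a i - h i)) (fun i => min (b i) (b i - h i)), ee (Dlt h φ x) := by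
    rw [normsq_sum, ← Finset.sum_product' (ibox a b) (ibox a b) (fun x x' => ee (φ x - φ x')), Finset.sum_sigma']
    apply Finset.sum_nbij' (fun p => (⟨p.1 - p.2, p.2⟩ : (_ : Fin n → ℤ) × (Fin n → ℤ))) (fun s => (s.2 + s.1, s.2))
    · intro p hp
      rw [Finset.mem_product, mem_ibox, mem_ibox] at hp
      rw [Finset.mem_sigma, mem_box, mem_ibox]
      refine ⟨fun i => ?_, fun i => ?_⟩
      · have := hp.1 i; have := hp.2 i; have := hab i
        simp only [Pi.sub_apply]; rw [abs_le]; constructor <;> omega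
      · have := hp.1 i; have := hp.2 i
        simp only [Pi.sub_apply]; omega
    · intro s hs
      rw [Finset.mem_sigma, mem_box, mem_ibox] at hs
      rw [Finset.mem_product, mem_ibox, mem_ibox]
      refine ⟨fun i => ?_, fun i => ?_⟩
      · have := hs.2 i; simp only [Pi.add_apply]; omega
      · have := hs.2 i; simp only; omega
    · intro p _; ext <;> simp
    · intro s _
      obtain ⟨h, x⟩ := s
      simp
    · intro p _; simp [Dlt]
  have e2 := congrArg norm e
  rw [Complex.norm_real, Real.norm_of_nonneg (by positivity)] at e2
  rw [e2]; exact norm_sum_le _ _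

lemma sum_pi_succ {k : ℕ} (S : Finset (Fin n → ℤ)) (f : (Fin (k+1) → (Fin n → ℤ)) → ℝ) :
    ∑ h ∈ Fintype.piFinset (fun _ : Fin (k+1) => S), f h =
    ∑ h0 ∈ S, ∑ h ∈ Fintype.piFinset (fun _ : Fin k => S), f (Fin.cons h0 h) := by
  rw [← Finset.sum_product' S _ (fun h0 h => f (Fin.cons h0 h))]
  apply Finset.sum_nbij' (fun h => (h 0, Fin.tail h)) (fun p => Fin.cons p.1 p.2)
  · intro h hh
    rw [Fintype.mem_piFinset] at hh
    rw [Finset.mem_product, Fintype.mem_piFinset]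
    exact ⟨hh 0, fun i => hh i.succ⟩
  · intro p hp
    rw [Finset.mem_product, Fintype.mem_piFinset] at hp
    rw [Fintype.mem_piFinset]
    intro i
    refine Fin.cases ?_ (fun i => ?_) i
    · simpa using hp.1
    · simpa using hp.2 i
  · intro h _; simp
  · intro p _; simp
  · intro h _; simp

lemma weyl (A : ℕ) : ∀ (k : ℕ) (a b : Fin n → ℤ) (_ : ∀ i, b i - a i ≤ A) (φ : (Fin n → ℤ) → ℝ)
    (G : (Fin k → (Fin n → ℤ)) → (Fin n → ℝ)) (_ : ∀ h x, iterD k h φ x = iterD k h φ 0 + dt x (G h)),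
    ((box n A).card : ℝ) ^ (k+1) * ‖∑ x ∈ ibox a b, ee (φ x)‖ ^ (2 ^ k) ≤
    ((box n A).card : ℝ) ^ (2 ^ k) * ∑ h ∈ Fintype.piFinset (fun _ : Fin k => box n A), ∏ i, wj A (key A (G h i))
  | 0, a, b, hab, φ, G, hG => by
    have e : ∀ x, ee (φ x) = ee (φ 0) * ee (dt x (G default)) := by
      intro x; rw [← ee_add]; exact congrArg ee (hG default x)
    rw [Finset.sum_congr rfl (fun x _ => e x)]
    rw [← Finset.mul_sum, norm_mul, norm_ee, one_mul]
    have h1 := geom_ibox A a b hab (G default)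
    have h2 : ∑ h ∈ Fintype.piFinset (fun _ : Fin 0 => box n A), ∏ i, wj A (key A (G h i)) = ∏ i, wj A (key A (G default i)) := by
      rw [Fintype.piFinset_of_isEmpty, Fintype.sum_unique]
      congr!
    rw [h2]
    simp only [zero_add, pow_one, pow_zero]
    exact mul_le_mul_of_nonneg_left h1 (by positivity)
  | (k+1), a, b, hab, φ, G, hG => by
    set M : ℝ := ((box n A).card : ℝ) with hM
    have hM0 : 0 < M := by
      rw [hM, card_box]; positivity
    set Sh : (Fin n → ℤ) → ℝ := fun h => ‖∑ x ∈ ibox (fun i => max (a i) (a i - h i)) (fun i => min (b i) (b i - h i)), ee (Dlt h φ x)‖ with hSh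
    have s1 : ‖∑ x ∈ ibox a b, ee (φ x)‖ ^ 2 ≤ ∑ h ∈ box n A, Sh h := diff_step a b A hab φ
    obtain ⟨m, hm⟩ : ∃ m, 2 ^ k = m + 1 := ⟨2 ^ k - 1, by have := Nat.one_le_two_pow (n := k); omega⟩
    have s2 : M * (∑ h ∈ box n A, Sh h) ^ (2 ^ k) ≤ M ^ (2 ^ k) * ∑ h ∈ box n A, Sh h ^ (2 ^ k) := by
      have h1 := pow_sum_div_card_le_sum_pow (s := box n A) (f := Sh) (fun h _ => norm_nonneg _) m
      rw [div_le_iff₀ (by positivity)] at h1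
      rw [hm]
      calc M * (∑ h ∈ box n A, Sh h) ^ (m+1) ≤ M * ((∑ h ∈ box n A, Sh h ^ (m+1)) * M ^ m) := mul_le_mul_of_nonneg_left h1 hM0.le
        _ = _ := by ring
    have s3 : ∀ h ∈ box n A, M ^ (k+1) * Sh h ^ (2 ^ k) ≤ M ^ (2 ^ k) * ∑ h' ∈ Fintype.piFinset (fun _ : Fin k => box n A), ∏ i, wj A (key A (G (Fin.cons h h') i)) := by
      intro h hh
      apply weyl A k _ _ _ (Dlt h φ) (fun h' => G (Fin.cons h h'))
      · intro h' x
        have := hG (Fin.cons h h') x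
        simpa [iterD] using this
      · intro i; have := hab i; omega
    rw [sum_pi_succ]
    calc M ^ (k + 1 + 1) * ‖∑ x ∈ ibox a b, ee (φ x)‖ ^ (2 ^ (k+1))
        = M ^ (k+1) * (M * (‖∑ x ∈ ibox a b, ee (φ x)‖ ^ 2) ^ (2 ^ k)) := by rw [← pow_mul, pow_succ 2 k]; ring
      _ ≤ M ^ (k+1) * (M * (∑ h ∈ box n A, Sh h) ^ (2 ^ k)) := by gcongr
      _ ≤ M ^ (k+1) * (M ^ (2 ^ k) * ∑ h ∈ box n A, Sh h ^ (2 ^ k)) := by gcongr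
      _ = M ^ (2 ^ k) * ∑ h ∈ box n A, M ^ (k+1) * Sh h ^ (2 ^ k) := by rw [← Finset.mul_sum]; ring
      _ ≤ M ^ (2 ^ k) * ∑ h ∈ box n A, M ^ (2 ^ k) * ∑ h' ∈ Fintype.piFinset (fun _ : Fin k => box n A), ∏ i, wj A (key A (G (Fin.cons h h') i)) := by
          apply mul_le_mul_of_nonneg_left (Finset.sum_le_sum s3) (by positivity)
      _ = _ := by rw [← Finset.mul_sum, pow_succ 2 k]; ring

end
end BirchThin

namespace BirchThin
section
variable {n : ℕ}

lemma sum_slot {m : ℕ} (s : Fin m → Finset (Fin n → ℤ)) (i : Fin m) (f : (Fin m → (Fin n → ℤ)) → ℝ) :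
    ∑ h ∈ Fintype.piFinset s, f h = ∑ r ∈ Fintype.piFinset (Function.update s i {0}), ∑ z ∈ s i, f (Function.update r i z) := by
  classical
  rw [← Finset.sum_product' _ (s i) (fun r z => f (Function.update r i z))]
  apply Finset.sum_nbij' (fun h => (Function.update h i 0, h i)) (fun p => Function.update p.1 i p.2)
  · intro h hh
    rw [Fintype.mem_piFinset] at hh
    rw [Finset.mem_product, Fintype.mem_piFinset]
    refine ⟨fun k => ?_, hh i⟩
    by_cases hk : k = i
    · subst hk; simp
    · simpa [hk] using hh k
  · intro p hp
    rw [Finset.mem_product, Fintype.mem_piFinset] at hp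
    rw [Fintype.mem_piFinset]
    intro k
    by_cases hk : k = i
    · subst hk; simpa using hp.2
    · simpa [hk] using hp.1 k
  · intro h _; simp
  · intro p hp
    rw [Finset.mem_product, Fintype.mem_piFinset] at hp
    have := hp.1 i
    simp only [Function.update_self, Finset.mem_singleton] at this
    ext1
    · simp [← this]
    · simp
  · intro h _; simp

lemma round_of_lt {t : ℝ} {v : ℤ} (h : |t - v| < 1/2) : round t = v := by
  have h1 := abs_sub_round t
  have : |((round t - v : ℤ) : ℝ)| < 1 := by
    push_cast
    rw [abs_lt] at *; rw [abs_le] at h1; constructor <;> linarith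
  have h2 : |round t - v| < 1 := by exact_mod_cast this
  rw [abs_lt] at h2; omega

lemma cnt_le_NN (L : (Fin n → ℤ) →+ (Fin n → ℝ)) (U : ℕ) (τ : ℝ) :
    ((box n U).filter fun z => ∀ j, |sf (L z j)| ≤ τ).card ≤ NN L U τ := by
  apply Finset.card_le_card_of_injOn (fun z => (z, fun j => round (L z j)))
  · intro z hz
    obtain ⟨h1, h2⟩ := Finset.mem_filter.mp hz
    rw [mem_box] at h1
    rw [Finset.mem_coe, mem_BlF]
    exact ⟨fun i => by simp only; exact_mod_cast h1 i, h2⟩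
  · intro z _ z' _ h; exact (Prod.mk.inj h).1

lemma NN_le_cnt (L : (Fin n → ℤ) →+ (Fin n → ℝ)) (U : ℕ) (τ : ℝ) (hτ : τ < 1/2) :
    NN L U τ ≤ ((box n U).filter fun z => ∀ j, |sf (L z j)| ≤ τ).card := by
  have hr : ∀ g ∈ (Bl_finite L U τ).toFinset, ∀ j, round (L g.1 j) = g.2 j := by
    intro g hg j
    rw [mem_BlF] at hg
    exact round_of_lt ((hg.2 j).trans_lt hτ)
  apply Finset.card_le_card_of_injOn (fun g => g.1)
  · intro g hg
    have := hr g hg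
    rw [Finset.mem_coe, mem_BlF] at hg
    rw [Finset.mem_coe, Finset.mem_filter, mem_box]
    exact ⟨fun i => by exact_mod_cast hg.1 i, fun j => by unfold sf; rw [this]; exact hg.2 j⟩
  · intro g hg g' hg' h
    refine Prod.ext h ?_
    ext j
    rw [← hr g hg j, ← hr g' hg' j]
    simp only at h
    rw [h]

variable (F : MvPolynomial (Fin n) ℤ) (l : ℕ) (hf : FD (l+2) (fun x => eval x F))

def Lslot (α : ℝ) (h : Fin (l+1) → (Fin n → ℤ)) (i : Fin (l+1)) : (Fin n → ℤ) →+ (Fin n → ℝ) :=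
  AddMonoidHom.mk' (fun z j => α * (Psi F l hf j (Function.update h i z) : ℤ)) (by
    intro x y; ext j
    rw [MultilinearMap.map_update_add]
    simp only [Pi.add_apply]
    push_cast; ring)

lemma Lslot_apply (α : ℝ) (h : Fin (l+1) → (Fin n → ℤ)) (i : Fin (l+1)) (z : Fin n → ℤ) (j : Fin n) :
    Lslot F l hf α h i z j = α * (Psi F l hf j (Function.update h i z) : ℤ) := rfl

lemma Tf_last (h : Fin (l+1) → (Fin n → ℤ)) (x : Fin n → ℤ) :
    Tf (fun x => eval x F) (l+2) (Fin.snoc h x : Fin (l+2) → (Fin n → ℤ)) = ∑ j, x j * Psi F l hf j h := by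
  let φ : (Fin n → ℤ) →+ ℤ := AddMonoidHom.mk' (fun x => Tf (fun x => eval x F) (l+2) (Function.update (Fin.snoc h 0 : Fin (l+2) → (Fin n → ℤ)) (Fin.last (l+1)) x))
      (fun a b => Tf_update_add _ _ hf _ _ a b)
  have hφ : ∀ x, φ x = Tf (fun x => eval x F) (l+2) (Fin.snoc h x : Fin (l+2) → (Fin n → ℤ)) := by
    intro x
    have : φ x = Tf (fun x => eval x F) (l+2) (Function.update (Fin.snoc h 0 : Fin (l+2) → (Fin n → ℤ)) (Fin.last (l+1)) x) := rfl
    rw [this, Fin.update_snoc_last]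
  rw [← hφ]
  conv_lhs => rw [vec_eq_sum x]
  rw [map_sum]
  apply Finset.sum_congr rfl; intro j _
  rw [map_zsmul, hφ, smul_eq_mul]; rfl

lemma Lslot_symm (α : ℝ) (h : Fin (l+1) → (Fin n → ℤ)) (i : Fin (l+1)) (w z : Fin n → ℤ) :
    dt w (Lslot F l hf α h i z) = dt z (Lslot F l hf α h i w) := by
  have key : ∀ w z : Fin n → ℤ, dt w (Lslot F l hf α h i z) = α * (Tf (fun x => eval x F) (l+2) (Fin.snoc (Function.update h i z) w : Fin (l+2) → (Fin n → ℤ)) : ℤ) := by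
    intro w z
    rw [Tf_last F l hf]
    unfold dt
    push_cast
    rw [Finset.mul_sum]
    apply Finset.sum_congr rfl; intro j _
    rw [Lslot_apply]; ring
  rw [key, key, ← Tf_perm _ _ (Fin.snoc (Function.update h i z) w : Fin (l+2) → (Fin n → ℤ)) (Equiv.swap i.castSucc (Fin.last _))]
  congr 3
  ext1 k
  simp only [Function.comp]
  refine Fin.lastCases ?_ (fun k => ?_) k
  · rw [Equiv.swap_apply_right, Fin.snoc_castSucc]; simp
  · by_cases hk : k = i
    · subst hk
      rw [Equiv.swap_apply_left, Fin.snoc_castSucc]; simp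
    · rw [Equiv.swap_apply_of_ne_of_ne (by simpa using hk) (Fin.castSucc_lt_last k).ne, Fin.snoc_castSucc, Fin.snoc_castSucc]
      simp [hk]

def Cnt (α : ℝ) (U : Fin (l+1) → ℕ) (τ : ℝ) : ℕ :=
  ((Fintype.piFinset fun i => box n (U i)).filter fun h => ∀ j, |sf (α * (Psi F l hf j h : ℤ))| ≤ τ).card

lemma Cnt_slot (α : ℝ) (U : Fin (l+1) → ℕ) (τ : ℝ) (i : Fin (l+1)) :
    (Cnt F l hf α U τ : ℝ) = ∑ r ∈ Fintype.piFinset (Function.update (fun k => box n (U k)) i {0}),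
      (((box n (U i)).filter fun z => ∀ j, |sf (Lslot F l hf α r i z j)| ≤ τ).card : ℝ) := by
  classical
  unfold Cnt
  rw [← Finset.sum_boole, sum_slot (fun i => box n (U i)) i]
  apply Finset.sum_congr rfl; intro r _
  rw [← Finset.sum_boole]; rfl

lemma cnt_shrink (C : ℝ) (hC : ∀ (L : (Fin n → ℤ) →+ (Fin n → ℝ)) (_ : ∀ w z, dt w (L z) = dt z (L w))
    (U l : ℕ) (δ : ℝ), 0 < U → 0 < l → 0 < δ → (l * U) * (l * δ) ≤ 1 →
    (NN L (l * U) (l * δ) : ℝ) ≤ C * l ^ n * NN L U δ) (α : ℝ) (U : Fin (l+1) → ℕ) (i : Fin (l+1)) (m U' : ℕ) (τ : ℝ)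
    (hUi : U i = m * U') (hm : 0 < m) (hU' : 0 < U') (hτ : 0 < τ) (hτ2 : τ < 1/2) (hle : (m * U' : ℝ) * τ ≤ 1) :
    (Cnt F l hf α U τ : ℝ) ≤ C * m ^ n * Cnt F l hf α (Function.update U i U') (τ / m) := by
  have hmR : (1:ℝ) ≤ m := by exact_mod_cast hm
  rw [Cnt_slot F l hf α U τ i, Cnt_slot F l hf α _ _ i, Finset.mul_sum]
  have e : Function.update (fun k => box n (Function.update U i U' k)) i {0} = Function.update (fun k => box n (U k)) i {0} := by
    ext1 k
    by_cases hk : k = i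
    · subst hk; simp
    · simp [hk]
  rw [e]
  apply Finset.sum_le_sum
  intro r _
  have h1 := cnt_le_NN (Lslot F l hf α r i) (U i) τ
  have h2 := hC (Lslot F l hf α r i) (Lslot_symm F l hf α r i) U' m (τ / m) hU' hm (by positivity) (by
    rw [mul_div_cancel₀ _ (by positivity)]; exact hle)
  rw [mul_div_cancel₀ _ (by positivity)] at h2
  have h3 := NN_le_cnt (Lslot F l hf α r i) U' (τ / m) ((div_le_self hτ.le hmR).trans_lt hτ2)
  have hU : ((U i : ℕ) : ℝ) = m * U' := by rw [hUi]; push_cast; rfl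
  rw [hU] at h1
  rw [Function.update_self]
  have hCpos : 0 ≤ C * m ^ n := by
    by_contra hneg
    push Not at hneg
    have : (0:ℝ) < NN (Lslot F l hf α r i) U' (τ / m) := by exact_mod_cast NN_pos _ (by positivity) (by positivity)
    have : (0:ℝ) ≤ NN (Lslot F l hf α r i) (m * U') τ := by positivity
    nlinarith
  calc _ ≤ (NN (Lslot F l hf α r i) (m * U') τ : ℝ) := Nat.cast_le.mpr h1
    _ ≤ _ := h2
    _ ≤ _ := mul_le_mul_of_nonneg_left (Nat.cast_le.mpr h3) hCpos

end
end BirchThin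

namespace BirchThin
section
variable {n : ℕ}

lemma iterD_comb (α : ℝ) (b : Fin n → ℝ) : ∀ (k : ℕ) (h : Fin k → (Fin n → ℤ)) (f : (Fin n → ℤ) → ℤ) (g : (Fin n → ℤ) → ℝ) (x : Fin n → ℤ),
    iterD k h (fun x => α * (f x : ℝ) + g x) x = α * (iterD k h f x : ℤ) + iterD k h g x
  | 0, h, f, g, x => rfl
  | (k+1), h, f, g, x => by
    have e : Dlt (h 0) (fun x => α * (f x : ℝ) + g x) = fun x => α * ((Dlt (h 0) f x : ℤ) : ℝ) + Dlt (h 0) g x := by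
      ext x; simp only [Dlt]; push_cast; ring
    simp only [iterD]
    rw [e]
    exact iterD_comb α b k _ _ _ x

lemma iterD_const (c : ℝ) : ∀ (k : ℕ) (h : Fin k → (Fin n → ℤ)) (x : Fin n → ℤ), iterD k h (fun _ => c) x = iterD k h (fun _ => c) 0
  | 0, _, _ => rfl
  | (k+1), h, x => by
    have e : Dlt (h 0) (fun _ : Fin n → ℤ => c) = fun _ => 0 := by ext x; simp [Dlt]
    simp only [iterD]; rw [e]
    exact iterD_const 0 k _ x

lemma iterD_lin (b : Fin n → ℝ) (k : ℕ) (h : Fin (k+1) → (Fin n → ℤ)) (x : Fin n → ℤ) :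
    iterD (k+1) h (fun x => dt x b) x = iterD (k+1) h (fun x => dt x b) 0 := by
  have e : Dlt (h 0) (fun x => dt x b) = fun _ => dt (h 0) b := by
    ext x; simp only [Dlt]; rw [← dt_sub_left]; simp
  simp only [iterD]; rw [e]
  exact iterD_const _ k _ x

lemma Psi_bound (F : MvPolynomial (Fin n) ℤ) (l : ℕ) (hf) : ∃ Q : ℝ, 0 ≤ Q ∧ ∀ (H : ℕ) (h : Fin (l+1) → (Fin n → ℤ)) (j : Fin n),
    (∀ i, h i ∈ box n H) → |(Psi F l hf j h : ℝ)| ≤ Q * H ^ (l+1) := by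
  classical
  refine ⟨∑ j : Fin n, ∑ c : Fin (l+1) → Fin n, |(Psi F l hf j (fun i => eb (c i)) : ℝ)|, Finset.sum_nonneg fun _ _ => Finset.sum_nonneg fun _ _ => abs_nonneg _, ?_⟩
  intro H h j hh
  have e : Psi F l hf j h = ∑ c : Fin (l+1) → Fin n, (∏ i, h i (c i)) * Psi F l hf j (fun i => eb (c i)) := by
    conv_lhs => rw [show h = fun i => ∑ a, h i a • (eb a : Fin n → ℤ) from funext fun i => vec_eq_sum (h i)]
    rw [MultilinearMap.map_sum]
    apply Finset.sum_congr rfl; intro c _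
    rw [MultilinearMap.map_smul_univ, smul_eq_mul]
  have h1 : |(Psi F l hf j h : ℝ)| ≤ (∑ c : Fin (l+1) → Fin n, |(Psi F l hf j (fun i => eb (c i)) : ℝ)|) * H ^ (l+1) := by
    rw [e]; push_cast
    refine (Finset.abs_sum_le_sum_abs _ _).trans ?_
    rw [Finset.sum_mul]
    apply Finset.sum_le_sum; intro c _
    rw [abs_mul, mul_comm]
    apply mul_le_mul_of_nonneg_left _ (abs_nonneg _)
    rw [Finset.abs_prod]
    calc ∏ i, |(h i (c i) : ℝ)| ≤ ∏ _i : Fin (l+1), (H:ℝ) := Finset.prod_le_prod (fun _ _ => abs_nonneg _) (fun i _ => by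
            have := mem_box.mp (hh i) (c i); exact_mod_cast this)
      _ = _ := by simp
  refine h1.trans (mul_le_mul_of_nonneg_right ?_ (by positivity))
  generalize hT : (fun j => ∑ c : Fin (l+1) → Fin n, |(Psi F l hf j (fun i => eb (c i)) : ℝ)|) = T
  have hT0 : ∀ j ∈ Finset.univ, 0 ≤ T j := fun j _ => by rw [← hT]; exact Finset.sum_nonneg fun _ _ => abs_nonneg _
  have h2 := Finset.single_le_sum hT0 (Finset.mem_univ j)
  rw [← hT] at h2 ⊢
  exact h2

lemma box_eq_ibox (P : ℕ) : box n P = ibox (fun _ => -(P:ℤ)) (fun _ => (P:ℤ) + 1) := by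
  ext x; rw [mem_box, mem_ibox]
  apply forall_congr'; intro i; rw [abs_le]; omega

lemma cnt_iter (C : ℝ) (hC1 : 1 ≤ C) (hC : ∀ (L : (Fin n → ℤ) →+ (Fin n → ℝ)) (_ : ∀ w z, dt w (L z) = dt z (L w))
    (U l : ℕ) (δ : ℝ), 0 < U → 0 < l → 0 < δ → (l * U) * (l * δ) ≤ 1 →
    (NN L (l * U) (l * δ) : ℝ) ≤ C * l ^ n * NN L U δ)
    (F : MvPolynomial (Fin n) ℤ) (l : ℕ) (hf : FD (l+2) (fun x => eval x F)) (α : ℝ) (H m : ℕ) (τ : ℝ) (hH : 0 < H) (hm : 0 < m)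
    (hτ : 0 < τ) (hτ2 : τ < 1/2) (hle : (m * H : ℝ) * τ ≤ 1) : ∀ k ≤ l + 1,
    (Cnt F l hf α (fun _ => m * H) τ : ℝ) ≤ (C * m ^ n) ^ k * Cnt F l hf α (fun i => if i.val < k then H else m * H) (τ / m ^ k) := by
  intro k
  have hmR : (1:ℝ) ≤ m := by exact_mod_cast hm
  induction k with
  | zero => intro _; simp
  | succ k ih =>
    intro hk
    refine (ih (by omega)).trans ?_
    have hdl : τ / m ^ k ≤ τ := div_le_self hτ.le (one_le_pow₀ hmR)
    have := cnt_shrink F l hf C hC α (fun i => if i.val < k then H else m * H) ⟨k, by omega⟩ m H (τ / m ^ k) (by simp) hm hH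
      (by positivity) (hdl.trans_lt hτ2) ((mul_le_mul_of_nonneg_left hdl (by positivity)).trans hle)
    have e : Function.update (fun i : Fin (l+1) => if i.val < k then H else m * H) ⟨k, by omega⟩ H = fun i => if i.val < k + 1 then H else m * H := by
      ext i
      by_cases hi : i = ⟨k, by omega⟩
      · subst hi; simp
      · have : i.val ≠ k := fun h => hi (Fin.ext h)
        rw [Function.update_of_ne hi]
        split_ifs <;> omega
    rw [e, div_div, ← pow_succ] at this
    calc _ ≤ _ := mul_le_mul_of_nonneg_left this (by positivity)
      _ = _ := by rw [pow_succ (C * _)]; ring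

lemma birch_pre (F : MvPolynomial (Fin n) ℤ) (l : ℕ) (hf : FD (l+2) (fun x => eval x F)) : ∃ C : ℝ, 1 ≤ C ∧
    ∀ (P H m : ℕ) (α : ℝ) (b : Fin n → ℝ), 0 < P → 0 < H → 3 * P = m * H →
    (((6 * P + 1) ^ n : ℕ) : ℝ) ^ (l+2) * ‖∑ x ∈ box n P, ee (α * (eval x F : ℤ) + dt x b)‖ ^ (2 ^ (l+1)) ≤
    (((6 * P + 1) ^ n : ℕ) : ℝ) ^ (2 ^ (l+1)) * (C * (P * (1 + Real.log P)) ^ n * (m ^ n) ^ (l+1) * Cnt F l hf α (fun _ => H) (1 / (6 * P) / m ^ (l+1))) := by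
  obtain ⟨C, hC1, hC⟩ := shrink n
  refine ⟨54 ^ n * 5 ^ (2 * n) * C ^ (l+1), ?_, ?_⟩
  · have a1 : (1:ℝ) ≤ 54 ^ n := one_le_pow₀ (by norm_num)
    have a2 : (1:ℝ) ≤ 5 ^ (2 * n) := one_le_pow₀ (by norm_num)
    exact one_le_mul_of_one_le_of_one_le (one_le_mul_of_one_le_of_one_le a1 a2) (one_le_pow₀ hC1)
  intro P H m α b hP hH hPH
  have hm : 0 < m := by rcases Nat.eq_zero_or_pos m with h | h; (rw [h] at hPH; omega); exact h
  have hPR : (1:ℝ) ≤ P := by exact_mod_cast hP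
  have hw := weyl (3 * P) (l+1) (fun _ : Fin n => -(P:ℤ)) (fun _ => (P:ℤ) + 1) (by intro i; push_cast; omega)
    (fun x => α * (eval x F : ℤ) + dt x b) (fun h j => α * (Psi F l hf j h : ℤ)) (by
      intro h x
      rw [iterD_comb α b, iterD_comb α b, iterD_lin, iterD_Tm _ _ hf, Tm_apply, Tf_last F l hf]
      unfold dt; push_cast
      rw [mul_add, Finset.mul_sum]
      have : ∀ j, α * ((x j : ℝ) * (Psi F l hf j h : ℝ)) = x j * (α * (Psi F l hf j h : ℝ)) := fun j => by ring
      simp_rw [this]; ring)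
  rw [← box_eq_ibox, card_box, show 2 * (3 * P) + 1 = 6 * P + 1 by ring] at hw
  refine hw.trans (mul_le_mul_of_nonneg_left ?_ (by positivity))
  rw [sum_slot (fun _ => box n (3 * P)) 0]
  have hlog : Real.log (3 * P + 1) ≤ 2 + Real.log P := by
    calc Real.log (3 * P + 1) ≤ Real.log (4 * P) := Real.log_le_log (by positivity) (by linarith)
      _ = Real.log 4 + Real.log P := Real.log_mul (by norm_num) (by positivity)
      _ ≤ _ := by
        have : Real.log 4 ≤ 2 := by
          rw [show (4:ℝ) = 2 ^ 2 by norm_num, Real.log_pow]; push_cast; linarith [Real.log_two_lt_d9]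
        linarith
  have hlog0 : 0 ≤ Real.log P := Real.log_nonneg hPR
  have hlog1 : 0 ≤ Real.log (3 * P + 1) := Real.log_nonneg (by linarith)
  have hr : ∀ r : Fin (l+1) → Fin n → ℤ, ∑ z ∈ box n (3 * P), ∏ j, wj (3 * P) (key (3 * P) (α * (Psi F l hf j (Function.update r 0 z) : ℤ))) ≤
      (54 ^ n * 5 ^ (2 * n) * (P * (1 + Real.log P)) ^ n) * (((box n (3 * P)).filter fun z => ∀ j, |sf (Lslot F l hf α r 0 z j)| ≤ 1 / (6 * P)).card : ℝ) := by
    intro r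
    have c1 := cell (Lslot F l hf α r 0) (3 * P) (3 * P) (by omega) (wj (3 * P)) (wj_nonneg _)
    refine c1.trans ?_
    have c2 := pow_le_pow_left₀ (Finset.sum_nonneg fun j _ => wj_nonneg _ j) (wj_sum (3 * P)) n
    have c3 : (6 * ((3 * P : ℕ):ℝ) * (1 + Real.log ((3 * P : ℕ) + 1))) ^ n ≤ 54 ^ n * (P * (1 + Real.log P)) ^ n := by
      rw [← mul_pow]
      apply pow_le_pow_left₀ (by push_cast; positivity)
      push_cast; nlinarith
    have c4 : (NN (Lslot F l hf α r 0) (2 * (3 * P : ℕ)) (1 / (3 * P : ℕ)) : ℝ) ≤ 5 ^ (2 * n) * (((box n (3 * P)).filter fun z => ∀ j, |sf (Lslot F l hf α r 0 z j)| ≤ 1 / (6 * P)).card : ℝ) := by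
      have d1 := NN_dbl (Lslot F l hf α r 0) (U := (3 * P : ℕ)) (δ := 1 / (6 * P)) (by positivity) (by positivity) 2
      have d2 := NN_le_cnt (Lslot F l hf α r 0) (3 * P) (1 / (6 * P)) (by
        rw [div_lt_div_iff₀ (by positivity) (by norm_num)]; linarith)
      have e : ((2:ℕ):ℝ) * (1 / (6 * P)) = 1 / (3 * P : ℕ) := by push_cast; field_simp; norm_num
      rw [e] at d1
      have d3 := d1.trans (Nat.mul_le_mul_left _ d2)
      have d4 : ((NN (Lslot F l hf α r 0) ((2:ℕ) * (3 * P : ℕ)) (1 / (3 * P : ℕ)) : ℕ) : ℝ) ≤ (((2 * 2 + 1) ^ (2 * n) * ((box n (3 * P)).filter fun z => ∀ j, |sf (Lslot F l hf α r 0 z j)| ≤ 1 / (6 * P)).card : ℕ) : ℝ) := Nat.cast_le.mpr d3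
      rw [show (((2:ℕ):ℝ)) = 2 from Nat.cast_ofNat] at d4
      refine d4.trans (le_of_eq ?_)
      rw [Nat.cast_mul, Nat.cast_pow]; norm_num
    calc _ ≤ (5 ^ (2 * n) * (((box n (3 * P)).filter fun z => ∀ j, |sf (Lslot F l hf α r 0 z j)| ≤ 1 / (6 * P)).card : ℝ)) * (54 ^ n * (P * (1 + Real.log P)) ^ n) :=
          mul_le_mul c4 (c2.trans c3) (pow_nonneg (Finset.sum_nonneg fun j _ => wj_nonneg _ j) _) (by positivity)
      _ = _ := by ring
  refine (Finset.sum_le_sum fun r _ => hr r).trans ?_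
  rw [← Finset.mul_sum]
  have hc := Cnt_slot F l hf α (fun _ => 3 * P) (1 / (6 * P)) 0
  rw [← hc]
  have hi := cnt_iter C hC1 hC F l hf α H m (1 / (6 * P)) hH hm (by positivity) (by
        rw [div_lt_div_iff₀ (by positivity) (by norm_num)]; linarith) (by
        have : (m * H : ℝ) = 3 * P := by exact_mod_cast hPH.symm
        rw [this, mul_one_div, div_le_one (by positivity)]; linarith) (l+1) le_rfl
  have e : (fun i : Fin (l+1) => if i.val < l + 1 then H else m * H) = fun _ => H := by ext i; simp [i.2]
  rw [e, ← hPH] at hi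
  calc _ ≤ _ := mul_le_mul_of_nonneg_left hi (by positivity)
    _ = _ := by rw [mul_pow C]; ring

end
end BirchThin

namespace BirchThin
section
variable {n : ℕ}

lemma birch (hn : 0 < n) (F : MvPolynomial (Fin n) ℤ) (l : ℕ) (hF : F.IsHomogeneous (l+2)) (hs : Smooth F) : ∃ C : ℝ, 1 ≤ C ∧
    ∀ (P H : ℕ) (α : ℝ) (b : Fin n → ℝ), 0 < P → 0 < H → H ∣ P →
    (‖∑ x ∈ box n P, ee (α * (eval x F : ℤ) + dt x b)‖ ^ (2 ^ (l+1)) * (H:ℝ) ^ n ≤ C * ((P:ℝ) ^ (n * 2 ^ (l+1)) * (1 + Real.log P) ^ n)) ∨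
    ∃ q : ℕ, 0 < q ∧ (q:ℝ) ≤ C * (H:ℝ) ^ (l+1) ∧ ∃ a : ℤ, |q * α - a| * (P:ℝ) ^ (l+2) ≤ (H:ℝ) ^ (l+1) := by
  classical
  have hf := FD_poly F (l+2) hF.totalDegree_le
  obtain ⟨C, hC1, hC⟩ := birch_pre F l hf
  obtain ⟨K, hK⟩ := claimD hn F l hF hs hf
  obtain ⟨Q, hQ0, hQ⟩ := Psi_bound F l hf
  obtain ⟨t, ht⟩ : ∃ t, 2 ^ (l+1) = l + 2 + t := by
    have : l + 1 < 2 ^ (l+1) := Nat.lt_two_pow_self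
    exact ⟨2 ^ (l+1) - (l+2), by omega⟩
  set C0 : ℝ := (7 ^ n) ^ t * (C * K * (5 ^ n) ^ l * (3 ^ n) ^ (l+1)) with hC0
  have hC00 : 0 ≤ C0 := by positivity
  refine ⟨1 + Q + C0, by linarith, ?_⟩
  intro P H α b hP hH ⟨m0, hm0⟩
  have hPR : (1:ℝ) ≤ P := by exact_mod_cast hP
  have hHR : (1:ℝ) ≤ H := by exact_mod_cast hH
  have hlog0 : 0 ≤ Real.log P := Real.log_nonneg hPR
  have hm0' : 0 < m0 := by rcases Nat.eq_zero_or_pos m0 with h | h; (rw [h] at hm0; omega); exact h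
  have h3 : 3 * P = (3 * m0) * H := by rw [hm0]; ring
  have hmR : (3 * P : ℝ) = ((3 * m0 : ℕ) : ℝ) * H := by exact_mod_cast h3
  have hmpos : (0:ℝ) < ((3 * m0 : ℕ) : ℝ) := by exact_mod_cast (by omega : 0 < 3 * m0)
  have hb := hC P H (3 * m0) α b hP hH h3
  generalize hm : 3 * m0 = m at *
  by_cases hex : ∃ v ∈ (Fintype.piFinset fun _ : Fin (l+1) => box n H), (∀ j, |sf (α * (Psi F l hf j v : ℤ))| ≤ 1 / (6 * P) / m ^ (l+1)) ∧ ∃ j, Psi F l hf j v ≠ 0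
  · right
    obtain ⟨v, hv, hv1, j, hj⟩ := hex
    have hτ : 1 / (6 * P) / (m:ℝ) ^ (l+1) * (P:ℝ) ^ (l+2) ≤ (H:ℝ) ^ (l+1) := by
      have e : (P:ℝ) ^ (l+1) * 3 ^ (l+1) = (m:ℝ) ^ (l+1) * H ^ (l+1) := by rw [← mul_pow, ← mul_pow, ← hmR]; ring
      rw [div_div, div_mul_eq_mul_div, div_le_iff₀ (by positivity), one_mul]
      have h31 : (1:ℝ) ≤ 3 ^ (l+1) := one_le_pow₀ (by norm_num)
      calc (P:ℝ) ^ (l+2) = P * P ^ (l+1) * 1 := by ring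
        _ ≤ P * P ^ (l+1) * 3 ^ (l+1) := mul_le_mul_of_nonneg_left h31 (by positivity)
        _ = P * (m ^ (l+1) * H ^ (l+1)) := by rw [mul_assoc, e]
        _ ≤ 6 * (P * (m ^ (l+1) * H ^ (l+1))) := by
          have : 0 ≤ P * ((m:ℝ) ^ (l+1) * H ^ (l+1)) := by positivity
          linarith
        _ = _ := by ring
    refine ⟨(Psi F l hf j v).natAbs, Int.natAbs_pos.mpr hj, ?_, ?_⟩
    · rw [Nat.cast_natAbs, Int.cast_abs]
      refine (hQ H v j (fun i => Fintype.mem_piFinset.mp hv i)).trans ?_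
      apply mul_le_mul_of_nonneg_right _ (by positivity); linarith
    · have h1 := mul_le_mul_of_nonneg_right (hv1 j) (by positivity : (0:ℝ) ≤ (P:ℝ) ^ (l+2))
      have h2 := h1.trans hτ
      unfold sf at h2
      rw [Nat.cast_natAbs, Int.cast_abs]
      rcases abs_choice ((Psi F l hf j v : ℤ) : ℝ) with h | h
      · exact ⟨round (α * (Psi F l hf j v : ℤ)), by rw [h, mul_comm _ α]; exact h2⟩
      · refine ⟨-round (α * (Psi F l hf j v : ℤ)), ?_⟩
        have e : -(Psi F l hf j v : ℝ) * α - ((-round (α * (Psi F l hf j v : ℤ)) : ℤ) : ℝ) = -(α * (Psi F l hf j v : ℤ) - round (α * (Psi F l hf j v : ℤ))) := by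
          push_cast; ring
        rw [h, e, abs_neg]; exact h2
  · left
    have hcnt : (Cnt F l hf α (fun _ => H) (1 / (6 * P) / m ^ (l+1)) : ℝ) ≤ K * ((5 * H) ^ n) ^ l := by
      have h1 : Cnt F l hf α (fun _ => H) (1 / (6 * P) / m ^ (l+1)) ≤ K * (4 * H + 1) ^ (n * l) := by
        refine le_trans (Finset.card_le_card ?_) (hK H)
        intro v hv
        rw [Finset.mem_filter] at hv ⊢
        refine ⟨hv.1, ?_⟩
        by_contra hh; push Not at hh
        exact hex ⟨v, hv.1, hv.2, hh⟩
      have h2 : K * (4 * H + 1) ^ (n * l) ≤ K * ((5 * H) ^ n) ^ l := by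
        rw [← pow_mul]; gcongr; omega
      exact_mod_cast h1.trans h2
    have hA : (((6 * P + 1) ^ n : ℕ) : ℝ) ≤ 7 ^ n * P ^ n := by
      rw [← mul_pow]; push_cast; gcongr; linarith
    have hA0 : (0:ℝ) < (((6 * P + 1) ^ n : ℕ) : ℝ) := by positivity
    generalize (((6 * P + 1) ^ n : ℕ) : ℝ) = A at *
    have hc0 : (0:ℝ) ≤ (Cnt F l hf α (fun _ => H) (1 / (6 * P) / m ^ (l+1)) : ℝ) := Nat.cast_nonneg _
    generalize (Cnt F l hf α (fun _ => H) (1 / (6 * P) / m ^ (l+1)) : ℝ) = c at *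
    rw [ht, pow_add A (l+2) t, mul_assoc (A ^ (l+2))] at hb
    have hb2 := le_of_mul_le_mul_left hb (pow_pos hA0 _)
    rw [ht]
    have e1 : ((m:ℝ) ^ n) ^ (l+1) * (H ^ n) ^ (l+1) = (3 ^ n) ^ (l+1) * (P ^ n) ^ (l+1) := by
      rw [← mul_pow, ← mul_pow, ← mul_pow, ← mul_pow, hmR]
    have hL : 0 ≤ 1 + Real.log P := by linarith
    calc _ ≤ (A ^ t * (C * (P * (1 + Real.log P)) ^ n * (m ^ n) ^ (l+1) * c)) * (H:ℝ) ^ n := mul_le_mul_of_nonneg_right hb2 (by positivity)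
      _ ≤ ((7 ^ n * P ^ n) ^ t * (C * (P * (1 + Real.log P)) ^ n * (m ^ n) ^ (l+1) * (K * ((5 * H) ^ n) ^ l))) * (H:ℝ) ^ n := by gcongr
      _ = ((7 ^ n) ^ t * (C * K * (5 ^ n) ^ l)) * ((m ^ n) ^ (l+1) * (H ^ n) ^ (l+1)) * (((P:ℝ) ^ n) ^ t * P ^ n * (1 + Real.log P) ^ n) := by
        rw [mul_pow, mul_pow (P:ℝ), mul_pow 5, mul_pow ((5:ℝ) ^ n), pow_succ ((H:ℝ) ^ n)]; ring
      _ = C0 * ((P:ℝ) ^ (n * (l + 2 + t)) * (1 + Real.log P) ^ n) := by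
        rw [e1, hC0, pow_mul, show l + 2 + t = (l + 1) + 1 + t by ring, pow_add ((P:ℝ) ^ n), pow_succ ((P:ℝ) ^ n)]; ring
      _ ≤ _ := mul_le_mul_of_nonneg_right (by linarith) (by positivity)

end
end BirchThin

namespace BirchThin
section
variable {n : ℕ}

def Arc (C : ℝ) (l P H : ℕ) (α : ℝ) : Prop := ∃ q : ℕ, 0 < q ∧ (q:ℝ) ≤ C * (H:ℝ) ^ (l+1) ∧ ∃ a : ℤ, |q * α - a| * (P:ℝ) ^ (l+2) ≤ (H:ℝ) ^ (l+1)

lemma int_Icc_card (x y : ℝ) (h : x ≤ y + 1) : ((Finset.Icc ⌈x⌉ ⌊y⌋).card : ℝ) ≤ y - x + 1 := by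
  rw [Int.card_Icc]
  have h1 := Int.floor_le y
  have h2 := Int.le_ceil x
  rcases le_total 0 (⌊y⌋ + 1 - ⌈x⌉) with h0 | h0
  · have : (((⌊y⌋ + 1 - ⌈x⌉).toNat : ℤ) : ℝ) = ⌊y⌋ + 1 - ⌈x⌉ := by rw [Int.toNat_of_nonneg h0]; push_cast; ring
    rw [Int.cast_natCast] at this
    rw [this]; linarith
  · rw [Int.toNat_of_nonpos h0]; push_cast; linarith

open Classical in
lemma arc_count1 (q : ℕ) (hq : 0 < q) (M : ℕ) (hM : 0 < M) (s η : ℝ) (h0 : 0 ≤ η) (h1 : η ≤ 1) :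
    (((Finset.range M).filter fun k : ℕ => ∃ a : ℤ, |q * ((k:ℝ) / M - s) - a| ≤ η).card : ℝ) ≤ 8 * η * M + 4 * q := by
  have hqR : (1:ℝ) ≤ q := by exact_mod_cast hq
  have hMR : (0:ℝ) < M := by exact_mod_cast hM
  have hch : ∀ k : ℕ, ∃ a : ℤ, (∃ a : ℤ, |q * ((k:ℝ) / M - s) - a| ≤ η) → |q * ((k:ℝ) / M - s) - a| ≤ η := by
    intro k
    by_cases h : ∃ a : ℤ, |q * ((k:ℝ) / M - s) - a| ≤ η
    · obtain ⟨a, ha⟩ := h; exact ⟨a, fun _ => ha⟩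
    · exact ⟨0, fun h' => absurd h' h⟩
  choose f hf using hch
  have key := Finset.card_le_mul_card_image_of_maps_to (s := (Finset.range M).filter fun k : ℕ => ∃ a : ℤ, |q * ((k:ℝ) / M - s) - a| ≤ η)
    (t := Finset.Icc ⌈-(q * s) - η⌉ ⌊q - q * s + η⌋) (f := f) (by
      intro k hk
      rw [Finset.mem_filter, Finset.mem_range] at hk
      have := abs_le.mp (hf k hk.2)
      have hk1 : (k:ℝ) / M ≤ 1 := by rw [div_le_one hMR]; exact_mod_cast hk.1.le
      have hk0 : 0 ≤ (k:ℝ) / M := by positivity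
      rw [Finset.mem_Icc, Int.ceil_le, Int.le_floor]
      constructor <;> nlinarith [this.1, this.2]) ⌊2 * η * M / q + 1⌋₊ (by
      intro a _
      apply Nat.le_floor
      set c := M * (a / q + s) with hc
      have : ((Finset.filter (fun k => f k = a) ((Finset.range M).filter fun k : ℕ => ∃ a : ℤ, |q * ((k:ℝ) / M - s) - a| ≤ η)).card) ≤
        (Finset.Icc ⌈c - η * M / q⌉ ⌊c + η * M / q⌋).card := by
        apply Finset.card_le_card_of_injOn (fun k : ℕ => (k:ℤ))
        · intro k hk
          simp only [Finset.coe_filter, Set.mem_ofPred_eq, Finset.mem_filter] at hk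
          have h := hf k hk.1.2
          rw [hk.2] at h
          have e : q * ((k:ℝ) / M - s) - a = (q / M) * (k - c) := by rw [hc]; field_simp; ring
          rw [e, abs_mul, abs_of_pos (by positivity : (0:ℝ) < q / M)] at h
          have h' : |k - c| ≤ η * M / q := by
            rw [le_div_iff₀ (by positivity)]
            rw [div_mul_eq_mul_div, div_le_iff₀ hMR] at h
            linarith
          have := abs_le.mp h'
          rw [Finset.mem_coe, Finset.mem_Icc, Int.ceil_le, Int.le_floor, Int.cast_natCast]
          constructor <;> linarith [this.1, this.2]
        · intro a _ b _ h; exact Int.ofNat_inj.mp h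
      have h2 := int_Icc_card (c - η * M / q) (c + η * M / q) (by
        have : 0 ≤ η * M / q := by positivity
        linarith)
      have h3 : (_ : ℝ) ≤ _ := Nat.cast_le.mpr this
      refine h3.trans (h2.trans (le_of_eq ?_)); ring)
  have k1 : (_ : ℝ) ≤ _ := Nat.cast_le.mpr key
  rw [Nat.cast_mul] at k1
  refine k1.trans ?_
  have k2 := int_Icc_card (-(q * s) - η) (q - q * s + η) (by linarith)
  calc _ ≤ (2 * η * M / q + 1) * (4 * q) := by
        apply mul_le_mul (Nat.floor_le (by positivity)) (k2.trans (by linarith)) (by positivity) (by positivity)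
    _ = _ := by field_simp; ring

open Classical in
lemma arc_count (C : ℝ) (hC : 1 ≤ C) (l P H M : ℕ) (hP : 0 < P) (hHP : H ≤ P) (hM : P ^ (l+2) ≤ M) (s : ℝ) :
    (((Finset.range M).filter fun k : ℕ => Arc C l P H ((k:ℝ) / M - s)).card : ℝ) ≤ (8 * C + 4 * C ^ 2) * (M * ((H:ℝ) ^ (l+1)) ^ 2 / (P:ℝ) ^ (l+2)) := by
  have hPR : (1:ℝ) ≤ P := by exact_mod_cast hP
  have hMR : (P:ℝ) ^ (l+2) ≤ M := by exact_mod_cast hM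
  have hM0 : 0 < M := lt_of_lt_of_le (by positivity) hM
  set X : ℝ := (H:ℝ) ^ (l+1) with hX
  have hX0 : 0 ≤ X := by positivity
  set η : ℝ := X / (P:ℝ) ^ (l+2) with hη
  have hη1 : η ≤ 1 := by
    rw [hη, div_le_one (by positivity)]
    calc X ≤ (P:ℝ) ^ (l+1) := by rw [hX]; gcongr
      _ ≤ _ := pow_le_pow_right₀ hPR (by omega)
  have hsub : ((Finset.range M).filter fun k : ℕ => Arc C l P H ((k:ℝ) / M - s)) ⊆
      (Finset.Icc 1 ⌊C * X⌋₊).biUnion fun q => (Finset.range M).filter fun k : ℕ => ∃ a : ℤ, |q * ((k:ℝ) / M - s) - a| ≤ η := by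
    intro k hk
    rw [Finset.mem_filter] at hk
    obtain ⟨hk, q, hq, hq2, a, ha⟩ := hk
    rw [Finset.mem_biUnion]
    exact ⟨q, Finset.mem_Icc.mpr ⟨hq, Nat.le_floor hq2⟩, Finset.mem_filter.mpr ⟨hk, a, by rw [hη, le_div_iff₀ (by positivity)]; exact ha⟩⟩
  have h1 : (_ : ℝ) ≤ _ := Nat.cast_le.mpr ((Finset.card_le_card hsub).trans Finset.card_biUnion_le)
  rw [Nat.cast_sum] at h1
  refine h1.trans ?_
  have hQ : (⌊C * X⌋₊ : ℝ) ≤ C * X := Nat.floor_le (by positivity)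
  calc _ ≤ ∑ q ∈ Finset.Icc 1 ⌊C * X⌋₊, (8 * η * M + 4 * (C * X)) := by
        apply Finset.sum_le_sum; intro q hq
        rw [Finset.mem_Icc] at hq
        have := arc_count1 q hq.1 M hM0 s η (by positivity) hη1
        have h2 : (q:ℝ) ≤ C * X := (Nat.cast_le.mpr hq.2).trans hQ
        linarith
    _ = ⌊C * X⌋₊ * (8 * η * M + 4 * (C * X)) := by rw [Finset.sum_const, Nat.card_Icc, nsmul_eq_mul]; simp
    _ ≤ (C * X) * (8 * η * M + 4 * (C * X)) := mul_le_mul_of_nonneg_right hQ (by positivity)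
    _ = 8 * C * (M * X ^ 2 / (P:ℝ) ^ (l+2)) + 4 * C ^ 2 * (X ^ 2 * 1) := by rw [hη]; ring
    _ ≤ 8 * C * (M * X ^ 2 / (P:ℝ) ^ (l+2)) + 4 * C ^ 2 * (X ^ 2 * (M / (P:ℝ) ^ (l+2))) := by
        have : 1 ≤ (M:ℝ) / (P:ℝ) ^ (l+2) := by rwa [one_le_div (by positivity)]
        gcongr
    _ = _ := by ring

lemma arc_top (C : ℝ) (hC : 1 ≤ C) (l P : ℕ) (hP : 0 < P) (α : ℝ) : Arc C l P P α := by
  have hPR : (1:ℝ) ≤ P := by exact_mod_cast hP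
  obtain ⟨q, hq, hqP, h⟩ := Real.exists_nat_abs_mul_sub_round_le α hP
  refine ⟨q, hq, ?_, round (q * α), ?_⟩
  · calc (q:ℝ) ≤ P := by exact_mod_cast hqP
      _ ≤ (P:ℝ) ^ (l+1) := le_self_pow₀ hPR (by omega)
      _ ≤ _ := le_mul_of_one_le_left (by positivity) hC
  · calc _ ≤ (1 / ((P:ℝ) + 1)) * (P:ℝ) ^ (l+2) := mul_le_mul_of_nonneg_right (by simpa using h) (by positivity)
      _ ≤ _ := by
        rw [div_mul_eq_mul_div, div_le_iff₀ (by positivity)]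
        have : 0 ≤ (P:ℝ) ^ (l+1) := by positivity
        calc _ = (P:ℝ) ^ (l+1) * P := by ring
          _ ≤ _ := by gcongr; linarith

open Classical in
lemma slice (C : ℝ) (hC : 1 ≤ C) (l R J j0 M : ℕ) (hR : 0 < R) (hj : j0 ≤ J) (hM : (R ^ J) ^ (l+2) ≤ M) (s W : ℝ) (hW : 0 ≤ W) (T : ℝ → ℝ)
    (hT : ∀ i, j0 ≤ i → i < J → ∀ α, ¬ Arc C l (R ^ J) (R ^ i) α → T α * (((R:ℝ) ^ i) ^ (l+1)) ^ 2 ≤ W) :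
    ∑ k ∈ (Finset.range M).filter (fun k : ℕ => ¬ Arc C l (R ^ J) (R ^ j0) ((k:ℝ) / M - s)), T ((k:ℝ) / M - s) ≤
      J * ((8 * C + 4 * C ^ 2) * (W * ((R:ℝ) ^ (l+1)) ^ 2 * (M / ((R:ℝ) ^ J) ^ (l+2)))) := by
  have hRR : (0:ℝ) < R := by exact_mod_cast hR
  have hp : ∀ k ∈ (Finset.range M).filter (fun k : ℕ => ¬ Arc C l (R ^ J) (R ^ j0) ((k:ℝ) / M - s)), T ((k:ℝ) / M - s) ≤
      ∑ i ∈ Finset.range J, if Arc C l (R ^ J) (R ^ (i+1)) ((k:ℝ) / M - s) then W / (((R:ℝ) ^ i) ^ (l+1)) ^ 2 else 0 := by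
    intro k hk
    rw [Finset.mem_filter] at hk
    set α := (k:ℝ) / M - s
    have hex : ∃ i, j0 ≤ i ∧ i < J ∧ ¬ Arc C l (R ^ J) (R ^ i) α ∧ Arc C l (R ^ J) (R ^ (i+1)) α := by
      by_contra hno
      push Not at hno
      have : ∀ t, j0 + t ≤ J → ¬ Arc C l (R ^ J) (R ^ (j0 + t)) α := by
        intro t
        induction t with
        | zero => intro _; exact hk.2
        | succ t ih => intro h; exact hno (j0 + t) (by omega) (by omega) (ih (by omega))
      have h := this (J - j0) (by omega)
      rw [show j0 + (J - j0) = J by omega] at h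
      exact h (arc_top C hC l (R ^ J) (by positivity) α)
    obtain ⟨i, hi0, hiJ, hn, hy⟩ := hex
    have h1 := hT i hi0 hiJ α hn
    have h2 : T α ≤ W / (((R:ℝ) ^ i) ^ (l+1)) ^ 2 := by rwa [le_div_iff₀ (by positivity)]
    refine h2.trans ?_
    have := Finset.single_le_sum (f := fun i => if Arc C l (R ^ J) (R ^ (i+1)) α then W / (((R:ℝ) ^ i) ^ (l+1)) ^ 2 else 0)
      (fun i _ => by split_ifs <;> positivity) (Finset.mem_range.mpr hiJ)
    simpa [hy] using this
  refine (Finset.sum_le_sum hp).trans ?_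
  refine (Finset.sum_le_sum_of_subset_of_nonneg (Finset.filter_subset _ _) (fun k _ _ => Finset.sum_nonneg fun i _ => by split_ifs <;> positivity)).trans ?_
  rw [Finset.sum_comm]
  calc _ ≤ ∑ _i ∈ Finset.range J, ((8 * C + 4 * C ^ 2) * (W * ((R:ℝ) ^ (l+1)) ^ 2 * (M / ((R:ℝ) ^ J) ^ (l+2)))) := by
        apply Finset.sum_le_sum; intro i hi
        rw [Finset.mem_range] at hi
        rw [← Finset.sum_filter, Finset.sum_const, nsmul_eq_mul]
        have := arc_count C hC l (R ^ J) (R ^ (i+1)) M (by positivity) (Nat.pow_le_pow_right hR hi) hM s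
        push_cast at this
        calc _ ≤ _ := mul_le_mul_of_nonneg_right this (by positivity)
          _ = _ := by
            rw [pow_succ (R:ℝ) i, mul_pow]; field_simp
    _ = _ := by rw [Finset.sum_const, Finset.card_range, nsmul_eq_mul]

end
end BirchThin

namespace BirchThin
section
variable {n : ℕ}

def SS (F : MvPolynomial (Fin n) ℤ) (P : ℕ) (α : ℝ) (b : Fin n → ℝ) : ℂ := ∑ x ∈ box n P, ee (α * (eval x F : ℤ) + dt x b)

lemma log_bound (n J : ℕ) (hn : 0 < n) : ∃ C : ℝ, 1 ≤ C ∧ ∀ R : ℕ, 0 < R → (1 + Real.log ((R ^ J : ℕ):ℝ)) ^ n ≤ C * R := by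
  refine ⟨(1 + J * n) ^ n, one_le_pow₀ (by have : (0:ℝ) ≤ J * n := by positivity
                                           linarith), ?_⟩
  intro R hR
  have hRR : (1:ℝ) ≤ R := by exact_mod_cast hR
  have hnR : (0:ℝ) < n := by exact_mod_cast hn
  have h1 := Real.log_le_rpow_div (by linarith : (0:ℝ) ≤ R) (ε := 1 / n) (by positivity)
  rw [div_div_eq_mul_div, div_one] at h1
  have h2 : (1:ℝ) ≤ (R:ℝ) ^ (1 / (n:ℝ)) := Real.one_le_rpow hRR (by positivity)
  have h3 : ((R:ℝ) ^ (1 / (n:ℝ))) ^ n = R := by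
    rw [← Real.rpow_natCast, ← Real.rpow_mul (by linarith)]; field_simp; simp
  have h0 : 0 ≤ Real.log R := Real.log_nonneg hRR
  push_cast
  rw [Real.log_pow]
  calc (1 + J * Real.log R) ^ n ≤ ((1 + J * n) * (R:ℝ) ^ (1 / (n:ℝ))) ^ n := by
        apply pow_le_pow_left₀ (by positivity)
        have : J * Real.log R ≤ J * ((R:ℝ) ^ (1 / (n:ℝ)) * n) := mul_le_mul_of_nonneg_left h1 (by positivity)
        nlinarith
    _ = _ := by rw [mul_pow, h3]

lemma birch2 (F : MvPolynomial (Fin n) ℤ) (l : ℕ) (hF : F.IsHomogeneous (l+2)) (hs : Smooth F) (hn : 2 * 2 ^ (l+1) * (l+1) + 2 ≤ n) :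
    ∃ C : ℝ, 1 ≤ C ∧ ∀ J : ℕ, ∃ C2 : ℝ, 1 ≤ C2 ∧ ∀ R : ℕ, 0 < R → ∀ e i : ℕ, 2 ^ (l+1) * e ≤ i → i ≤ J → ∀ α,
      ¬ Arc C l (R ^ J) (R ^ i) α → ∀ b, ‖SS F (R ^ J) α b‖ * (((R:ℝ) ^ i) ^ (l+1)) ^ 2 ≤ C2 * (((R:ℝ) ^ J) ^ n * R) / ((R:ℝ) ^ e) ^ 2 := by
  obtain ⟨C, hC, hb⟩ := birch (by omega) F l hF hs
  refine ⟨C, hC, fun J => ?_⟩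
  obtain ⟨L, hL, hlog⟩ := log_bound n J (by omega)
  have hCL : 1 ≤ C * L := one_le_mul_of_one_le_of_one_le hC hL
  refine ⟨C * L, hCL, ?_⟩
  intro R hR e i hei hiJ α hα b
  have hRR : (1:ℝ) ≤ R := by exact_mod_cast hR
  have hD : (2:ℕ) ^ (l+1) ≠ 0 := by positivity
  have h1 := (hb (R ^ J) (R ^ i) α b (by positivity) (by positivity) (Nat.pow_dvd_pow R hiJ)).resolve_right hα
  change ‖SS F (R ^ J) α b‖ ^ _ * _ ≤ _ at h1
  have h2 := hlog R hR
  rw [le_div_iff₀ (by positivity)]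
  rw [← pow_le_pow_iff_left₀ (by positivity) (by positivity) hD]
  generalize hDD : (2:ℕ) ^ (l+1) = D at *
  push_cast at h1 h2
  have hexp : i * (l+1) * 2 * D + e * 2 * D ≤ i * n := by
    calc _ ≤ i * (2 * D * (l+1)) + i * 2 := by nlinarith
      _ ≤ i * n := by rw [← mul_add]; exact Nat.mul_le_mul_left _ hn
  calc (‖SS F (R ^ J) α b‖ * (((R:ℝ) ^ i) ^ (l+1)) ^ 2 * ((R:ℝ) ^ e) ^ 2) ^ D
      = ‖SS F (R ^ J) α b‖ ^ D * (R:ℝ) ^ (i * (l+1) * 2 * D + e * 2 * D) := by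
        rw [mul_pow, mul_pow, pow_add, ← pow_mul, ← pow_mul, ← pow_mul, ← pow_mul, ← pow_mul]; ring
    _ ≤ ‖SS F (R ^ J) α b‖ ^ D * (R:ℝ) ^ (i * n) := by
        apply mul_le_mul_of_nonneg_left (pow_le_pow_right₀ hRR hexp) (by positivity)
    _ ≤ C * (((R:ℝ) ^ J) ^ (n * D) * (L * R)) := by
        rw [pow_mul]
        refine h1.trans ?_
        apply mul_le_mul_of_nonneg_left _ (by positivity)
        exact mul_le_mul_of_nonneg_left h2 (by positivity)
    _ = (C * L) * ((((R:ℝ) ^ J) ^ n) ^ D * R) := by rw [pow_mul]; ring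
    _ ≤ (C * L) ^ D * ((((R:ℝ) ^ J) ^ n) ^ D * (R:ℝ) ^ D) := by
        gcongr
        · exact le_self_pow₀ hCL hD
        · exact le_self_pow₀ hRR hD
    _ = _ := by rw [← mul_pow, ← mul_pow]

lemma SS_triv (F : MvPolynomial (Fin n) ℤ) (P : ℕ) (hP : 0 < P) (α b) : ‖SS F P α b‖ ≤ 3 ^ n * (P:ℝ) ^ n := by
  have hPR : (1:ℝ) ≤ P := by exact_mod_cast hP
  unfold SS
  calc _ ≤ ∑ x ∈ box n P, (1:ℝ) := (norm_sum_le _ _).trans (Finset.sum_le_sum fun x _ => (norm_ee _).le)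
    _ = (2 * P + 1) ^ n := by rw [Finset.sum_const, card_box, nsmul_eq_mul]; push_cast; ring
    _ ≤ _ := by rw [← mul_pow]; gcongr; linarith

lemma mean (F : MvPolynomial (Fin n) ℤ) (l J : ℕ) (C C2 : ℝ) (hC : 1 ≤ C) (hC2 : 1 ≤ C2)
    (h : ∀ R : ℕ, 0 < R → ∀ e i : ℕ, 2 ^ (l+1) * e ≤ i → i ≤ J → ∀ α,
      ¬ Arc C l (R ^ J) (R ^ i) α → ∀ b, ‖SS F (R ^ J) α b‖ * (((R:ℝ) ^ i) ^ (l+1)) ^ 2 ≤ C2 * (((R:ℝ) ^ J) ^ n * R) / ((R:ℝ) ^ e) ^ 2) :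
    ∃ C3 : ℝ, 0 ≤ C3 ∧ ∀ R M : ℕ, 0 < R → (R ^ J) ^ (l+2) ≤ M → ∀ s, ∑ k ∈ Finset.range M, ‖SS F (R ^ J) ((k:ℝ) / M - s) 0‖ ≤
      C3 * (((R:ℝ) ^ J) ^ n * R * ((R:ℝ) ^ (l+1)) ^ 2 * (M / ((R:ℝ) ^ J) ^ (l+2))) := by
  classical
  set K := 8 * C + 4 * C ^ 2 with hK
  have hK0 : 0 ≤ K := by positivity
  refine ⟨K * 3 ^ n + J * K * C2, by positivity, ?_⟩
  intro R M hR hM s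
  have hRR : (1:ℝ) ≤ R := by exact_mod_cast hR
  rw [← Finset.sum_filter_add_sum_filter_not (Finset.range M) (fun k : ℕ => Arc C l (R ^ J) (R ^ 0) ((k:ℝ) / M - s)), add_mul]
  apply add_le_add
  · have hc := arc_count C hC l (R ^ J) (R ^ 0) M (by positivity) (Nat.pow_le_pow_right hR (Nat.zero_le _)) hM s
    rw [pow_zero, Nat.cast_one, one_pow, one_pow, mul_one] at hc
    calc _ ≤ ∑ k ∈ (Finset.range M).filter (fun k : ℕ => Arc C l (R ^ J) (R ^ 0) ((k:ℝ) / M - s)), 3 ^ n * ((R:ℝ) ^ J) ^ n := by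
          apply Finset.sum_le_sum; intro k _
          have := SS_triv F (R ^ J) (by positivity) ((k:ℝ) / M - s) 0
          push_cast at this; exact this
      _ ≤ (K * (M / ((R ^ J : ℕ):ℝ) ^ (l+2))) * (3 ^ n * ((R:ℝ) ^ J) ^ n) := by
          rw [Finset.sum_const, nsmul_eq_mul, pow_zero]
          exact mul_le_mul_of_nonneg_right hc (by positivity)
      _ = K * 3 ^ n * (((R:ℝ) ^ J) ^ n * 1 * 1 * (M / ((R:ℝ) ^ J) ^ (l+2))) := by push_cast; ring
      _ ≤ _ := by
        gcongr
        exact one_le_pow₀ (one_le_pow₀ hRR)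
  · have := slice C hC l R J 0 M hR (Nat.zero_le _) hM s (C2 * (((R:ℝ) ^ J) ^ n * R)) (by positivity) (fun α => ‖SS F (R ^ J) α 0‖) (by
      intro i _ hi α hα
      have := h R hR 0 i (by simp) hi.le α hα 0
      simpa using this)
    refine this.trans (le_of_eq ?_)
    rw [hK]; ring

end
end BirchThin

namespace BirchThin
section
variable {n : ℕ}

lemma geo_range (m : ℕ) (hm : 0 < m) (c : ℤ) : ∑ t ∈ Finset.range m, ee (t * ((c:ℝ) / m)) = if (m:ℤ) ∣ c then (m:ℂ) else 0 := by
  have hmR : (m:ℝ) ≠ 0 := by exact_mod_cast hm.ne'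
  simp_rw [ee_nmul]
  split_ifs with h
  · obtain ⟨k, rfl⟩ := h
    have : (((m:ℤ) * k : ℤ) : ℝ) / m = (k:ℤ) := by push_cast; field_simp
    rw [this, ee_int]; simp
  · have hw : ee ((c:ℝ) / m) ≠ 1 := by
      intro hh
      unfold ee at hh
      rw [Complex.exp_eq_one_iff] at hh
      obtain ⟨k, hk⟩ := hh
      apply h
      refine ⟨k, ?_⟩
      have h1 : ((c:ℝ) / m : ℂ) = k := by
        have hpi : (2 * Real.pi * Complex.I : ℂ) ≠ 0 := Complex.two_pi_I_ne_zero
        apply mul_left_cancel₀ hpi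
        rw [mul_comm _ (k:ℂ), ← hk]; push_cast; ring
      have h2 : (c:ℝ) / m = k := by exact_mod_cast h1
      rw [div_eq_iff hmR] at h2
      have h3 : c = k * m := by exact_mod_cast h2
      rw [h3, mul_comm]
    have h1 := mul_geom_sum (ee ((c:ℝ) / m)) m
    rw [← ee_nmul, mul_div_cancel₀ _ hmR, ee_int, sub_self] at h1
    exact (mul_eq_zero.mp h1).resolve_left (sub_ne_zero.mpr hw)

lemma geo_Ico (m : ℕ) (hm : 0 < m) (c : ℤ) : ∑ t ∈ Finset.Ico (0:ℤ) m, ee (t * ((c:ℝ) / m)) = if (m:ℤ) ∣ c then (m:ℂ) else 0 := by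
  rw [← geo_range m hm]
  symm
  apply Finset.sum_nbij' (fun t : ℕ => (t:ℤ)) Int.toNat
  · intro a ha; rw [Finset.mem_range] at ha; rw [Finset.mem_Ico]; omega
  · intro a ha; rw [Finset.mem_Ico] at ha; rw [Finset.mem_range]; omega
  · intro a ha; simp
  · intro a ha; rw [Finset.mem_Ico] at ha; exact Int.toNat_of_nonneg ha.1
  · intro a _; rw [Int.cast_natCast]

open Classical in
lemma cube_ee (m : ℕ) (hm : 0 < m) (c : Fin n → ℤ) : ∑ b ∈ ibox (fun _ => 0) (fun _ => (m:ℤ)), ee (dt b (fun i => (c i : ℝ) / m)) =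
    if ∀ i, (m:ℤ) ∣ c i then (m:ℂ) ^ n else 0 := by
  rw [sum_ibox_ee]
  simp_rw [geo_Ico m hm]
  split_ifs with h
  · rw [Finset.prod_congr rfl (fun i _ => if_pos (h i))]; simp
  · push Not at h
    obtain ⟨i, hi⟩ := h
    exact Finset.prod_eq_zero (Finset.mem_univ i) (if_neg hi)

def cz (p : ℕ) (x : Fin n → ℤ) : Fin n → ZMod p := fun i => (x i : ZMod p)

lemma sum_ibox_cast {A : Type*} [AddCommMonoid A] (p : ℕ) [NeZero p] (f : (Fin n → ZMod p) → A) :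
    ∑ z ∈ ibox (fun _ => 0) (fun _ => (p:ℤ)), f (cz p z) = ∑ y, f y := by
  apply Finset.sum_nbij' (cz p) (fun y i => ((y i).val : ℤ))
  · intros; simp
  · intro y _; rw [mem_ibox]; intro i
    have := ZMod.val_lt (y i); omega
  · intro z hz
    rw [mem_ibox] at hz
    ext i
    have h0 := (hz i).1
    simp only [cz]
    rw [ZMod.val_intCast, Int.emod_eq_of_lt h0 (hz i).2]
  · intro y _; ext i; simp [cz]
  · intros; rfl

open Classical in
def SZ (F : MvPolynomial (Fin n) ℤ) (P p : ℕ) (Z : Finset (Fin n → ZMod p)) (α : ℝ) : ℂ :=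
  ∑ x ∈ box n P, if cz p x ∈ Z then ee (α * (eval x F : ℤ)) else 0

lemma cz_eq_iff (p : ℕ) (x z : Fin n → ℤ) : (∀ i, (p:ℤ) ∣ (x - z) i) ↔ cz p z = cz p x := by
  constructor
  · intro h; ext i
    exact (ZMod.intCast_eq_intCast_iff_dvd_sub _ _ _).mpr (h i)
  · intro h i
    exact (ZMod.intCast_eq_intCast_iff_dvd_sub _ _ _).mp (congrFun h i)

lemma fourier (F : MvPolynomial (Fin n) ℤ) (P p : ℕ) [NeZero p] (Z : Finset (Fin n → ZMod p)) (α W : ℝ) (hW : ∀ b, ‖SS F P α b‖ ≤ W) :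
    ‖SZ F P p Z α‖ ≤ (p:ℝ) ^ n * W := by
  classical
  have hp : 0 < p := Nat.pos_of_ne_zero (NeZero.ne p)
  set I : Finset (Fin n → ℤ) := ibox (fun _ => 0) (fun _ => (p:ℤ)) with hI
  have key : (p:ℂ) ^ n * SZ F P p Z α = ∑ b ∈ I, ∑ z ∈ I, if cz p z ∈ Z then ee (-(dt z (fun i => (b i : ℝ) / p))) * SS F P α (fun i => (b i : ℝ) / p) else 0 := by
    unfold SZ SS
    rw [Finset.mul_sum]
    have e1 : ∀ x, (p:ℂ) ^ n * (if cz p x ∈ Z then ee (α * (eval x F : ℤ)) else 0) =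
        ∑ z ∈ I, ∑ b ∈ I, if cz p z ∈ Z then ee (-(dt z (fun i => (b i : ℝ) / p))) * ee (α * (eval x F : ℤ) + dt x (fun i => (b i : ℝ) / p)) else 0 := by
      intro x
      have e2 : ∀ z, (∑ b ∈ I, if cz p z ∈ Z then ee (-(dt z (fun i => (b i : ℝ) / p))) * ee (α * (eval x F : ℤ) + dt x (fun i => (b i : ℝ) / p)) else 0) =
          (fun y => if y ∈ Z then (if y = cz p x then ee (α * (eval x F : ℤ)) * (p:ℂ) ^ n else 0) else 0) (cz p z) := by
        intro z
        dsimp only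
        split_ifs with h1 h2
        · have h3 := cube_ee p hp (x - z)
          rw [if_pos ((cz_eq_iff p x z).mpr h2)] at h3
          rw [← h3, Finset.mul_sum]
          apply Finset.sum_congr rfl; intro b _
          rw [← ee_add, ← ee_add]; congr 1
          rw [show -dt z (fun i => (b i : ℝ) / p) + (α * (eval x F : ℤ) + dt x (fun i => (b i : ℝ) / p)) = α * (eval x F : ℤ) + (dt x (fun i => (b i : ℝ) / p) - dt z (fun i => (b i : ℝ) / p)) by ring, ← dt_sub_left]
          unfold dt; congr 1
          apply Finset.sum_congr rfl; intro i _; ring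
        · have h3 := cube_ee p hp (x - z)
          rw [if_neg (fun h => h2 ((cz_eq_iff p x z).mp h))] at h3
          rw [← mul_zero (ee (α * (eval x F : ℤ))), ← h3, Finset.mul_sum]
          apply Finset.sum_congr rfl; intro b _
          rw [← ee_add, ← ee_add]; congr 1
          rw [show -dt z (fun i => (b i : ℝ) / p) + (α * (eval x F : ℤ) + dt x (fun i => (b i : ℝ) / p)) = α * (eval x F : ℤ) + (dt x (fun i => (b i : ℝ) / p) - dt z (fun i => (b i : ℝ) / p)) by ring, ← dt_sub_left]
          unfold dt; congr 1
          apply Finset.sum_congr rfl; intro i _; ring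
        · simp
      rw [Finset.sum_congr rfl fun z _ => e2 z, sum_ibox_cast p (fun y => if y ∈ Z then (if y = cz p x then ee (α * (eval x F : ℤ)) * (p:ℂ) ^ n else 0) else 0)]
      simp_rw [← ite_and, and_comm (a := _ ∈ Z)]
      simp_rw [ite_and]
      rw [Finset.sum_ite_eq']
      simp only [Finset.mem_univ, if_true]
      split_ifs <;> ring
    rw [Finset.sum_congr rfl fun x _ => e1 x, Finset.sum_comm]
    rw [Finset.sum_congr rfl fun z _ => Finset.sum_comm, Finset.sum_comm]
    apply Finset.sum_congr rfl; intro b _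
    apply Finset.sum_congr rfl; intro z _
    split_ifs
    · rw [Finset.mul_sum]
    · simp
  have hW0 : 0 ≤ W := (norm_nonneg _).trans (hW 0)
  have h1 : ‖(p:ℂ) ^ n * SZ F P p Z α‖ ≤ (p:ℝ) ^ n * ((p:ℝ) ^ n * W) := by
    rw [key]
    calc _ ≤ ∑ b ∈ I, ∑ z ∈ I, W := by
          refine (norm_sum_le _ _).trans (Finset.sum_le_sum fun b _ => (norm_sum_le _ _).trans (Finset.sum_le_sum fun z _ => ?_))
          split_ifs
          · rw [norm_mul, norm_ee, one_mul]; exact hW _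
          · simpa using hW0
      _ = _ := by
        rw [Finset.sum_const, Finset.sum_const, hI, card_ibox, nsmul_eq_mul, nsmul_eq_mul]; push_cast; ring
  rw [norm_mul, norm_pow, Complex.norm_natCast] at h1
  exact le_of_mul_le_mul_left h1 (by positivity)

end
end BirchThin

namespace BirchThin
section
variable {n : ℕ}

lemma lip (F : MvPolynomial (Fin n) ℤ) (d : ℕ) (hF : F.totalDegree ≤ d) : ∃ C : ℕ, ∀ P m : ℕ, 0 < P → m ≤ P →
    ∀ x ∈ box n P, ∀ r ∈ box n m, |eval x F| ≤ C * (P:ℤ) ^ d ∧ |eval (x + r) F| ≤ C * (P:ℤ) ^ d ∧ P * |eval (x + r) F - eval x F| ≤ C * m * (P:ℤ) ^ d := by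
  refine poly_closure (fun d f => ∃ C : ℕ, ∀ P m : ℕ, 0 < P → m ≤ P →
    ∀ x ∈ box n P, ∀ r ∈ box n m, |f x| ≤ C * (P:ℤ) ^ d ∧ |f (x + r)| ≤ C * (P:ℤ) ^ d ∧ P * |f (x + r) - f x| ≤ C * m * (P:ℤ) ^ d) ?_ ?_ ?_ ?_ ?_ F d hF
  · rintro k l f hkl ⟨C, hC⟩
    refine ⟨C, fun P m hP hm x hx r hr => ?_⟩
    obtain ⟨h1, h2, h3⟩ := hC P m hP hm x hx r hr
    have : (P:ℤ) ^ k ≤ (P:ℤ) ^ l := pow_le_pow_right₀ (by exact_mod_cast hP) hkl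
    exact ⟨h1.trans (by gcongr), h2.trans (by gcongr), h3.trans (by gcongr)⟩
  · intro c
    refine ⟨c.natAbs, fun P m hP hm x hx r hr => ?_⟩
    refine ⟨by simp, by simp, ?_⟩
    simp only [sub_self, abs_zero, mul_zero]; positivity
  · intro i
    refine ⟨2, fun P m hP hm x hx r hr => ?_⟩
    have h1 := mem_box.mp hx i
    have h2 := mem_box.mp hr i
    have h3 := abs_add_le (x i) (r i)
    have h4 : (m:ℤ) ≤ P := by exact_mod_cast hm
    simp only [Pi.add_apply, pow_one, add_sub_cancel_left]
    refine ⟨by push_cast; linarith [abs_nonneg (x i)], by push_cast; linarith, ?_⟩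
    push_cast
    nlinarith [abs_nonneg (r i)]
  · rintro k f g ⟨C, hC⟩ ⟨D, hD⟩
    refine ⟨C + D, fun P m hP hm x hx r hr => ?_⟩
    obtain ⟨h1, h2, h3⟩ := hC P m hP hm x hx r hr
    obtain ⟨g1, g2, g3⟩ := hD P m hP hm x hx r hr
    simp only [Pi.add_apply]
    push_cast
    refine ⟨(abs_add_le _ _).trans (by linarith), (abs_add_le _ _).trans (by linarith), ?_⟩
    rw [show f (x + r) + g (x + r) - (f x + g x) = (f (x + r) - f x) + (g (x + r) - g x) by ring]
    have := mul_le_mul_of_nonneg_left (abs_add_le (f (x + r) - f x) (g (x + r) - g x)) (by positivity : (0:ℤ) ≤ P)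
    linarith
  · rintro k l f g ⟨C, hC⟩ ⟨D, hD⟩
    refine ⟨2 * (C * D), fun P m hP hm x hx r hr => ?_⟩
    obtain ⟨h1, h2, h3⟩ := hC P m hP hm x hx r hr
    obtain ⟨g1, g2, g3⟩ := hD P m hP hm x hx r hr
    simp only [Pi.mul_apply]
    have z : ∀ a b : ℤ, |a| ≤ C * (P:ℤ) ^ k → |b| ≤ D * (P:ℤ) ^ l → |a * b| ≤ (2 * (C * D) : ℕ) * (P:ℤ) ^ (k + l) := by
      intro a b ha hb
      rw [abs_mul]
      calc _ ≤ (C * (P:ℤ) ^ k) * (D * (P:ℤ) ^ l) := mul_le_mul ha hb (abs_nonneg _) (by positivity)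
        _ = (C * D) * (P:ℤ) ^ (k + l) := by ring
        _ ≤ _ := by
          push_cast
          have : 0 ≤ (C * D : ℤ) * (P:ℤ) ^ (k + l) := by positivity
          linarith
    refine ⟨z _ _ h1 g1, z _ _ h2 g2, ?_⟩
    rw [show f (x + r) * g (x + r) - f x * g x = f (x + r) * (g (x + r) - g x) + (f (x + r) - f x) * g x by ring]
    calc _ ≤ (P:ℤ) * (|f (x + r)| * |g (x + r) - g x| + |f (x + r) - f x| * |g x|) := by
          rw [← abs_mul, ← abs_mul]; exact mul_le_mul_of_nonneg_left (abs_add_le _ _) (by positivity)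
      _ = |f (x + r)| * (P * |g (x + r) - g x|) + (P * |f (x + r) - f x|) * |g x| := by ring
      _ ≤ (C * (P:ℤ) ^ k) * (D * m * (P:ℤ) ^ l) + (C * m * (P:ℤ) ^ k) * (D * (P:ℤ) ^ l) := by gcongr
      _ = _ := by push_cast; ring

lemma pow_diff (x y : ℝ) (h0 : 0 ≤ y) (h : y ≤ x) (n : ℕ) : x * (x ^ n - y ^ n) ≤ n * (x - y) * x ^ n := by
  induction n with
  | zero => simp
  | succ n ih =>
    have h1 : y ^ n ≤ x ^ n := pow_le_pow_left₀ h0 h n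
    have hx : 0 ≤ x := h0.trans h
    have h2 := mul_le_mul_of_nonneg_left ih hx
    have h3 := mul_le_mul_of_nonneg_left h1 (mul_nonneg hx (sub_nonneg.mpr h))
    push_cast
    calc x * (x ^ (n+1) - y ^ (n+1)) = x * (x * (x ^ n - y ^ n)) + x * (x - y) * y ^ n := by ring
      _ ≤ x * (n * (x - y) * x ^ n) + x * (x - y) * x ^ n := add_le_add h2 h3
      _ = _ := by ring

lemma sub_norm {ι : Type*} [DecidableEq ι] (S I : Finset ι) (h : I ⊆ S) (f : ι → ℂ) (hf : ∀ x, ‖f x‖ ≤ 2) :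
    ‖∑ x ∈ S, f x - ∑ x ∈ I, f x‖ ≤ 2 * (S.card - I.card) := by
  rw [← Finset.sum_sdiff h, add_sub_cancel_right]
  calc _ ≤ ∑ x ∈ S \ I, (2:ℝ) := (norm_sum_le _ _).trans (Finset.sum_le_sum fun x _ => hf x)
    _ = _ := by
      rw [Finset.sum_const, nsmul_eq_mul, Finset.card_sdiff_of_subset h, Nat.cast_sub (Finset.card_le_card h)]; ring

lemma box_shift (P m : ℕ) (hP : 0 < P) (hm : m ≤ P) (f : (Fin n → ℤ) → ℂ) (hf : ∀ x, ‖f x‖ ≤ 2) (r : Fin n → ℤ) (hr : r ∈ box n m) :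
    ‖∑ x ∈ box n P, f x - ∑ x ∈ box n P, f (x + r)‖ ≤ 8 * n * 3 ^ n * (m * ((P:ℝ) ^ n / P)) := by
  classical
  have hPR : (1:ℝ) ≤ P := by exact_mod_cast hP
  have hmR : (m:ℝ) ≤ P := by exact_mod_cast hm
  have e : ∑ x ∈ box n P, f (x + r) = ∑ x ∈ (box n P).map (addRightEmbedding r), f x := by
    rw [Finset.sum_map]; rfl
  have h1 := sub_norm (box n P) (box n (P - m)) (by
    intro x hx; rw [mem_box] at hx ⊢; intro i; have := hx i; omega) f hf
  have h2 := sub_norm ((box n P).map (addRightEmbedding r)) (box n (P - m)) (by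
    intro x hx
    rw [Finset.mem_map]
    refine ⟨x - r, ?_, by simp⟩
    rw [mem_box] at hx hr ⊢; intro i
    have h1 := hx i
    have h2 := hr i
    have := abs_sub (x i) (r i)
    simp only [Pi.sub_apply]; omega) f hf
  rw [Finset.card_map] at h2
  have h3 : ((box n P).card : ℝ) - (box n (P - m)).card ≤ 2 * n * 3 ^ n * (m * ((P:ℝ) ^ n / P)) := by
    rw [card_box, card_box]
    push_cast [Nat.cast_sub hm]
    have := pow_diff (2 * P + 1) (2 * (P - m) + 1) (by linarith) (by have : (0:ℝ) ≤ m := by positivity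
                                                                     linarith) n
    have hx : (2 * (P:ℝ) + 1) ^ n ≤ 3 ^ n * P ^ n := by rw [← mul_pow]; gcongr; linarith
    have hd : 0 ≤ (2 * (P:ℝ) + 1) ^ n - (2 * (P - m) + 1) ^ n :=
      sub_nonneg.mpr (pow_le_pow_left₀ (by linarith) (by have : (0:ℝ) ≤ m := by positivity
                                                         linarith) n)
    rw [show 2 * n * 3 ^ n * (m * ((P:ℝ) ^ n / P)) = (n * (2 * m) * (3 ^ n * P ^ n)) / P by ring, le_div_iff₀ (by positivity)]
    calc _ ≤ (2 * (P:ℝ) + 1) * ((2 * (P:ℝ) + 1) ^ n - (2 * (P - m) + 1) ^ n) := by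
          rw [mul_comm]; apply mul_le_mul_of_nonneg_right _ hd; linarith
      _ ≤ _ := this
      _ = n * (2 * m) * (2 * (P:ℝ) + 1) ^ n := by ring
      _ ≤ _ := by gcongr
  rw [e]
  calc _ ≤ ‖∑ x ∈ box n P, f x - ∑ x ∈ box n (P - m), f x‖ + ‖∑ x ∈ box n (P - m), f x - ∑ x ∈ (box n P).map (addRightEmbedding r), f x‖ := norm_sub_le_norm_sub_add_norm_sub _ _ _
    _ ≤ _ := by rw [norm_sub_rev (∑ x ∈ box n (P - m), f x)]; linarith

lemma shift_sum (F : MvPolynomial (Fin n) ℤ) (d : ℕ) (hF : F.totalDegree ≤ d) : ∃ C : ℝ, 0 ≤ C ∧ ∀ (P m : ℕ) (V : Finset (Fin n → ℤ))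
    (ψ : (Fin n → ℤ) → ℂ) (β : ℝ), 0 < P → V.Nonempty → (∀ r ∈ V, r ∈ box n m) → (∀ x, ‖ψ x‖ ≤ 2) → (∀ x, ∑ r ∈ V, ψ (x + r) = 0) →
    ‖∑ x ∈ box n P, ψ x * ee (β * (eval x F : ℤ))‖ ≤ C * (m * ((P:ℝ) ^ n / P) * (|β| * (P:ℝ) ^ d + 1)) := by
  classical
  obtain ⟨L, hL⟩ := lip F d hF
  refine ⟨2 * 3 ^ n + (3 ^ n * (4 * Real.pi * L) + 8 * n * 3 ^ n), by positivity, ?_⟩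
  intro P m V ψ β hP hV hVm hψ hz
  have hPR : (1:ℝ) ≤ P := by exact_mod_cast hP
  set f : (Fin n → ℤ) → ℂ := fun x => ψ x * ee (β * (eval x F : ℤ)) with hf
  have hf2 : ∀ x, ‖f x‖ ≤ 2 := fun x => by rw [hf]; simp only; rw [norm_mul, norm_ee, mul_one]; exact hψ x
  have hbox : ((box n P).card : ℝ) ≤ 3 ^ n * (P:ℝ) ^ n := by
    rw [card_box, ← mul_pow]; push_cast; gcongr; linarith
  set E : ℝ := m * ((P:ℝ) ^ n / P) with hE
  have hE0 : 0 ≤ E := by positivity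
  set Bt : ℝ := |β| * (P:ℝ) ^ d with hBt
  have hBt0 : 0 ≤ Bt := by positivity
  by_cases hm : m ≤ P
  · have hVc : (0:ℝ) < V.card := by exact_mod_cast hV.card_pos
    have h1 : ∀ x ∈ box n P, ‖∑ r ∈ V, f (x + r)‖ ≤ V.card * (4 * Real.pi * L * (Bt * m / P)) := by
      intro x hx
      have e : ∑ r ∈ V, f (x + r) = ∑ r ∈ V, ψ (x + r) * (ee (β * (eval (x + r) F : ℤ)) - ee (β * (eval x F : ℤ))) := by
        simp_rw [mul_sub]; rw [Finset.sum_sub_distrib, ← Finset.sum_mul, hz, zero_mul, sub_zero]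
      rw [e]
      calc _ ≤ ∑ r ∈ V, 4 * Real.pi * L * (Bt * m / P) := by
            refine (norm_sum_le _ _).trans (Finset.sum_le_sum fun r hr => ?_)
            have e2 : ee (β * (eval (x + r) F : ℤ)) - ee (β * (eval x F : ℤ)) = ee (β * (eval x F : ℤ)) * (ee (β * ((eval (x + r) F : ℤ) - (eval x F : ℤ))) - 1) := by
              rw [mul_sub, ← ee_add, mul_one]; congr 2; ring
            rw [norm_mul, e2, norm_mul, norm_ee, one_mul]
            have h3 := ee_sub_one_le (β * ((eval (x + r) F : ℤ) - (eval x F : ℤ)))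
            have h4 := (hL P m hP hm x hx r (hVm r hr)).2.2
            have h5 : |((eval (x + r) F : ℤ) : ℝ) - (eval x F : ℤ)| ≤ L * m * (P:ℝ) ^ d / P := by
              rw [le_div_iff₀ (by positivity), mul_comm]; exact_mod_cast h4
            rw [abs_mul] at h3
            calc _ ≤ 2 * (2 * Real.pi * (|β| * (L * m * (P:ℝ) ^ d / P))) := by
                  apply mul_le_mul (hψ _) (h3.trans _) (norm_nonneg _) (by norm_num)
                  have := mul_le_mul_of_nonneg_left h5 (abs_nonneg β)
                  exact mul_le_mul_of_nonneg_left this (by positivity)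
              _ = _ := by rw [hBt]; ring
        _ = _ := by rw [Finset.sum_const, nsmul_eq_mul]
    have h2 : ‖(V.card : ℂ) * ∑ x ∈ box n P, f x‖ ≤ V.card * ((3 ^ n * (P:ℝ) ^ n) * (4 * Real.pi * L * (Bt * m / P)) + 8 * n * 3 ^ n * E) := by
      have e : (V.card : ℂ) * ∑ x ∈ box n P, f x = ∑ x ∈ box n P, ∑ r ∈ V, f (x + r) + ∑ r ∈ V, (∑ x ∈ box n P, f x - ∑ x ∈ box n P, f (x + r)) := by
        rw [Finset.sum_comm, Finset.sum_sub_distrib, Finset.sum_const, nsmul_eq_mul]; ring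
      rw [e]
      refine (norm_add_le _ _).trans ?_
      rw [mul_add]
      apply add_le_add
      · calc _ ≤ ∑ x ∈ box n P, V.card * (4 * Real.pi * L * (Bt * m / P)) := (norm_sum_le _ _).trans (Finset.sum_le_sum h1)
          _ = (box n P).card * (V.card * (4 * Real.pi * L * (Bt * m / P))) := by rw [Finset.sum_const, nsmul_eq_mul]
          _ ≤ (3 ^ n * (P:ℝ) ^ n) * (V.card * (4 * Real.pi * L * (Bt * m / P))) := mul_le_mul_of_nonneg_right hbox (by positivity)
          _ = _ := by ring
      · calc _ ≤ ∑ r ∈ V, 8 * n * 3 ^ n * E := (norm_sum_le _ _).trans (Finset.sum_le_sum fun r hr => box_shift P m hP hm f hf2 r (hVm r hr))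
          _ = _ := by rw [Finset.sum_const, nsmul_eq_mul]
    rw [norm_mul, Complex.norm_natCast] at h2
    refine (le_of_mul_le_mul_left h2 hVc).trans ?_
    calc _ = 3 ^ n * (4 * Real.pi * L) * (E * Bt) + 8 * n * 3 ^ n * (E * 1) := by rw [hE]; ring
      _ ≤ 3 ^ n * (4 * Real.pi * L) * (E * (Bt + 1)) + 8 * n * 3 ^ n * (E * (Bt + 1)) := by gcongr <;> linarith
      _ ≤ _ := by
        rw [← add_mul]; apply mul_le_mul_of_nonneg_right _ (by positivity)
        have : (0:ℝ) ≤ 2 * 3 ^ n := by positivity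
        linarith
  · push Not at hm
    have hmR : (P:ℝ) ≤ m := by exact_mod_cast hm.le
    calc _ ≤ ∑ x ∈ box n P, (2:ℝ) := (norm_sum_le _ _).trans (Finset.sum_le_sum fun x _ => hf2 x)
      _ = (box n P).card * 2 := by rw [Finset.sum_const, nsmul_eq_mul]
      _ ≤ (3 ^ n * (P:ℝ) ^ n) * 2 := by linarith
      _ = 2 * 3 ^ n * (P * ((P:ℝ) ^ n / P) * (0 + 1)) := by field_simp; ring
      _ ≤ 2 * 3 ^ n * (m * ((P:ℝ) ^ n / P) * (Bt + 1)) := by gcongr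
      _ ≤ _ := by
        rw [← hE]
        apply mul_le_mul_of_nonneg_right _ (by positivity)
        have : (0:ℝ) ≤ 3 ^ n * (4 * Real.pi * L) + 8 * n * 3 ^ n := by positivity
        linarith

end
end BirchThin

namespace BirchThin
section
variable {n : ℕ}

lemma taylor (F : MvPolynomial (Fin n) ℤ) (x v : Fin n → ℤ) (h : ℤ) :
    ∃ c : ℤ, eval (x + h • v) F = eval x F + h * ∑ j, v j * eval x (pderiv j F) + h ^ 2 * c := by
  classical
  induction F using MvPolynomial.induction_on with
  | C a => exact ⟨0, by simp⟩
  | add p q hp hq =>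
    obtain ⟨c, hc⟩ := hp
    obtain ⟨c', hc'⟩ := hq
    refine ⟨c + c', ?_⟩
    simp only [map_add, hc, hc', mul_add, Finset.sum_add_distrib]; ring
  | mul_X p i hp =>
    obtain ⟨c, hc⟩ := hp
    set G := ∑ j, v j * eval x (pderiv j p) with hG
    refine ⟨c * x i + G * v i + h * c * v i, ?_⟩
    have e : ∑ j, v j * eval x (pderiv j (p * X i)) = G * x i + eval x p * v i := by
      simp only [Derivation.leibniz, smul_eq_mul, map_add, map_mul, eval_X, pderiv_X, mul_add, Finset.sum_add_distrib]
      rw [add_comm, hG, Finset.sum_mul]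
      congr 1
      · apply Finset.sum_congr rfl; intro j _; ring
      · rw [Finset.sum_eq_single i]
        · simp; ring
        · intro j _ hj; rw [Pi.single_eq_of_ne (Ne.symm hj)]; simp
        · simp
    rw [e]
    simp only [map_mul, eval_X, hc, Pi.add_apply, Pi.smul_apply, smul_eq_mul]; ring

def cube (p h : ℕ) : Finset (Fin n → ℤ) := (ibox (fun _ => 0) (fun _ => (p:ℤ))).image fun v => (h:ℤ) • v

lemma cube_sum (p h : ℕ) (hh : 0 < h) (f : (Fin n → ℤ) → ℂ) : ∑ r ∈ cube p h, f r = ∑ v ∈ ibox (fun _ => 0) (fun _ => (p:ℤ)), f ((h:ℤ) • v) := by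
  classical
  unfold cube
  rw [Finset.sum_image]
  intro a _ b _ hab
  ext i
  have := congrFun hab i
  simp only [Pi.smul_apply, smul_eq_mul] at this
  exact mul_left_cancel₀ (by exact_mod_cast hh.ne') this

lemma cube_ne (p h : ℕ) (hp : 0 < p) : (cube p h : Finset (Fin n → ℤ)).Nonempty := by
  unfold cube
  apply Finset.Nonempty.image
  exact ⟨fun _ => 0, mem_ibox.mpr fun i => ⟨le_rfl, by exact_mod_cast hp⟩⟩

lemma cube_box (p h m : ℕ) (hm : h * p ≤ m) (r : Fin n → ℤ) (hr : r ∈ cube p h) : r ∈ box n m := by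
  unfold cube at hr
  rw [Finset.mem_image] at hr
  obtain ⟨v, hv, rfl⟩ := hr
  rw [mem_ibox] at hv
  rw [mem_box]; intro i
  have h1 : ((h * p : ℕ) : ℤ) ≤ m := by exact_mod_cast hm
  push_cast at h1
  simp only [Pi.smul_apply, smul_eq_mul]
  rw [abs_of_nonneg (mul_nonneg (by positivity) (hv i).1)]
  have := mul_le_mul_of_nonneg_left (hv i).2.le (by positivity : (0:ℤ) ≤ h)
  linarith

lemma ee_eq_of (s t : ℝ) (m : ℤ) (h : s = t + m) : ee s = ee t := by rw [h, ee_add_int]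

lemma cz_F (F : MvPolynomial (Fin n) ℤ) (p : ℕ) (x : Fin n → ℤ) (h : eval (cz p x) (mP p F) = 0) : (p:ℤ) ∣ eval x F := by
  rw [← ZMod.intCast_zmod_eq_zero_iff_dvd, ← eval_mP]; exact h

lemma caseA (F : MvPolynomial (Fin n) ℤ) (l : ℕ) (Cs : ℝ)
    (hsh : ∀ (P m : ℕ) (V : Finset (Fin n → ℤ))
    (ψ : (Fin n → ℤ) → ℂ) (β : ℝ), 0 < P → V.Nonempty → (∀ r ∈ V, r ∈ box n m) → (∀ x, ‖ψ x‖ ≤ 2) → (∀ x, ∑ r ∈ V, ψ (x + r) = 0) →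
    ‖∑ x ∈ box n P, ψ x * ee (β * (eval x F : ℤ))‖ ≤ Cs * (m * ((P:ℝ) ^ n / P) * (|β| * (P:ℝ) ^ (l+2) + 1)))
    (P p m : ℕ) (hP : 0 < P) [hp : Fact p.Prime] (Z : Finset (Fin n → ZMod p)) (hZ : ∀ y ∈ Z, eval y (mP p F) = 0)
    (q' a1 : ℕ) (a' : ℤ) (hq' : 0 < q') (hpq : ¬ p ∣ q') (hm : q' * p ≤ m) (α β : ℝ) (hα : α = β + ((a1:ℝ) / p + (a':ℝ) / q')) :
    ‖SZ F P p Z α‖ ≤ (Z.card / (p:ℝ) ^ n) * ‖SS F P (α - (a1:ℝ) / p) 0‖ + Cs * (m * ((P:ℝ) ^ n / P) * (|β| * (P:ℝ) ^ (l+2) + 1)) := by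
  classical
  have hp0 : (p:ℝ) ≠ 0 := by exact_mod_cast hp.out.ne_zero
  have hq0 : (q':ℝ) ≠ 0 := by exact_mod_cast hq'.ne'
  set ρ : ℝ := Z.card / (p:ℝ) ^ n with hρ
  have hρ0 : 0 ≤ ρ := by positivity
  have hρ1 : ρ ≤ 1 := by
    have : Z.card ≤ p ^ n := by
      refine (Finset.card_le_univ Z).trans (le_of_eq ?_); simp [ZMod.card]
    rw [hρ, div_le_one (by positivity)]; exact_mod_cast this
  set ψ : (Fin n → ℤ) → ℂ := fun x => ((if cz p x ∈ Z then 1 else 0) - (ρ:ℂ)) * ee ((a':ℝ) / q' * (eval x F : ℤ)) with hψ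
  have hψ2 : ∀ x, ‖ψ x‖ ≤ 2 := by
    intro x
    rw [hψ]; simp only
    rw [norm_mul, norm_ee, mul_one]
    refine (norm_sub_le _ _).trans ?_
    rw [Complex.norm_real, Real.norm_of_nonneg hρ0]
    have : ‖(if cz p x ∈ Z then (1:ℂ) else 0)‖ ≤ 1 := by split_ifs <;> simp
    linarith
  have hsum : ∀ x, ∑ r ∈ cube p q', ψ (x + r) = 0 := by
    intro x
    rw [cube_sum p q' hq']
    have e1 : ∀ v : Fin n → ℤ, ψ (x + (q':ℤ) • v) = (fun y => ((if cz p x + (q' : ZMod p) • y ∈ Z then 1 else 0) - (ρ:ℂ)) * ee ((a':ℝ) / q' * (eval x F : ℤ))) (cz p v) := by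
      intro v
      rw [hψ]; simp only
      have e2 : cz p (x + (q':ℤ) • v) = cz p x + (q' : ZMod p) • cz p v := by
        ext i; simp [cz]
      rw [e2]
      congr 1
      obtain ⟨c, hc⟩ := taylor F x v q'
      apply ee_eq_of _ _ (a' * (∑ j, v j * eval x (pderiv j F) + q' * c))
      rw [hc]; push_cast; field_simp; ring
    rw [Finset.sum_congr rfl fun v _ => e1 v, sum_ibox_cast p (fun y => ((if cz p x + (q' : ZMod p) • y ∈ Z then 1 else 0) - (ρ:ℂ)) * ee ((a':ℝ) / q' * (eval x F : ℤ)))]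
    rw [← Finset.sum_mul, Finset.sum_sub_distrib]
    have hu : (q' : ZMod p) ≠ 0 := by rw [Ne, ZMod.natCast_eq_zero_iff]; exact hpq
    have e3 : ∑ y : Fin n → ZMod p, (if cz p x + (q' : ZMod p) • y ∈ Z then (1:ℂ) else 0) = Z.card := by
      have : Function.Bijective (fun y : Fin n → ZMod p => cz p x + (q' : ZMod p) • y) := by
        rw [Finite.injective_iff_bijective.symm]
        intro a b hab
        exact smul_right_injective _ hu (add_left_cancel hab)
      rw [this.sum_comp (fun y => if y ∈ Z then (1:ℂ) else 0)]
      simp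
    rw [e3, Finset.sum_const, Finset.card_univ, Fintype.card_fun, ZMod.card, Fintype.card_fin, nsmul_eq_mul, hρ]
    push_cast
    have : ((p:ℂ)) ^ n ≠ 0 := pow_ne_zero _ (by exact_mod_cast hp.out.ne_zero)
    rw [mul_div_cancel₀ _ this, sub_self, zero_mul]
  have h1 := hsh P m (cube p q') ψ β hP (cube_ne p q' hp.out.pos) (cube_box p q' m hm) hψ2 hsum
  have e : SZ F P p Z α = ρ * SS F P (α - (a1:ℝ) / p) 0 + ∑ x ∈ box n P, ψ x * ee (β * (eval x F : ℤ)) := by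
    unfold SZ SS
    rw [Finset.mul_sum, ← Finset.sum_add_distrib]
    apply Finset.sum_congr rfl; intro x _
    have e0 : ee ((α - (a1:ℝ) / p) * (eval x F : ℤ) + dt x 0) = ee ((a':ℝ) / q' * (eval x F : ℤ)) * ee (β * (eval x F : ℤ)) := by
      rw [← ee_add]; congr 1; rw [hα]; simp [dt]; ring
    rw [e0, hψ]; simp only
    split_ifs with hx
    · have e4 : ee (α * (eval x F : ℤ)) = ee ((a':ℝ) / q' * (eval x F : ℤ)) * ee (β * (eval x F : ℤ)) := by
        rw [← ee_add]
        obtain ⟨c, hc⟩ := cz_F F p x (hZ _ hx)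
        apply ee_eq_of _ _ (a1 * c)
        rw [hα, hc]; push_cast; field_simp; ring
      rw [e4]; ring
    · ring
  rw [e]
  refine (norm_add_le _ _).trans (add_le_add (le_of_eq ?_) h1)
  rw [norm_mul, Complex.norm_real, Real.norm_of_nonneg hρ0]

lemma caseB (F : MvPolynomial (Fin n) ℤ) (l : ℕ) (Cs : ℝ)
    (hsh : ∀ (P m : ℕ) (V : Finset (Fin n → ℤ))
    (ψ : (Fin n → ℤ) → ℂ) (β : ℝ), 0 < P → V.Nonempty → (∀ r ∈ V, r ∈ box n m) → (∀ x, ‖ψ x‖ ≤ 2) → (∀ x, ∑ r ∈ V, ψ (x + r) = 0) →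
    ‖∑ x ∈ box n P, ψ x * ee (β * (eval x F : ℤ))‖ ≤ Cs * (m * ((P:ℝ) ^ n / P) * (|β| * (P:ℝ) ^ (l+2) + 1)))
    (P p m : ℕ) (hP : 0 < P) [hp : Fact p.Prime] (Z : Finset (Fin n → ZMod p)) (hZ : ∀ y ∈ Z, ∃ j, eval y (mP p (pderiv j F)) ≠ 0)
    (h : ℕ) (a : ℤ) (hh : 0 < h) (hph : p ∣ h) (hpa : ¬ (p:ℤ) ∣ a) (hm : h * p ≤ m) (α β : ℝ) (hα : α = β + (a:ℝ) / (p * h)) :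
    ‖SZ F P p Z α‖ ≤ Cs * (m * ((P:ℝ) ^ n / P) * (|β| * (P:ℝ) ^ (l+2) + 1)) := by
  classical
  have hp0 : (p:ℝ) ≠ 0 := by exact_mod_cast hp.out.ne_zero
  have hh0 : (h:ℝ) ≠ 0 := by exact_mod_cast hh.ne'
  obtain ⟨h', rfl⟩ := hph
  set h := p * h' with hhd
  set ψ : (Fin n → ℤ) → ℂ := fun x => if cz p x ∈ Z then ee ((a:ℝ) / (p * h) * (eval x F : ℤ)) else 0 with hψ
  have hψ2 : ∀ x, ‖ψ x‖ ≤ 2 := by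
    intro x
    rw [hψ]; simp only
    split_ifs
    · rw [norm_ee]; norm_num
    · simp
  have hsum : ∀ x, ∑ r ∈ cube p h, ψ (x + r) = 0 := by
    intro x
    rw [cube_sum p h hh]
    have e2 : ∀ v, cz p (x + (h:ℤ) • v) = cz p x := by
      intro v; ext i; simp [cz, hhd]
    by_cases hx : cz p x ∈ Z
    · have e1 : ∀ v : Fin n → ℤ, ψ (x + (h:ℤ) • v) = ee ((a:ℝ) / (p * h) * (eval x F : ℤ)) * ee (dt v (fun i => ((a * eval x (pderiv i F) : ℤ) : ℝ) / p)) := by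
        intro v
        rw [hψ]; simp only
        rw [e2, if_pos hx, ← ee_add]
        obtain ⟨c, hc⟩ := taylor F x v h
        apply ee_eq_of _ _ (a * h' * c)
        have e5 : dt v (fun i => ((a * eval x (pderiv i F) : ℤ) : ℝ) / p) = (a:ℝ) / p * ∑ j, (v j : ℝ) * ((eval x (pderiv j F) : ℤ) : ℝ) := by
          unfold dt; rw [Finset.mul_sum]; apply Finset.sum_congr rfl; intro i _; push_cast; ring
        rw [e5, hc]; push_cast
        have : (h:ℝ) = p * h' := by rw [hhd]; push_cast; ring
        have hh' : (h':ℝ) ≠ 0 := by intro h0; rw [this, h0, mul_zero] at hh0; exact hh0 rfl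
        rw [this]; field_simp
      rw [Finset.sum_congr rfl fun v _ => e1 v, ← Finset.mul_sum, cube_ee p hp.out.pos (fun i => a * eval x (pderiv i F)), if_neg, mul_zero]
      intro hall
      obtain ⟨j, hj⟩ := hZ _ hx
      apply hj
      have h1 := (Int.Prime.dvd_mul' hp.out (hall j)).resolve_left hpa
      have := eval_mP p x (pderiv j F)
      rw [(ZMod.intCast_zmod_eq_zero_iff_dvd _ _).mpr h1] at this
      exact this
    · apply Finset.sum_eq_zero; intro v _
      rw [hψ]; simp only
      rw [e2, if_neg hx]
  have h1 := hsh P m (cube p h) ψ β hP (cube_ne p h hp.out.pos) (cube_box p h m hm) hψ2 hsum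
  have e : SZ F P p Z α = ∑ x ∈ box n P, ψ x * ee (β * (eval x F : ℤ)) := by
    unfold SZ
    apply Finset.sum_congr rfl; intro x _
    rw [hψ]; simp only
    split_ifs with hx
    · rw [← ee_add]; congr 1; rw [hα]; ring
    · simp
  rw [e]; exact h1

end
end BirchThin

namespace BirchThin
section
variable {n : ℕ}

lemma major_pt (F : MvPolynomial (Fin n) ℤ) (l : ℕ) (C Cs : ℝ) (hC : 1 ≤ C) (hCs : 0 ≤ Cs)
    (hsh : ∀ (P m : ℕ) (V : Finset (Fin n → ℤ))
    (ψ : (Fin n → ℤ) → ℂ) (β : ℝ), 0 < P → V.Nonempty → (∀ r ∈ V, r ∈ box n m) → (∀ x, ‖ψ x‖ ≤ 2) → (∀ x, ∑ r ∈ V, ψ (x + r) = 0) →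
    ‖∑ x ∈ box n P, ψ x * ee (β * (eval x F : ℤ))‖ ≤ Cs * (m * ((P:ℝ) ^ n / P) * (|β| * (P:ℝ) ^ (l+2) + 1)))
    (P p H : ℕ) (hP : 0 < P) (hH : 0 < H) [hp : Fact p.Prime] (Z : Finset (Fin n → ZMod p)) (hZ : ∀ y ∈ Z, eval y (mP p F) = 0)
    (hZ2 : ∀ y ∈ Z, ∃ j, eval y (mP p (pderiv j F)) ≠ 0) (α : ℝ) (hα : Arc C l P H α) :
    ‖SZ F P p Z α‖ ≤ (Z.card / (p:ℝ) ^ n) * ∑ a1 ∈ Finset.range p, ‖SS F P (α - (a1:ℝ) / p) 0‖ + 2 * Cs * C * (p * ((H:ℝ) ^ (l+1)) ^ 2 * ((P:ℝ) ^ n / P)) := by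
  obtain ⟨q, hq, hqC, a, ha⟩ := hα
  have hPR : (1:ℝ) ≤ P := by exact_mod_cast hP
  have hqR : (1:ℝ) ≤ q := by exact_mod_cast hq
  have hHR : (1:ℝ) ≤ H := by exact_mod_cast hH
  have hp0 : (p:ℝ) ≠ 0 := by exact_mod_cast hp.out.ne_zero
  set X : ℝ := (H:ℝ) ^ (l+1) with hX
  have hX1 : 1 ≤ X := one_le_pow₀ hHR
  set r : ℚ := (a:ℚ) / (q:ℚ) with hr
  set q0 := r.den with hq0
  have hq0q : q0 ≤ q := by
    have h1 : (q0:ℤ) ∣ (q:ℤ) := by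
      have := Rat.den_dvd a q
      rwa [Rat.divInt_eq_div, Int.cast_natCast] at this
    exact Nat.le_of_dvd hq (Int.natCast_dvd_natCast.mp h1)
  have hq0pos : 0 < q0 := r.den_pos
  have hrR : (r.num : ℝ) / q0 = (a:ℝ) / q := by
    have h1 : (r:ℝ) = (a:ℝ) / q := by rw [hr]; push_cast; ring
    rw [← h1, hq0]; exact_mod_cast Rat.num_div_den r
  set β : ℝ := α - (r.num : ℝ) / q0 with hβ
  have hβX : |β| * (P:ℝ) ^ (l+2) ≤ X := by
    have h1 : |β| ≤ |q * α - a| := by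
      rw [hβ, hrR, show (q * α - a : ℝ) = q * (α - (a:ℝ) / q) by field_simp, abs_mul, abs_of_pos (by linarith : (0:ℝ) < q)]
      exact le_mul_of_one_le_left (abs_nonneg _) hqR
    exact (mul_le_mul_of_nonneg_right h1 (by positivity)).trans ha
  have herr : Cs * (((q0 * p : ℕ):ℝ) * ((P:ℝ) ^ n / P) * (|β| * (P:ℝ) ^ (l+2) + 1)) ≤ 2 * Cs * C * (p * X ^ 2 * ((P:ℝ) ^ n / P)) := by
    have h1 : (q0:ℝ) ≤ C * X := (Nat.cast_le.mpr hq0q).trans hqC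
    calc _ ≤ Cs * (((C * X) * p) * ((P:ℝ) ^ n / P) * (X + X)) := by push_cast; gcongr
      _ = _ := by ring
  have hsumnn : 0 ≤ (Z.card / (p:ℝ) ^ n) * ∑ a1 ∈ Finset.range p, ‖SS F P (α - (a1:ℝ) / p) 0‖ := by positivity
  have hsingle : ∀ a1 ∈ Finset.range p, (Z.card / (p:ℝ) ^ n) * ‖SS F P (α - (a1:ℝ) / p) 0‖ ≤ (Z.card / (p:ℝ) ^ n) * ∑ a1 ∈ Finset.range p, ‖SS F P (α - (a1:ℝ) / p) 0‖ := by
    intro a1 h1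
    apply mul_le_mul_of_nonneg_left _ (by positivity)
    exact Finset.single_le_sum (f := fun a1 : ℕ => ‖SS F P (α - (a1:ℝ) / p) 0‖) (fun _ _ => norm_nonneg _) h1
  by_cases hpq : p ∣ q0
  · obtain ⟨h, hh⟩ := hpq
    have hh0 : 0 < h := by rcases Nat.eq_zero_or_pos h with h0 | h0; (rw [h0] at hh; omega); exact h0
    have hhp : h * p ≤ q0 * p := by
      apply Nat.mul_le_mul_right; rw [hh]; exact Nat.le_mul_of_pos_left _ hp.out.pos
    have hpa : ¬ (p:ℤ) ∣ r.num := by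
      intro hd
      have h1 : p ∣ r.num.natAbs := Int.natCast_dvd.mp hd
      have h2 := Nat.dvd_gcd h1 (⟨h, hh⟩ : p ∣ r.den)
      rw [Nat.Coprime.gcd_eq_one r.reduced] at h2
      exact hp.out.one_lt.ne' (Nat.dvd_one.mp h2)
    have hhR : (h:ℝ) ≠ 0 := by exact_mod_cast hh0.ne'
    have hq0R : (q0:ℝ) = p * h := by exact_mod_cast hh
    by_cases hph : p ∣ h
    · have := caseB F l Cs hsh P p (q0 * p) hP Z hZ2 h r.num hh0 hph hpa hhp α β (by rw [hβ, hq0R]; ring)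
      linarith
    · have hu : (h : ZMod p) ≠ 0 := by rw [Ne, ZMod.natCast_eq_zero_iff]; exact hph
      set a1 : ℕ := ((r.num : ZMod p) / (h : ZMod p)).val with ha1
      have hd : (p:ℤ) ∣ r.num - a1 * h := by
        rw [← ZMod.intCast_zmod_eq_zero_iff_dvd]
        push_cast
        rw [ha1, ZMod.natCast_zmod_val, div_mul_cancel₀ _ hu, sub_self]
      obtain ⟨a', ha'⟩ := hd
      have hnum : (r.num : ℝ) = a1 * h + p * a' := by
        have : r.num = a1 * h + p * a' := by linarith
        exact_mod_cast this
      have := caseA F l Cs hsh P p (q0 * p) hP Z hZ h a1 a' hh0 hph hhp α β (by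
        rw [hβ, hq0R, hnum]; field_simp; ring)
      have h2 := hsingle a1 (Finset.mem_range.mpr (ZMod.val_lt _))
      linarith
  · have := caseA F l Cs hsh P p (q0 * p) hP Z hZ q0 0 r.num hq0pos hpq le_rfl α β (by rw [hβ]; simp)
    have h2 := hsingle 0 (Finset.mem_range.mpr hp.out.pos)
    linarith

end
end BirchThin

namespace BirchThin
section
variable {n : ℕ}

open Classical in
lemma orth (F : MvPolynomial (Fin n) ℤ) (P p M : ℕ) (hM : 0 < M) (Z : Finset (Fin n → ZMod p)) :
    (((box n P).filter fun x => cz p x ∈ Z ∧ eval x F = 0).card : ℝ) * M ≤ ∑ k ∈ Finset.range M, ‖SZ F P p Z ((k:ℝ) / M - 0)‖ := by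
  have h1 : ∑ k ∈ Finset.range M, SZ F P p Z ((k:ℝ) / M - 0) = (((box n P).filter fun x => cz p x ∈ Z ∧ (M:ℤ) ∣ eval x F).card : ℂ) * M := by
    unfold SZ
    rw [Finset.sum_comm, Finset.card_filter, Nat.cast_sum, Finset.sum_mul]
    apply Finset.sum_congr rfl
    intro x _
    by_cases hx : cz p x ∈ Z
    · simp only [hx, if_true, true_and]
      have := geo_range M hM (eval x F)
      have h2 : ∀ k : ℕ, ((k:ℝ) / M - 0) * ((eval x F : ℤ):ℝ) = (k:ℝ) * (((eval x F : ℤ) : ℝ) / M) := fun k => by ring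
      simp_rw [h2]
      rw [this]
      split_ifs <;> simp
    · simp [hx]
  have h2 := norm_sum_le (Finset.range M) (fun k : ℕ => SZ F P p Z ((k:ℝ) / M - 0))
  rw [h1, norm_mul, Complex.norm_natCast, Complex.norm_natCast] at h2
  refine le_trans ?_ h2
  gcongr with x _ _
  intro hx
  rw [hx]; exact dvd_zero _

open Classical in
lemma minor_sum (F : MvPolynomial (Fin n) ℤ) (l J e : ℕ) (C C2 : ℝ) (hC : 1 ≤ C) (hC2 : 1 ≤ C2)
    (h : ∀ R : ℕ, 0 < R → ∀ e i : ℕ, 2 ^ (l+1) * e ≤ i → i ≤ J → ∀ α,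
      ¬ Arc C l (R ^ J) (R ^ i) α → ∀ b, ‖SS F (R ^ J) α b‖ * (((R:ℝ) ^ i) ^ (l+1)) ^ 2 ≤ C2 * (((R:ℝ) ^ J) ^ n * R) / ((R:ℝ) ^ e) ^ 2)
    (he : (2*l+4) * n + 2 * l + 4 ≤ 2 * e) (heJ : 2 ^ (l+1) * e ≤ J)
    (R p M : ℕ) (hR : 0 < R) [Fact p.Prime] (hp : p ≤ 2 * R ^ (2*l+4)) (hM : (R ^ J) ^ (l+2) ≤ M) (Z : Finset (Fin n → ZMod p)) :
    ∑ k ∈ (Finset.range M).filter (fun k : ℕ => ¬ Arc C l (R ^ J) (R ^ (2 ^ (l+1) * e)) ((k:ℝ) / M - 0)), ‖SZ F (R ^ J) p Z ((k:ℝ) / M - 0)‖ ≤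
      (J * (8 * C + 4 * C ^ 2) * 2 ^ n * C2) * (((R:ℝ) ^ J) ^ n * (M / ((R:ℝ) ^ J) ^ (l+2)) / R) := by
  have hRR : (1:ℝ) ≤ R := by exact_mod_cast hR
  have hs := slice C hC l R J (2 ^ (l+1) * e) M hR heJ hM 0 ((p:ℝ) ^ n * (C2 * (((R:ℝ) ^ J) ^ n * R) / ((R:ℝ) ^ e) ^ 2)) (by positivity)
    (fun α => ‖SZ F (R ^ J) p Z α‖) (by
      intro i hi hiJ α hα
      have hX : 0 < (((R:ℝ) ^ i) ^ (l+1)) ^ 2 := by positivity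
      rw [← le_div_iff₀ hX, mul_div_assoc]
      apply fourier
      intro b
      rw [le_div_iff₀ hX]
      exact h R hR e i hi hiJ.le α hα b)
  refine hs.trans ?_
  have hpn : (p:ℝ) ^ n ≤ 2 ^ n * (R:ℝ) ^ ((2*l+4)*n) := by
    rw [pow_mul, ← mul_pow]
    have : (p:ℝ) ≤ 2 * (R:ℝ) ^ (2*l+4) := by exact_mod_cast hp
    gcongr
  have hpow : (R:ℝ) ^ ((2*l+4)*n) * R * ((R:ℝ) ^ (l+1)) ^ 2 / ((R:ℝ) ^ e) ^ 2 ≤ 1 / R := by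
    rw [div_le_div_iff₀ (by positivity) (by positivity), one_mul]
    calc _ = (R:ℝ) ^ ((2*l+4) * n + 2 * l + 4) := by ring
      _ ≤ (R:ℝ) ^ (2 * e) := pow_le_pow_right₀ hRR he
      _ = _ := by ring
  set U := (M:ℝ) / ((R:ℝ) ^ J) ^ (l+2)
  have hU : 0 ≤ U := by positivity
  calc _ ≤ J * ((8 * C + 4 * C ^ 2) * ((2 ^ n * (R:ℝ) ^ ((2*l+4)*n)) * (C2 * (((R:ℝ) ^ J) ^ n * R) / ((R:ℝ) ^ e) ^ 2) * ((R:ℝ) ^ (l+1)) ^ 2 * U)) := by gcongr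
    _ = (J * (8 * C + 4 * C ^ 2) * 2 ^ n * C2) * (((R:ℝ) ^ J) ^ n * U) * ((R:ℝ) ^ ((2*l+4)*n) * R * ((R:ℝ) ^ (l+1)) ^ 2 / ((R:ℝ) ^ e) ^ 2) := by ring
    _ ≤ (J * (8 * C + 4 * C ^ 2) * 2 ^ n * C2) * (((R:ℝ) ^ J) ^ n * U) * (1 / R) := by gcongr
    _ = _ := by ring

open Classical in
lemma major_sum (F : MvPolynomial (Fin n) ℤ) (l J j0 : ℕ) (C Cs C3 K : ℝ) (hC : 1 ≤ C) (hCs : 0 ≤ Cs) (hC3 : 0 ≤ C3) (hK : 0 ≤ K)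
    (hsh : ∀ (P m : ℕ) (V : Finset (Fin n → ℤ))
    (ψ : (Fin n → ℤ) → ℂ) (β : ℝ), 0 < P → V.Nonempty → (∀ r ∈ V, r ∈ box n m) → (∀ x, ‖ψ x‖ ≤ 2) → (∀ x, ∑ r ∈ V, ψ (x + r) = 0) →
    ‖∑ x ∈ box n P, ψ x * ee (β * (eval x F : ℤ))‖ ≤ Cs * (m * ((P:ℝ) ^ n / P) * (|β| * (P:ℝ) ^ (l+2) + 1)))
    (hmean : ∀ R M : ℕ, 0 < R → (R ^ J) ^ (l+2) ≤ M → ∀ s, ∑ k ∈ Finset.range M, ‖SS F (R ^ J) ((k:ℝ) / M - s) 0‖ ≤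
      C3 * (((R:ℝ) ^ J) ^ n * R * ((R:ℝ) ^ (l+1)) ^ 2 * (M / ((R:ℝ) ^ J) ^ (l+2))))
    (hJ : J = (2*l+4) + 4 * (j0 * (l+1)) + 1)
    (R p M : ℕ) (hR : 0 < R) [hpf : Fact p.Prime] (hp1 : R ^ (2*l+4) ≤ p) (hp : p ≤ 2 * R ^ (2*l+4)) (hM : (R ^ J) ^ (l+2) ≤ M) (Z : Finset (Fin n → ZMod p))
    (hZ : ∀ y ∈ Z, eval y (mP p F) = 0)
    (hZ2 : ∀ y ∈ Z, ∃ j, eval y (mP p (pderiv j F)) ≠ 0) (hZc : (Z.card:ℝ) * p ^ 2 ≤ K * p ^ n) :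
    ∑ k ∈ (Finset.range M).filter (fun k : ℕ => Arc C l (R ^ J) (R ^ j0) ((k:ℝ) / M - 0)), ‖SZ F (R ^ J) p Z ((k:ℝ) / M - 0)‖ ≤
      (K * C3 + (8 * C + 4 * C ^ 2) * (2 * Cs * C) * 2) * (((R:ℝ) ^ J) ^ n * (M / ((R:ℝ) ^ J) ^ (l+2)) / R) := by
  have hRR : (1:ℝ) ≤ R := by exact_mod_cast hR
  have hp0 : (0:ℝ) < p := by exact_mod_cast hpf.out.pos
  have hpR : (p:ℝ) ≤ 2 * (R:ℝ) ^ (2*l+4) := by exact_mod_cast hp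
  have hpR1 : (R:ℝ) ^ (2*l+4) ≤ p := by exact_mod_cast hp1
  have hj0 : j0 ≤ J := by
    rw [hJ]; have := Nat.le_mul_of_pos_right j0 (Nat.succ_pos l); simp only [Nat.succ_eq_add_one] at this; omega
  set U := (M:ℝ) / ((R:ℝ) ^ J) ^ (l+2) with hU'
  have hU : 0 ≤ U := by positivity
  set A := (Finset.range M).filter (fun k : ℕ => Arc C l (R ^ J) (R ^ j0) ((k:ℝ) / M - 0)) with hA
  set ρ : ℝ := Z.card / (p:ℝ) ^ n with hρ
  have hρ0 : 0 ≤ ρ := by positivity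
  have hc := arc_count C hC l (R ^ J) (R ^ j0) M (by positivity) (Nat.pow_le_pow_right hR hj0) hM 0
  rw [← hA] at hc
  push_cast at hc
  set E : ℝ := 2 * Cs * C * (p * (((R:ℝ) ^ j0) ^ (l+1)) ^ 2 * (((R:ℝ) ^ J) ^ n / (R:ℝ) ^ J)) with hE
  have hE0 : 0 ≤ E := by positivity
  have hpt : ∀ k ∈ A, ‖SZ F (R ^ J) p Z ((k:ℝ) / M - 0)‖ ≤ ρ * ∑ a1 ∈ Finset.range p, ‖SS F (R ^ J) ((k:ℝ) / M - (a1:ℝ) / p) 0‖ + E := by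
    intro k hk
    rw [hA, Finset.mem_filter] at hk
    have := major_pt F l C Cs hC hCs hsh (R ^ J) p (R ^ j0) (by positivity) (by positivity) Z hZ hZ2 _ hk.2
    push_cast at this
    simpa only [sub_zero] using this
  have hρp : ρ * p * ((R:ℝ) * ((R:ℝ) ^ (l+1)) ^ 2) ≤ K / R := by
    have h1 : ρ * p ≤ K / p := by
      rw [le_div_iff₀ hp0, hρ, div_mul_eq_mul_div, div_mul_eq_mul_div, div_le_iff₀ (by positivity)]
      linarith
    calc ρ * p * ((R:ℝ) * ((R:ℝ) ^ (l+1)) ^ 2) ≤ K / (R:ℝ) ^ (2*l+4) * ((R:ℝ) * ((R:ℝ) ^ (l+1)) ^ 2) := by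
          gcongr
          exact h1.trans (by gcongr)
      _ = K / R := by
          rw [show 2*l+4 = (l+1)*2+1+1 by ring, pow_succ (R:ℝ), pow_succ (R:ℝ), pow_mul]; field_simp
  have hmain : ∑ k ∈ A, ρ * ∑ a1 ∈ Finset.range p, ‖SS F (R ^ J) ((k:ℝ) / M - (a1:ℝ) / p) 0‖ ≤ K * C3 * (((R:ℝ) ^ J) ^ n * U / R) := by
    rw [← Finset.mul_sum, Finset.sum_comm]
    calc _ ≤ ρ * ∑ a1 ∈ Finset.range p, C3 * (((R:ℝ) ^ J) ^ n * R * ((R:ℝ) ^ (l+1)) ^ 2 * U) := by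
          gcongr with a1 _
          refine le_trans ?_ (hmean R M hR hM ((a1:ℝ) / p))
          exact Finset.sum_le_sum_of_subset_of_nonneg (Finset.filter_subset _ _) (fun _ _ _ => norm_nonneg _)
      _ = (ρ * p * ((R:ℝ) * ((R:ℝ) ^ (l+1)) ^ 2)) * (C3 * (((R:ℝ) ^ J) ^ n * U)) := by
          rw [Finset.sum_const, Finset.card_range, nsmul_eq_mul]; ring
      _ ≤ K / R * (C3 * (((R:ℝ) ^ J) ^ n * U)) := by gcongr
      _ = _ := by ring
  have herr : (A.card : ℝ) * E ≤ (8 * C + 4 * C ^ 2) * (2 * Cs * C) * 2 * (((R:ℝ) ^ J) ^ n * U / R) := by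
    set X := ((R:ℝ) ^ j0) ^ (l+1) with hX
    have hX4 : X ^ 4 * (R:ℝ) ^ (2*l+4) / (R:ℝ) ^ J = 1 / R := by
      rw [div_eq_div_iff (by positivity) (by positivity), hJ, hX]; ring
    calc (A.card : ℝ) * E ≤ ((8 * C + 4 * C ^ 2) * (M * X ^ 2 / ((R:ℝ) ^ J) ^ (l+2))) * (2 * Cs * C * ((2 * (R:ℝ) ^ (2*l+4)) * X ^ 2 * (((R:ℝ) ^ J) ^ n / (R:ℝ) ^ J))) := by
          rw [hE]; gcongr
      _ = (8 * C + 4 * C ^ 2) * (2 * Cs * C) * 2 * (((R:ℝ) ^ J) ^ n * U) * (X ^ 4 * (R:ℝ) ^ (2*l+4) / (R:ℝ) ^ J) := by rw [hU']; ring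
      _ = _ := by rw [hX4]; ring
  calc _ ≤ ∑ k ∈ A, (ρ * ∑ a1 ∈ Finset.range p, ‖SS F (R ^ J) ((k:ℝ) / M - (a1:ℝ) / p) 0‖ + E) := Finset.sum_le_sum hpt
    _ = ∑ k ∈ A, (ρ * ∑ a1 ∈ Finset.range p, ‖SS F (R ^ J) ((k:ℝ) / M - (a1:ℝ) / p) 0‖) + A.card * E := by
        rw [Finset.sum_add_distrib, Finset.sum_const, nsmul_eq_mul]
    _ ≤ _ := by rw [add_mul]; exact add_le_add hmain herr

end
end BirchThin

namespace BirchThin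
section
variable {k : ℕ}

open Classical in
lemma combine (F : MvPolynomial (Fin (k+1)) ℤ) (l : ℕ) (hF : F.IsHomogeneous (l+2)) (hs : Smooth F) (hn : 2 * 2 ^ (l+1) * (l+1) + 2 ≤ k + 1)
    (g : MvPolynomial (Fin (k+1)) ℤ) (hng : ¬ mQ F ∣ mQ g) :
    ∃ (C : ℝ) (J R0 : ℕ), 0 ≤ C ∧ 0 < J ∧ 0 < R0 ∧ ∀ R : ℕ, R0 ≤ R →
      (((box (k+1) (R ^ J)).filter fun x => Finset.univ.gcd x = 1 ∧ eval x F = 0 ∧ eval x g = 0).card : ℝ) * ((R:ℝ) ^ J) ^ (l+2) * R ≤ C * ((R:ℝ) ^ J) ^ (k+1) := by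
  have h2l : l + 1 ≤ 2 ^ (l+1) * (l+1) := Nat.le_mul_of_pos_left _ (by positivity)
  have hlk : l + 2 < k + 1 := by
    have : 2 * 2 ^ (l+1) * (l+1) = 2 * (2 ^ (l+1) * (l+1)) := by ring
    omega
  obtain ⟨C, hC, hb⟩ := birch2 F l hF hs hn
  set e := (2*l+4) * (k+1) + 2 * l + 4 with he
  set j0 := 2 ^ (l+1) * e with hj0
  set J := (2*l+4) + 4 * (j0 * (l+1)) + 1 with hJ
  have hj0J : j0 ≤ J := by
    have := Nat.le_mul_of_pos_right j0 (Nat.succ_pos l); simp only [Nat.succ_eq_add_one] at this; omega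
  obtain ⟨C2, hC2, hb2⟩ := hb J
  obtain ⟨C3, hC3, hm⟩ := mean F l J C C2 hC hC2 hb2
  obtain ⟨Cs, hCs, hsh⟩ := shift_sum F (l+2) hF.totalDegree_le
  obtain ⟨K, p0, hK⟩ := Z_count F l hF hs hlk g hng
  obtain ⟨c, hc, hmod⟩ := smooth_modp F l hF hs
  refine ⟨(K * C3 + (8 * C + 4 * C ^ 2) * (2 * Cs * C) * 2) + (J * (8 * C + 4 * C ^ 2) * 2 ^ (k+1) * C2), J, p0 + c.natAbs + 1, by positivity, by omega, by omega, ?_⟩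
  intro R hR0
  have hR : 0 < R := by omega
  have hRR : (1:ℝ) ≤ R := by exact_mod_cast hR
  obtain ⟨p, hpp, hp1, hp2⟩ := Nat.exists_prime_lt_and_le_two_mul (R ^ (2*l+4)) (by positivity)
  have hpR : R < p := lt_of_le_of_lt (Nat.le_self_pow (by omega) R) hp1
  have hpf := Fact.mk hpp
  have hpc := exists_prime_not_dvd c hc p (by omega)
  set Z : Finset (Fin (k+1) → ZMod p) := Finset.univ.filter fun y => (eval y (mP p F) = 0 ∧ eval y (mP p g) = 0) ∧ y ≠ 0 with hZ
  have hZ1 : ∀ y ∈ Z, eval y (mP p F) = 0 := by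
    intro y hy; rw [hZ, Finset.mem_filter] at hy; exact hy.2.1.1
  have hZ2 : ∀ y ∈ Z, ∃ j, eval y (mP p (pderiv j F)) ≠ 0 := by
    intro y hy; rw [hZ, Finset.mem_filter] at hy
    by_contra hcon
    push Not at hcon
    refine hy.2.2 (hmod p hpp hpc y ?_)
    intro j
    rw [← hcon j, mP, mP, pderiv_map]
  have hZc : (Z.card:ℝ) * p ^ 2 ≤ K * p ^ (k+1) := by
    have h1 : Z.card ≤ K * p ^ (k-1) := by
      refine le_trans (Finset.card_le_card ?_) (hK p (by omega))
      intro y hy; rw [hZ, Finset.mem_filter] at hy; rw [Finset.mem_filter]; exact ⟨hy.1, hy.2.1⟩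
    have h2 : Z.card * p ^ 2 ≤ K * p ^ (k+1) := by
      calc _ ≤ K * p ^ (k-1) * p ^ 2 := Nat.mul_le_mul_right _ h1
        _ = _ := by rw [mul_assoc, ← pow_add, show k - 1 + 2 = k + 1 by omega]
    exact_mod_cast h2
  set M := (R ^ J) ^ (l+2) with hM
  have hM0 : 0 < M := by positivity
  have h1 := orth F (R ^ J) p M hM0 Z
  rw [← Finset.sum_filter_add_sum_filter_not (Finset.range M) (fun k : ℕ => Arc C l (R ^ J) (R ^ j0) ((k:ℝ) / M - 0))] at h1
  have h2 := major_sum F l J j0 C Cs C3 K hC hCs hC3 (by positivity) hsh hm hJ R p M hR hp1.le hp2 le_rfl Z hZ1 hZ2 hZc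
  have h3 := minor_sum F l J e C C2 hC hC2 hb2 (by omega) hj0J R p M hR hp2 le_rfl Z
  have h4 := h1.trans (add_le_add h2 h3)
  rw [← add_mul] at h4
  set CC := (K * C3 + (8 * C + 4 * C ^ 2) * (2 * Cs * C) * 2) + (J * (8 * C + 4 * C ^ 2) * 2 ^ (k+1) * C2)
  have hMR : (M:ℝ) = ((R:ℝ) ^ J) ^ (l+2) := by rw [hM]; push_cast; rfl
  rw [hMR, div_self (by positivity), mul_one, ← mul_div_assoc, le_div_iff₀ (by positivity)] at h4
  refine le_trans ?_ h4
  refine mul_le_mul_of_nonneg_right (mul_le_mul_of_nonneg_right (Nat.cast_le.mpr (Finset.card_le_card ?_)) (by positivity)) (by positivity)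
  intro x hx
  simp only [Finset.mem_filter] at hx ⊢
  obtain ⟨hx1, hx2, hx3, hx4⟩ := hx
  refine ⟨hx1, ?_, hx3⟩
  rw [hZ, Finset.mem_filter]
  refine ⟨Finset.mem_univ _, ⟨?_, ?_⟩, ?_⟩
  · unfold cz; rw [eval_mP, hx3, Int.cast_zero]
  · unfold cz; rw [eval_mP, hx4, Int.cast_zero]
  · intro h0
    have hd : (p:ℤ) ∣ Finset.univ.gcd x := by
      apply Finset.dvd_gcd
      intro i _
      exact (ZMod.intCast_zmod_eq_zero_iff_dvd _ _).mp (congrFun h0 i)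
    rw [hx2] at hd
    have := Int.isUnit_iff_natAbs_eq.mp (isUnit_of_dvd_one hd)
    simp at this
    exact hpp.one_lt.ne' this

end
end BirchThin

open BirchThin in
/-- Let `N ≥ 2`, `d ≥ 2` with `N > 2^d(d−1)`, let `F ∈ ℤ[x₀,…,x_N]` be homogeneous of degree
`d` defining a smooth hypersurface, and let `g ∈ ℚ[x₀,…,x_N]` be homogeneous and not
identically zero on the hypersurface.  Then there exist `δ > 0`, `γ ∈ [0,1)` and `C > 0`
such that for all `B ≥ 2` the number of primitive `x ∈ ℤ^{N+1}` with `F(x) = 0`, `g(x) = 0`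
and `‖x‖∞^{N+1−d} ≤ B` is at most `C·B^{1−δ}·(log B)^γ`. -/
theorem stmt8 (N d : ℕ) (hN : 2 ≤ N) (hd : 2 ≤ d) (hNd : 2 ^ d * (d - 1) < N)
    (F : MvPolynomial (Fin (N + 1)) ℤ) (hF : F.IsHomogeneous d)
    (hsmooth : ∀ z : Fin (N + 1) → ℂ, z ≠ 0 →
      eval z (MvPolynomial.map (Int.castRingHom ℂ) F) = 0 →
      ∃ i, eval z (pderiv i (MvPolynomial.map (Int.castRingHom ℂ) F)) ≠ 0)
    (g : MvPolynomial (Fin (N + 1)) ℚ) (e : ℕ) (hg : g.IsHomogeneous e)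
    (hz : ∃ z : Fin (N + 1) → ℂ, z ≠ 0 ∧
      eval z (MvPolynomial.map (Int.castRingHom ℂ) F) = 0 ∧
      eval z (MvPolynomial.map (Rat.castHom ℂ) g) ≠ 0) :
    ∃ δ γ C : ℝ, 0 < δ ∧ 0 ≤ γ ∧ γ < 1 ∧ 0 < C ∧ ∀ B : ℝ, 2 ≤ B →
      (Nat.card {x : Fin (N + 1) → ℤ | IsPrimitiveVec x ∧
        eval x F = 0 ∧
        ((supNorm x : ℝ)) ^ (N + 1 - d) ≤ B ∧
        eval (fun i => ((x i : ℚ))) g = 0} : ℝ)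
      ≤ C * B ^ (1 - δ) * Real.log B ^ γ := by
  classical
  obtain ⟨l, rfl⟩ : ∃ l, d = l + 2 := ⟨d - 2, by omega⟩
  have hn : 2 * 2 ^ (l+1) * (l+1) + 2 ≤ N + 1 := by
    have : 2 ^ (l+2) * (l + 2 - 1) = 2 * 2 ^ (l+1) * (l+1) := by
      rw [show l + 2 - 1 = l + 1 by omega, pow_succ 2 (l+1)]; ring
    omega
  have h2l : l + 1 ≤ 2 ^ (l+1) * (l+1) := Nat.le_mul_of_pos_left _ (by positivity)
  have hlk : l + 2 < N + 1 := by
    have : 2 * 2 ^ (l+1) * (l+1) = 2 * (2 ^ (l+1) * (l+1)) := by ring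
    omega
  obtain ⟨c, G, hc, hG⟩ := clear_denom g
  have hcQ : (c:ℚ) ≠ 0 := by exact_mod_cast hc
  have hng : ¬ mQ F ∣ mQ G := by
    rintro ⟨q, hq⟩
    obtain ⟨z, _, hzF, hzg⟩ := hz
    rw [hG] at hq
    have h1 := congrArg (fun f => eval z (MvPolynomial.map (Rat.castHom ℂ) f)) hq
    simp only [map_mul, mQ, map_map, map_C, eval_C] at h1
    rw [show (Rat.castHom ℂ).comp (Int.castRingHom ℚ) = Int.castRingHom ℂ from RingHom.ext_int _ _, hzF, zero_mul] at h1
    rcases mul_eq_zero.mp h1 with h2 | h2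
    · simp at h2; exact hc h2
    · exact hzg h2
  obtain ⟨C, J, R0, hC, hJ, hR0, hmain⟩ := combine F l hF hsmooth hn G hng
  set t := N + 1 - (l + 2) with ht
  have ht0 : 0 < t := by omega
  have hJt : (0:ℝ) < (J * t : ℕ) := by exact_mod_cast Nat.mul_pos hJ ht0
  refine ⟨1 / (J * t : ℕ), 0, C * (2 * R0) ^ (J * t) + 1, by positivity, le_rfl, one_pos, by positivity, ?_⟩
  intro B hB
  rw [Real.rpow_zero, mul_one]
  have hB0 : 0 < B := by linarith
  set y := B ^ ((1:ℝ) / (J * t : ℕ)) with hy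
  have hy1 : 1 ≤ y := Real.one_le_rpow (by linarith) (by positivity)
  have hyB : y ^ (J * t) = B := by
    rw [hy, ← Real.rpow_natCast, ← Real.rpow_mul hB0.le, one_div, inv_mul_cancel₀ hJt.ne', Real.rpow_one]
  set R := R0 * ⌈y⌉₊ with hR
  have hR0R : (1:ℝ) ≤ R0 := by exact_mod_cast hR0
  have hc1 : y ≤ ⌈y⌉₊ := Nat.le_ceil y
  have hc2 : (⌈y⌉₊:ℝ) < y + 1 := Nat.ceil_lt_add_one (by linarith)
  have hRy : y ≤ R := by rw [hR]; push_cast; nlinarith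
  have hRy2 : (R:ℝ) ≤ 2 * R0 * y := by rw [hR]; push_cast; nlinarith
  have hRR0 : R0 ≤ R := Nat.le_mul_of_pos_right _ (Nat.ceil_pos.mpr (by linarith))
  have hRpos : (0:ℝ) < R := by linarith
  have hm := hmain R hRR0
  set S := (box (N+1) (R ^ J)).filter fun x => Finset.univ.gcd x = 1 ∧ eval x F = 0 ∧ eval x G = 0 with hS
  have hcard : Nat.card {x : Fin (N + 1) → ℤ | IsPrimitiveVec x ∧
        eval x F = 0 ∧ ((supNorm x : ℝ)) ^ t ≤ B ∧ eval (fun i => ((x i : ℚ))) g = 0} ≤ S.card := by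
    rw [← Nat.card_eq_finsetCard S]
    refine Nat.card_mono (t := (S : Set (Fin (N+1) → ℤ))) S.finite_toSet ?_
    rintro x ⟨hx1, hx2, hx3, hx4⟩
    rw [Finset.mem_coe, hS, Finset.mem_filter]
    refine ⟨?_, hx1, hx2, ?_⟩
    · have h1 : (supNorm x : ℝ) ≤ (R:ℝ) ^ J := by
        apply le_of_pow_le_pow_left₀ ht0.ne' (by positivity)
        calc _ ≤ B := hx3
          _ = (y ^ J) ^ t := by rw [← pow_mul, hyB]
          _ ≤ _ := by gcongr
      have h2 : supNorm x ≤ R ^ J := by exact_mod_cast h1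
      rw [mem_box]
      intro i
      have h3 : (x i).natAbs ≤ supNorm x := Finset.le_sup (f := fun i => (x i).natAbs) (Finset.mem_univ i)
      have h4 := h3.trans h2
      rw [Int.abs_eq_natAbs]
      exact_mod_cast h4
    · have h1 := congrArg (eval (fun i => ((x i : ℚ)))) hG
      rw [map_mul, hx4, mul_zero, mQ, eval_map] at h1
      have h2 : eval₂ (Int.castRingHom ℚ) (fun i => ((x i : ℚ))) G = ((eval x G : ℤ) : ℚ) := by
        have := eval₂_comp_left (Int.castRingHom ℚ) (RingHom.id ℤ) x G
        simp only [RingHom.comp_id] at this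
        exact this.symm
      rw [h2] at h1
      exact_mod_cast h1
  have hcardR : (Nat.card {x : Fin (N + 1) → ℤ | IsPrimitiveVec x ∧
        eval x F = 0 ∧ ((supNorm x : ℝ)) ^ t ≤ B ∧ eval (fun i => ((x i : ℚ))) g = 0} : ℝ) ≤ S.card := by exact_mod_cast hcard
  refine hcardR.trans ?_
  have hm2 : (S.card:ℝ) * R ≤ C * ((R:ℝ) ^ J) ^ t := by
    have hQ : 0 < ((R:ℝ) ^ J) ^ (l+2) := by positivity
    refine le_of_mul_le_mul_right ?_ hQ
    calc _ = _ := by ring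
      _ ≤ _ := hm
      _ = _ := by rw [mul_assoc, ← pow_add, show t + (l+2) = N + 1 by omega]
  have hm3 : (S.card:ℝ) * y ≤ C * (2 * R0) ^ (J * t) * B := by
    calc _ ≤ (S.card:ℝ) * R := by gcongr
      _ ≤ _ := hm2
      _ ≤ C * (2 * R0 * y) ^ (J * t) := by rw [← pow_mul]; gcongr
      _ = _ := by rw [mul_pow _ y, hyB]; ring
  rw [Real.rpow_sub hB0, Real.rpow_one, ← hy]
  rw [← mul_div_assoc, le_div_iff₀ (by linarith)]
  nlinarith
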